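/- There exist absolute constants C > 0 and N_0 such that the following holds for all n ≥ N_0. Let (d_1,…,d_n) be positive integers with even sum such that d_max^4 ≤ (d−2)n, and let x = (x_1,…,x_n) be a suitable degree sequence. Then the expected number E τ_d(x) of spanning trees with degree sequence x in a uniformly random graph in Γ_d satisfies E τ_d(x) = H_d · binom((d−1)n, n−2)^{−1} · ( ∏_{j=1}^n binom(d_j−1, x_j−1) ) · exp( (R+d²)²/(4d²) − 1/4 − λ(x) − λ(x)² − (1/n) Σ_{j=1}^n (x_j−1)(d_j−x_j) + E ), where |E| ≤ C·( d_max^4/((d−2)n) + η ) and η = min{ d_max^4/((d−2)² n), d_max³ (log n)/((d−2)n), d_max (d−2) }. -/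

import Mathlib

attribute [local instance] Classical.propDecidable

/-- The number of spanning trees with degree sequence `x` of a simple graph on `Fin n`. -/
noncomputable def spanningTreeCountWithDegrees {n : ℕ} (G : SimpleGraph (Fin n))
    (x : Fin n → ℕ) : ℕ :=
  (Finset.univ.filter (fun T : SimpleGraph (Fin n) =>
    T ≤ G ∧ T.IsTree ∧ ∀ j, T.degree j = x j)).card

section Realizations

variable {V : Type*}

/-- The `0/1` indicator of adjacency. -/
noncomputable def adjInd (G : SimpleGraph V) (a b : V) : ℝ := if G.Adj a b then 1 else 0

/-- The `0/1` indicator of equality. -/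
noncomputable def eqInd (a b : V) : ℝ := if a = b then 1 else 0

/-- The degrees that remain after an edge `uv` is used. -/
noncomputable def dropEdge (g : V → ℝ) (u v : V) : V → ℝ := fun j => g j - eqInd j u - eqInd j v

/-- The graph `X` with the edge `uv` added. -/
def addEdge (X : SimpleGraph V) (u v : V) : SimpleGraph V := X ⊔ SimpleGraph.edge u v

lemma addEdge_adj (X : SimpleGraph V) {u v : V} (huv : u ≠ v) (a b : V) :
    (addEdge X u v).Adj a b ↔ X.Adj a b ∨ (a = u ∧ b = v) ∨ (a = v ∧ b = u) := by
  simp only [addEdge, SimpleGraph.sup_adj, SimpleGraph.edge_adj]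
  constructor
  · rintro (h | h)
    · exact Or.inl h
    · rcases h.1 with h' | h'
      · exact Or.inr (Or.inl ⟨h'.1.symm ▸ rfl, h'.2.symm ▸ rfl⟩)
      · exact Or.inr (Or.inr ⟨h'.1.symm ▸ rfl, h'.2.symm ▸ rfl⟩)
  · rintro (h | ⟨rfl, rfl⟩ | ⟨rfl, rfl⟩)
    · exact Or.inl h
    · right; simp [huv]
    · right; simp [huv.symm]

lemma addEdge_adj_self (X : SimpleGraph V) {u v : V} (huv : u ≠ v) : (addEdge X u v).Adj u v := by
  simp [addEdge_adj X huv]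

lemma adjInd_comm (G : SimpleGraph V) (a b : V) : adjInd G a b = adjInd G b a := by
  simp only [adjInd, G.adj_comm]

lemma adjInd_self (G : SimpleGraph V) (a : V) : adjInd G a a = 0 := by simp [adjInd]

lemma adjInd_nonneg (G : SimpleGraph V) (a b : V) : 0 ≤ adjInd G a b := by
  unfold adjInd; split_ifs <;> norm_num

lemma adjInd_le_one (G : SimpleGraph V) (a b : V) : adjInd G a b ≤ 1 := by
  unfold adjInd; split_ifs <;> norm_num

lemma eqInd_nonneg (a b : V) : 0 ≤ eqInd a b := by
  unfold eqInd; split_ifs <;> norm_num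

lemma adjInd_of_adj {G : SimpleGraph V} {a b : V} (h : G.Adj a b) : adjInd G a b = 1 := by
  simp [adjInd, h]

lemma adjInd_of_not_adj {G : SimpleGraph V} {a b : V} (h : ¬ G.Adj a b) : adjInd G a b = 0 := by
  simp [adjInd, h]

lemma adjInd_addEdge (X : SimpleGraph V) {u v : V} (huv : u ≠ v) (hX : ¬ X.Adj u v) (a b : V) :
    adjInd (addEdge X u v) a b = adjInd X a b + eqInd a u * eqInd b v + eqInd a v * eqInd b u := by
  have hX' : ¬ X.Adj v u := fun h => hX h.symm
  unfold adjInd eqInd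
  rw [addEdge_adj X huv]
  by_cases h1 : a = u <;> by_cases h2 : b = v <;> by_cases h3 : a = v <;> by_cases h4 : b = u <;>
    simp_all

variable [Fintype V]

/-- The simple graphs with degrees `g` that are edge-disjoint from `X`. -/
noncomputable def realizations (g : V → ℝ) (X : SimpleGraph V) : Finset (SimpleGraph V) :=
  Finset.univ.filter fun G => (∀ a b, G.Adj a b → ¬ X.Adj a b) ∧ ∀ v, ∑ b, adjInd G v b = g v

/-- The number of realizations. -/
noncomputable def numReal (g : V → ℝ) (X : SimpleGraph V) : ℝ := ((realizations g X).card : ℝ)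

lemma sum_eqInd_mul (u : V) (f : V → ℝ) : ∑ a, eqInd a u * f a = f u := by
  simp [eqInd]

lemma sum_eqInd (u : V) : ∑ a, eqInd a u = 1 := by
  simp [eqInd]

lemma sum_adjInd (G : SimpleGraph V) (v : V) : ∑ b, adjInd G v b = G.degree v := by
  simp only [adjInd, Finset.sum_boole, ← SimpleGraph.card_neighborFinset_eq_degree]
  congr 2
  ext; simp

lemma sum_adjInd_addEdge (X : SimpleGraph V) {u v : V} (huv : u ≠ v) (hX : ¬ X.Adj u v) (a : V) :
    ∑ b, adjInd (addEdge X u v) a b = ∑ b, adjInd X a b + eqInd a u + eqInd a v := by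
  simp_rw [adjInd_addEdge X huv hX, Finset.sum_add_distrib, ← Finset.mul_sum, sum_eqInd, mul_one]

lemma mem_realizations {g : V → ℝ} {X G : SimpleGraph V} :
    G ∈ realizations g X ↔ (∀ a b, G.Adj a b → ¬ X.Adj a b) ∧ ∀ v, ∑ b, adjInd G v b = g v := by
  simp [realizations]

lemma sum_dropEdge (g : V → ℝ) (u v : V) : ∑ j, dropEdge g u v j = ∑ j, g j - 2 := by
  simp only [dropEdge, Finset.sum_sub_distrib, sum_eqInd]; ring

lemma numReal_nonneg (g : V → ℝ) (X : SimpleGraph V) : 0 ≤ numReal g X := by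
  unfold numReal; positivity

/-- Summing over the realizations that contain `uv` amounts to deleting `uv`. -/
lemma sum_realizations_adj (g : V → ℝ) (X : SimpleGraph V) {u v : V} (huv : u ≠ v)
    (hX : ¬ X.Adj u v) (φ : SimpleGraph V → ℝ) :
    ∑ G ∈ realizations g X, adjInd G u v * φ G =
      ∑ H ∈ realizations (dropEdge g u v) (addEdge X u v), φ (addEdge H u v) := by
  have hX' : ¬ X.Adj v u := fun h => hX h.symm
  have key : ∑ G ∈ realizations g X, adjInd G u v * φ G =
      ∑ G ∈ (realizations g X).filter (fun G => G.Adj u v), φ G := by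
    rw [Finset.sum_filter]
    refine Finset.sum_congr rfl fun G _ => ?_
    unfold adjInd; split_ifs <;> simp
  rw [key]
  symm
  have hH : ∀ H ∈ realizations (dropEdge g u v) (addEdge X u v), ¬ H.Adj u v := fun H hH h =>
    (mem_realizations.1 hH).1 u v h (addEdge_adj_self X huv)
  refine Finset.sum_bij (fun H _ => addEdge H u v) ?_ ?_ ?_ ?_
  · intro H hm
    have hnot := hH H hm
    obtain ⟨h1, h2⟩ := mem_realizations.1 hm
    rw [Finset.mem_filter, mem_realizations]
    refine ⟨⟨?_, ?_⟩, addEdge_adj_self H huv⟩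
    · intro a b hab hx
      rw [addEdge_adj H huv] at hab
      rcases hab with h | ⟨rfl, rfl⟩ | ⟨rfl, rfl⟩
      · exact h1 a b h ((addEdge_adj X huv a b).2 (Or.inl hx))
      · exact hX hx
      · exact hX' hx
    · intro w
      rw [sum_adjInd_addEdge H huv hnot, h2 w]
      simp only [dropEdge]; ring
  · intro H1 m1 H2 m2 heq
    have n1 := hH H1 m1
    have n2 := hH H2 m2
    ext a b
    have := congrArg (fun K : SimpleGraph V => K.Adj a b) heq
    simp only [addEdge_adj H1 huv, addEdge_adj H2 huv, eq_iff_iff] at this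
    have n1' : ¬ H1.Adj v u := fun h => n1 h.symm
    have n2' : ¬ H2.Adj v u := fun h => n2 h.symm
    by_cases c1 : a = u ∧ b = v
    · obtain ⟨rfl, rfl⟩ := c1; simp [n1, n2]
    · by_cases c2 : a = v ∧ b = u
      · obtain ⟨rfl, rfl⟩ := c2; simp [n1', n2']
      · simpa [c1, c2] using this
  · intro G hG
    rw [Finset.mem_filter, mem_realizations] at hG
    obtain ⟨⟨h1, h2⟩, huvG⟩ := hG
    have hvuG := huvG.symm
    let H : SimpleGraph V :=
      { Adj := fun a b => G.Adj a b ∧ ¬ ((a = u ∧ b = v) ∨ (a = v ∧ b = u))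
        symm := ⟨fun a b h => ⟨h.1.symm, fun h' => h.2 (by tauto)⟩⟩
        loopless := ⟨fun a h => G.loopless.irrefl a h.1⟩ }
    have hHuv : ¬ H.Adj u v := fun h => h.2 (Or.inl ⟨rfl, rfl⟩)
    have hadd : addEdge H u v = G := by
      ext a b
      rw [addEdge_adj H huv]
      constructor
      · rintro (h | ⟨rfl, rfl⟩ | ⟨rfl, rfl⟩)
        · exact h.1
        · exact huvG
        · exact hvuG
      · intro h
        by_cases c : (a = u ∧ b = v) ∨ (a = v ∧ b = u)
        · exact Or.inr c
        · exact Or.inl ⟨h, c⟩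
    refine ⟨H, ?_, hadd⟩
    rw [mem_realizations]
    refine ⟨?_, ?_⟩
    · intro a b hab hx
      rw [addEdge_adj X huv] at hx
      rcases hx with hx | hx
      · exact h1 a b hab.1 hx
      · exact hab.2 hx
    · intro w
      have := sum_adjInd_addEdge H huv hHuv w
      rw [hadd, h2 w] at this
      simp only [dropEdge]; linarith
  · intro H _; rfl

/-- Summing over the realizations that miss `uv` amounts to forbidding `uv`. -/
lemma sum_realizations_not_adj (g : V → ℝ) (X : SimpleGraph V) {u v : V} (huv : u ≠ v)
    (φ : SimpleGraph V → ℝ) :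
    ∑ G ∈ realizations g X, (1 - adjInd G u v) * φ G =
      ∑ G ∈ realizations g (addEdge X u v), φ G := by
  have key : ∑ G ∈ realizations g X, (1 - adjInd G u v) * φ G =
      ∑ G ∈ (realizations g X).filter (fun G => ¬ G.Adj u v), φ G := by
    rw [Finset.sum_filter]
    refine Finset.sum_congr rfl fun G _ => ?_
    unfold adjInd; split_ifs <;> simp
  rw [key]
  refine Finset.sum_congr ?_ fun _ _ => rfl
  ext G
  rw [Finset.mem_filter, mem_realizations, mem_realizations]
  constructor
  · rintro ⟨⟨h1, h2⟩, h3⟩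
    refine ⟨fun a b hab hx => ?_, h2⟩
    rw [addEdge_adj X huv] at hx
    rcases hx with hx | ⟨rfl, rfl⟩ | ⟨rfl, rfl⟩
    · exact h1 a b hab hx
    · exact h3 hab
    · exact h3 hab.symm
  · rintro ⟨h1, h2⟩
    exact ⟨⟨fun a b hab hx => h1 a b hab ((addEdge_adj X huv a b).2 (Or.inl hx)), h2⟩,
      fun h => h1 u v h (addEdge_adj_self X huv)⟩

lemma sum_realizations_adjInd (g : V → ℝ) (X : SimpleGraph V) {u v : V} (huv : u ≠ v)
    (hX : ¬ X.Adj u v) :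
    ∑ G ∈ realizations g X, adjInd G u v = numReal (dropEdge g u v) (addEdge X u v) := by
  have := sum_realizations_adj g X huv hX (fun _ => 1)
  simpa [numReal] using this

lemma numReal_eq_add (g : V → ℝ) (X : SimpleGraph V) {u v : V} (huv : u ≠ v)
    (hX : ¬ X.Adj u v) :
    numReal g X = numReal g (addEdge X u v) + numReal (dropEdge g u v) (addEdge X u v) := by
  have h1 := sum_realizations_adjInd g X huv hX
  have h2 := sum_realizations_not_adj g X huv (fun _ => 1)
  simp only [mul_one, Finset.sum_sub_distrib, Finset.sum_const, nsmul_eq_mul] at h2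
  rw [h1] at h2
  unfold numReal at *
  linarith

lemma adjInd_eq_zero_of_mem {g : V → ℝ} {X G : SimpleGraph V} (hG : G ∈ realizations g X)
    {a b : V} (h : X.Adj a b) : adjInd G a b = 0 :=
  adjInd_of_not_adj fun h' => (mem_realizations.1 hG).1 a b h' h

/-- The number of ways to switch a realization that misses `uv` away from `uv`. -/
noncomputable def switchOut (Y H : SimpleGraph V) (u v : V) : ℝ :=
  ∑ a, ∑ b, adjInd H a b * (1 - (eqInd a u + adjInd H u a + adjInd Y u a)) *
    (1 - (eqInd b v + adjInd H v b + adjInd Y v b))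

/-- The number of ways to switch a realization towards `uv`. -/
noncomputable def switchIn (Y G : SimpleGraph V) (u v : V) : ℝ :=
  ∑ a, ∑ b, adjInd G u a * adjInd G v b * (1 - (adjInd G a b + eqInd a b + adjInd Y a b))

end Realizations

section Switching

variable {V : Type*}

lemma adjInd_addEdge_of_ne (H : SimpleGraph V) {u v a b : V} (huv : u ≠ v)
    (h1 : ¬ (a = u ∧ b = v)) (h2 : ¬ (a = v ∧ b = u)) :
    adjInd (addEdge H u v) a b = adjInd H a b := by
  simp only [adjInd, addEdge_adj H huv, h1, h2, or_false]

lemma addEdge_right_comm (X : SimpleGraph V) (a b c d : V) :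
    addEdge (addEdge X a b) c d = addEdge (addEdge X c d) a b := by
  simp only [addEdge, sup_assoc, sup_comm (SimpleGraph.edge a b)]

lemma eqInd_self (a : V) : eqInd a a = 1 := by simp [eqInd]

lemma eqInd_of_ne {a b : V} (h : a ≠ b) : eqInd a b = 0 := by simp [eqInd, h]

/-- The indicator of the vertices that cannot be joined to `u`. -/
noncomputable def blocked (Y H : SimpleGraph V) (u a : V) : ℝ :=
  eqInd a u + adjInd H u a + adjInd Y u a

lemma blocked_nonneg (Y H : SimpleGraph V) (u a : V) : 0 ≤ blocked Y H u a :=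
  add_nonneg (add_nonneg (eqInd_nonneg _ _) (adjInd_nonneg _ _ _)) (adjInd_nonneg _ _ _)

variable [Fintype V]

/-- Double counting of the switchings that trade the edges `ua`, `vb` for `uv`, `ab`. -/
lemma sum_switchOut_eq_sum_switchIn (g : V → ℝ) (Y : SimpleGraph V) {u v : V} (huv : u ≠ v)
    (hY : Y.Adj u v) :
    ∑ H ∈ realizations (dropEdge g u v) Y, switchOut Y H u v =
      ∑ G ∈ realizations g Y, switchIn Y G u v := by
  unfold switchOut switchIn
  rw [Finset.sum_comm]
  conv_rhs => rw [Finset.sum_comm]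
  refine Finset.sum_congr rfl fun a _ => ?_
  rw [Finset.sum_comm]
  conv_rhs => rw [Finset.sum_comm]
  refine Finset.sum_congr rfl fun b _ => ?_
  by_cases ha : a = u
  · subst ha
    simp [eqInd_self, adjInd_self]
  by_cases hb : b = v
  · subst hb
    simp [eqInd_self, adjInd_self]
  by_cases hab : a = b
  · subst hab
    simp [eqInd_self, adjInd_self]
  by_cases hua : Y.Adj u a
  · rw [Finset.sum_eq_zero, Finset.sum_eq_zero]
    · intro G hG
      simp [adjInd_eq_zero_of_mem hG hua]
    · intro H hH
      simp [adjInd_eq_zero_of_mem hH hua, eqInd_of_ne ha, adjInd_of_adj hua]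
  by_cases hvb : Y.Adj v b
  · rw [Finset.sum_eq_zero, Finset.sum_eq_zero]
    · intro G hG
      simp [adjInd_eq_zero_of_mem hG hvb]
    · intro H hH
      simp [adjInd_eq_zero_of_mem hH hvb, eqInd_of_ne hb, adjInd_of_adj hvb]
  by_cases hYab : Y.Adj a b
  · rw [Finset.sum_eq_zero, Finset.sum_eq_zero]
    · intro G hG
      simp [adjInd_eq_zero_of_mem hG hYab, eqInd_of_ne hab, adjInd_of_adj hYab]
    · intro H hH
      simp [adjInd_eq_zero_of_mem hH hYab]
  have hav : a ≠ v := fun h => hua (h ▸ hY)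
  have hbu : b ≠ u := fun h => hvb (h ▸ hY.symm)
  simp only [eqInd_of_ne ha, eqInd_of_ne hb, eqInd_of_ne hab, adjInd_of_not_adj hua,
    adjInd_of_not_adj hvb, adjInd_of_not_adj hYab, add_zero, zero_add, mul_assoc]
  rw [sum_realizations_adj _ _ hab hYab, sum_realizations_adj _ _ (Ne.symm ha) hua]
  have hvb' : ¬ (addEdge Y u a).Adj v b := by
    rw [addEdge_adj Y (Ne.symm ha)]
    rintro (h | ⟨h, _⟩ | ⟨h, _⟩)
    · exact hvb h
    · exact huv h.symm
    · exact hav h.symm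
  have e1 : ∀ H : SimpleGraph V, adjInd (addEdge H a b) u a = adjInd H u a := fun H =>
    adjInd_addEdge_of_ne H hab (by tauto) (by tauto)
  have e2 : ∀ H : SimpleGraph V, adjInd (addEdge H a b) v b = adjInd H v b := fun H =>
    adjInd_addEdge_of_ne H hab (by tauto) (by tauto)
  have e3 : ∀ H : SimpleGraph V, adjInd (addEdge H u a) v b = adjInd H v b := fun H =>
    adjInd_addEdge_of_ne H (Ne.symm ha) (by tauto) (by tauto)
  have e4 : ∀ H : SimpleGraph V, adjInd (addEdge H u a) a b = adjInd H a b := fun H =>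
    adjInd_addEdge_of_ne H (Ne.symm ha) (by tauto) (by tauto)
  have e5 : ∀ H : SimpleGraph V, adjInd (addEdge H v b) a b = adjInd H a b := fun H =>
    adjInd_addEdge_of_ne H (Ne.symm hb) (by tauto) (by tauto)
  simp only [e1, e2, e3, e4]
  rw [sum_realizations_not_adj _ _ (Ne.symm ha), sum_realizations_adj _ _ (Ne.symm hb) hvb']
  simp only [e5]
  have r1 := sum_realizations_not_adj (dropEdge (dropEdge g u v) a b)
    (addEdge (addEdge Y a b) u a) (Ne.symm hb) (fun _ => 1)
  have r2 := sum_realizations_not_adj (dropEdge (dropEdge g u a) v b)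
    (addEdge (addEdge Y u a) v b) hab (fun _ => 1)
  simp only [mul_one] at r1 r2
  rw [r1, r2]
  have h1 : dropEdge (dropEdge g u v) a b = dropEdge (dropEdge g u a) v b := by
    funext j; simp only [dropEdge]; ring
  have h2 : addEdge (addEdge (addEdge Y a b) u a) v b =
      addEdge (addEdge (addEdge Y u a) v b) a b := by
    rw [addEdge_right_comm Y a b, addEdge_right_comm _ a b]
  rw [h1, h2]

/-- Degree bounds for the prescribed degrees `g` and the forbidden graph `X`. -/
structure DegBound (g : V → ℝ) (X : SimpleGraph V) (Δ D : ℝ) : Prop where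
  le : ∀ j, g j ≤ Δ
  add_le : ∀ j, g j + ∑ b, adjInd X j b ≤ D

lemma DegBound.dropEdge_addEdge {g : V → ℝ} {X : SimpleGraph V} {Δ D : ℝ}
    (h : DegBound g X Δ D) {u v : V} (huv : u ≠ v) (hX : ¬ X.Adj u v) :
    DegBound (dropEdge g u v) (addEdge X u v) Δ D := by
  refine ⟨fun j => ?_, fun j => ?_⟩
  · have := h.le j
    have := eqInd_nonneg j u
    have := eqInd_nonneg j v
    simp only [dropEdge]; linarith
  · have := h.add_le j
    rw [sum_adjInd_addEdge X huv hX]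
    simp only [dropEdge]; linarith

lemma DegBound.addEdge {g : V → ℝ} {X : SimpleGraph V} {Δ D : ℝ}
    (h : DegBound g X Δ D) {u v : V} (huv : u ≠ v) (hX : ¬ X.Adj u v) :
    DegBound g (addEdge X u v) Δ (D + 1) := by
  refine ⟨h.le, fun j => ?_⟩
  have := h.add_le j
  rw [sum_adjInd_addEdge X huv hX]
  have : eqInd j u + eqInd j v ≤ 1 := by
    unfold eqInd; split_ifs with h1 h2 h2
    · exact absurd (h1.symm.trans h2) huv
    all_goals norm_num
  linarith

lemma nonneg_of_mem {g : V → ℝ} {X G : SimpleGraph V} (hG : G ∈ realizations g X) (j : V) :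
    0 ≤ g j := by
  rw [← (mem_realizations.1 hG).2 j]
  exact Finset.sum_nonneg fun b _ => adjInd_nonneg G j b

lemma exists_nat_of_mem {g : V → ℝ} {X G : SimpleGraph V} (hG : G ∈ realizations g X) (j : V) :
    ∃ k : ℕ, g j = k := by
  rw [← (mem_realizations.1 hG).2 j, sum_adjInd]
  exact ⟨_, rfl⟩

lemma mul_sub_one_nonneg_of_mem {g : V → ℝ} {X G : SimpleGraph V} (hG : G ∈ realizations g X)
    (j : V) : 0 ≤ g j * (g j - 1) := by
  obtain ⟨k, hk⟩ := exists_nat_of_mem hG j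
  rw [hk]
  rcases Nat.eq_zero_or_pos k with rfl | h
  · simp
  · have : (1 : ℝ) ≤ k := by exact_mod_cast h
    exact mul_nonneg (by linarith) (by linarith)

lemma blocked_le_one {h : V → ℝ} {Y H : SimpleGraph V} (hH : H ∈ realizations h Y) (u a : V) :
    blocked Y H u a ≤ 1 := by
  unfold blocked
  by_cases hau : a = u
  · subst hau; simp [eqInd_self, adjInd_self]
  rw [eqInd_of_ne hau]
  by_cases hY : Y.Adj u a
  · rw [adjInd_eq_zero_of_mem hH hY]
    have := adjInd_le_one Y u a
    linarith
  · rw [adjInd_of_not_adj hY]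
    have := adjInd_le_one H u a
    linarith

lemma sum_blocked {h : V → ℝ} {Y H : SimpleGraph V} (hH : H ∈ realizations h Y) (u : V) :
    ∑ a, blocked Y H u a = 1 + h u + ∑ a, adjInd Y u a := by
  simp only [blocked, Finset.sum_add_distrib, sum_eqInd, (mem_realizations.1 hH).2 u]

lemma switchOut_eq {h : V → ℝ} {Y H : SimpleGraph V} (hH : H ∈ realizations h Y) (u v : V) :
    switchOut Y H u v = ∑ j, h j - ∑ a, blocked Y H u a * h a - ∑ b, blocked Y H v b * h b +
      ∑ a, ∑ b, adjInd H a b * blocked Y H u a * blocked Y H v b := by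
  have hd := (mem_realizations.1 hH).2
  have h1 : ∑ j, h j = ∑ a, ∑ b, adjInd H a b := by simp_rw [hd]
  have h2 : ∑ a, blocked Y H u a * h a = ∑ a, ∑ b, adjInd H a b * blocked Y H u a := by
    simp_rw [← hd, Finset.mul_sum, mul_comm]
  have h3 : ∑ b, blocked Y H v b * h b = ∑ a, ∑ b, adjInd H a b * blocked Y H v b := by
    rw [Finset.sum_comm]
    simp_rw [← hd, Finset.mul_sum, adjInd_comm H, mul_comm]
  rw [h1, h2, h3]
  unfold switchOut
  simp only [← Finset.sum_sub_distrib, ← Finset.sum_add_distrib]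
  refine Finset.sum_congr rfl fun a _ => Finset.sum_congr rfl fun b _ => ?_
  simp only [blocked]; ring

lemma switchOut_le {h : V → ℝ} {Y H : SimpleGraph V} (hH : H ∈ realizations h Y) (u v : V) :
    switchOut Y H u v ≤ ∑ j, h j := by
  have hd := (mem_realizations.1 hH).2
  simp_rw [← hd]
  unfold switchOut
  refine Finset.sum_le_sum fun a _ => Finset.sum_le_sum fun b _ => ?_
  have a1 := blocked_nonneg Y H u a
  have a2 := blocked_le_one hH u a
  have b1 := blocked_nonneg Y H v b
  have b2 := blocked_le_one hH v b
  have c := adjInd_nonneg H a b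
  change adjInd H a b * (1 - blocked Y H u a) * (1 - blocked Y H v b) ≤ _
  have : adjInd H a b * (1 - blocked Y H u a) ≤ adjInd H a b := by nlinarith
  have h0 : 0 ≤ adjInd H a b * (1 - blocked Y H u a) := mul_nonneg c (by linarith)
  nlinarith

lemma sum_blocked_mul_le {h : V → ℝ} {Y H : SimpleGraph V} {Δ D : ℝ}
    (hH : H ∈ realizations h Y) (hB : DegBound h Y Δ D) (hΔ : 0 ≤ Δ) (u : V) :
    ∑ a, blocked Y H u a * h a ≤ Δ * (D + 1) := by
  calc ∑ a, blocked Y H u a * h a ≤ ∑ a, blocked Y H u a * Δ :=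
        Finset.sum_le_sum fun a _ => mul_le_mul_of_nonneg_left (hB.le a) (blocked_nonneg _ _ _ _)
    _ = (1 + h u + ∑ a, adjInd Y u a) * Δ := by rw [← Finset.sum_mul, sum_blocked hH]
    _ ≤ Δ * (D + 1) := by
        have := hB.add_le u
        nlinarith

lemma le_switchOut {h : V → ℝ} {Y H : SimpleGraph V} {Δ D : ℝ}
    (hH : H ∈ realizations h Y) (hB : DegBound h Y Δ D) (hΔ : 0 ≤ Δ) (u v : V) :
    ∑ j, h j - 2 * Δ * (D + 1) ≤ switchOut Y H u v := by
  rw [switchOut_eq hH]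
  have h1 := sum_blocked_mul_le hH hB hΔ u
  have h2 := sum_blocked_mul_le hH hB hΔ v
  have h3 : 0 ≤ ∑ a, ∑ b, adjInd H a b * blocked Y H u a * blocked Y H v b :=
    Finset.sum_nonneg fun a _ => Finset.sum_nonneg fun b _ =>
      mul_nonneg (mul_nonneg (adjInd_nonneg _ _ _) (blocked_nonneg _ _ _ _))
        (blocked_nonneg _ _ _ _)
  linarith

/-- The number of choices of a switching towards `uv` that are not allowed. -/
noncomputable def switchBad (Y G : SimpleGraph V) (u v : V) : ℝ :=
  ∑ a, ∑ b, adjInd G u a * adjInd G v b * (adjInd G a b + eqInd a b + adjInd Y a b)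

lemma switchIn_eq {g : V → ℝ} {Y G : SimpleGraph V} (hG : G ∈ realizations g Y) (u v : V) :
    switchIn Y G u v = g u * g v - switchBad Y G u v := by
  have hd := (mem_realizations.1 hG).2
  rw [← hd u, ← hd v, Finset.sum_mul_sum]
  unfold switchIn switchBad
  simp only [← Finset.sum_sub_distrib]
  refine Finset.sum_congr rfl fun a _ => Finset.sum_congr rfl fun b _ => ?_
  ring

lemma switchBad_nonneg (Y G : SimpleGraph V) (u v : V) : 0 ≤ switchBad Y G u v :=
  Finset.sum_nonneg fun _ _ => Finset.sum_nonneg fun _ _ =>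
    mul_nonneg (mul_nonneg (adjInd_nonneg _ _ _) (adjInd_nonneg _ _ _))
      (add_nonneg (add_nonneg (adjInd_nonneg _ _ _) (eqInd_nonneg _ _)) (adjInd_nonneg _ _ _))

lemma realizations_eq_empty_or (g : V → ℝ) (X : SimpleGraph V) :
    (realizations g X = ∅ ∧ numReal g X = 0) ∨ ∃ G, G ∈ realizations g X := by
  rcases (realizations g X).eq_empty_or_nonempty with h | h
  · exact Or.inl ⟨h, by simp [numReal, h]⟩
  · exact Or.inr h

lemma numReal_pos_iff {g : V → ℝ} {X : SimpleGraph V} :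
    0 < numReal g X ↔ ∃ G, G ∈ realizations g X := by
  simp only [numReal, Nat.cast_pos, Finset.card_pos]; rfl

/-- The count form of the crude upper bound for an edge probability. -/
lemma numReal_dropEdge_le {g : V → ℝ} {X : SimpleGraph V} {Δ D W : ℝ} (hB : DegBound g X Δ D)
    (hΔ : 0 ≤ Δ) (hW : 0 < W) (hWM : W ≤ ∑ j, g j - 2 - 2 * Δ * (D + 1)) {u v : V} (huv : u ≠ v)
    (hX : ¬ X.Adj u v) :
    numReal (dropEdge g u v) (addEdge X u v) ≤ g u * g v / W * numReal g (addEdge X u v) := by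
  have hid := sum_switchOut_eq_sum_switchIn g (addEdge X u v) huv (addEdge_adj_self X huv)
  have h1 : W * numReal (dropEdge g u v) (addEdge X u v) ≤
      ∑ H ∈ realizations (dropEdge g u v) (addEdge X u v), switchOut (addEdge X u v) H u v := by
    rw [mul_comm, numReal, ← nsmul_eq_mul]
    refine Finset.card_nsmul_le_sum _ _ _ fun H hH => ?_
    refine le_trans ?_ (le_switchOut hH (hB.dropEdge_addEdge huv hX) hΔ u v)
    rw [sum_dropEdge]; linarith
  have h2 : ∑ G ∈ realizations g (addEdge X u v), switchIn (addEdge X u v) G u v ≤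
      g u * g v * numReal g (addEdge X u v) := by
    rw [mul_comm, numReal, ← nsmul_eq_mul]
    refine Finset.sum_le_card_nsmul _ _ _ fun G hG => ?_
    rw [switchIn_eq hG]
    linarith [switchBad_nonneg (addEdge X u v) G u v]
  rw [div_mul_eq_mul_div, le_div_iff₀ hW]
  linarith

lemma numReal_addEdge_le (g : V → ℝ) (X : SimpleGraph V) {u v : V} (huv : u ≠ v)
    (hX : ¬ X.Adj u v) : numReal g (addEdge X u v) ≤ numReal g X := by
  rw [numReal_eq_add g X huv hX]
  linarith [numReal_nonneg (dropEdge g u v) (addEdge X u v)]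

lemma sum_adjInd_le {g : V → ℝ} {X : SimpleGraph V} {Δ D W : ℝ} (hB : DegBound g X Δ D)
    (hΔ : 0 ≤ Δ) (hW : 0 < W) (hWM : W ≤ ∑ j, g j - 2 - 2 * Δ * (D + 1)) {u v : V} (huv : u ≠ v) :
    ∑ G ∈ realizations g X, adjInd G u v ≤ g u * g v / W * numReal g X := by
  rcases realizations_eq_empty_or g X with ⟨h, h'⟩ | ⟨G₀, hG₀⟩
  · simp [h, h']
  have hn : 0 ≤ g u * g v / W :=
    div_nonneg (mul_nonneg (nonneg_of_mem hG₀ u) (nonneg_of_mem hG₀ v)) hW.le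
  by_cases hX : X.Adj u v
  · rw [Finset.sum_eq_zero fun G hG => adjInd_eq_zero_of_mem hG hX]
    exact mul_nonneg hn (numReal_nonneg _ _)
  rw [sum_realizations_adjInd g X huv hX]
  exact (numReal_dropEdge_le hB hΔ hW hWM huv hX).trans
    (mul_le_mul_of_nonneg_left (numReal_addEdge_le g X huv hX) hn)

/-- Two distinct edges. -/
lemma sum_adjInd_mul_le {g : V → ℝ} {X : SimpleGraph V} {Δ D W : ℝ} (hB : DegBound g X Δ D)
    (hΔ : 0 ≤ Δ) (hW : 0 < W) (hWM : W ≤ ∑ j, g j - 4 - 2 * Δ * (D + 1)) {p q r s : V}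
    (hpq : p ≠ q) (hrs : r ≠ s) (h1 : ¬ (r = p ∧ s = q)) (h2 : ¬ (r = q ∧ s = p)) 
    (hn : ∀ G ∈ realizations g X, 0 ≤ g p * g q * (dropEdge g p q r * dropEdge g p q s)) :
    ∑ G ∈ realizations g X, adjInd G p q * adjInd G r s ≤
      g p * g q * (dropEdge g p q r * dropEdge g p q s) / W ^ 2 * numReal g X := by
  rcases realizations_eq_empty_or g X with ⟨h, h'⟩ | ⟨G₀, hG₀⟩
  · simp [h, h']
  have hn' := hn G₀ hG₀
  by_cases hX : X.Adj p q
  · rw [Finset.sum_eq_zero fun G hG => by rw [adjInd_eq_zero_of_mem hG hX, zero_mul]]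
    exact mul_nonneg (by positivity) (numReal_nonneg _ _)
  rw [sum_realizations_adj g X hpq hX]
  simp only [adjInd_addEdge_of_ne _ hpq h1 h2]
  rcases realizations_eq_empty_or (dropEdge g p q) (addEdge X p q) with ⟨h, h'⟩ | ⟨G₁, hG₁⟩
  · rw [h, Finset.sum_empty]
    exact mul_nonneg (by positivity) (numReal_nonneg _ _)
  have s1 := sum_adjInd_le (hB.dropEdge_addEdge hpq hX) hΔ hW
    (by rw [sum_dropEdge]; linarith) hrs
  have s2 := sum_adjInd_le hB hΔ hW (by linarith) hpq
  rw [sum_realizations_adjInd g X hpq hX] at s2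
  refine s1.trans ?_
  calc _ ≤ dropEdge g p q r * dropEdge g p q s / W * (g p * g q / W * numReal g X) :=
        mul_le_mul_of_nonneg_left s2 (div_nonneg (mul_nonneg (nonneg_of_mem hG₁ r)
          (nonneg_of_mem hG₁ s)) hW.le)
    _ = _ := by field_simp

/-- Paths of length two. -/
lemma sum_path_two_le {g : V → ℝ} {X : SimpleGraph V} {Δ D W : ℝ} (hB : DegBound g X Δ D)
    (hΔ : 0 ≤ Δ) (hW : 0 < W) (hWM : W ≤ ∑ j, g j - 4 - 2 * Δ * (D + 1)) {u v : V} (huv : u ≠ v)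
    (a : V) :
    ∑ G ∈ realizations g X, adjInd G u a * adjInd G a v ≤
      g u * (g a * (g a - 1)) * g v / W ^ 2 * numReal g X := by
  rcases realizations_eq_empty_or g X with ⟨h, h'⟩ | ⟨G₀, hG₀⟩
  · simp [h, h']
  have hn : 0 ≤ g u * (g a * (g a - 1)) * g v :=
    mul_nonneg (mul_nonneg (nonneg_of_mem hG₀ u) (mul_sub_one_nonneg_of_mem hG₀ a))
      (nonneg_of_mem hG₀ v)
  by_cases hau : u = a
  · subst hau
    simp only [adjInd_self, zero_mul, Finset.sum_const_zero]
    exact mul_nonneg (by positivity) (numReal_nonneg _ _)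
  by_cases hav : a = v
  · subst hav
    simp only [adjInd_self, mul_zero, Finset.sum_const_zero]
    exact mul_nonneg (by positivity) (numReal_nonneg _ _)
  have e : g u * g a * (dropEdge g u a a * dropEdge g u a v) =
      g u * (g a * (g a - 1)) * g v := by
    simp only [dropEdge, eqInd_self, eqInd_of_ne (Ne.symm hau), eqInd_of_ne (Ne.symm huv),
      eqInd_of_ne (Ne.symm hav)]
    ring
  have := sum_adjInd_mul_le hB hΔ hW hWM hau hav (by tauto) (by tauto) (by rw [e]; tauto)
  rwa [e] at this

/-- Paths of length three. -/
lemma sum_path_three_le {g : V → ℝ} {X : SimpleGraph V} {Δ D W : ℝ} (hB : DegBound g X Δ D)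
    (hΔ : 0 ≤ Δ) (hW : 0 < W) (hWM : W ≤ ∑ j, g j - 6 - 2 * Δ * (D + 1)) {u v : V} (huv : u ≠ v)
    (hX : X.Adj u v) (a b : V) :
    ∑ G ∈ realizations g X, adjInd G u a * (adjInd G a b * adjInd G b v) ≤
      g u * (g a * (g a - 1)) * (g b * (g b - 1)) * g v / W ^ 3 * numReal g X := by
  rcases realizations_eq_empty_or g X with ⟨h, h'⟩ | ⟨G₀, hG₀⟩
  · simp [h, h']
  have hn : 0 ≤ g u * (g a * (g a - 1)) * (g b * (g b - 1)) * g v :=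
    mul_nonneg (mul_nonneg (mul_nonneg (nonneg_of_mem hG₀ u) (mul_sub_one_nonneg_of_mem hG₀ a))
      (mul_sub_one_nonneg_of_mem hG₀ b)) (nonneg_of_mem hG₀ v)
  have hr : 0 ≤ g u * (g a * (g a - 1)) * (g b * (g b - 1)) * g v / W ^ 3 * numReal g X :=
    mul_nonneg (by positivity) (numReal_nonneg _ _)
  by_cases hua : X.Adj u a
  · rwa [Finset.sum_eq_zero fun G hG => by rw [adjInd_eq_zero_of_mem hG hua, zero_mul]]
  by_cases hbv : X.Adj b v
  · rwa [Finset.sum_eq_zero fun G hG => by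
      rw [adjInd_eq_zero_of_mem hG hbv, mul_zero, mul_zero]]
  by_cases hau : u = a
  · subst hau; simpa only [adjInd_self, zero_mul, Finset.sum_const_zero]
  by_cases hab : a = b
  · subst hab; simpa only [adjInd_self, zero_mul, mul_zero, Finset.sum_const_zero]
  by_cases hbv' : b = v
  · subst hbv'; simpa only [adjInd_self, mul_zero, Finset.sum_const_zero]
  have hav : a ≠ v := fun h => hua (h ▸ hX)
  have hbu : b ≠ u := fun h => hbv (h ▸ hX)
  rw [sum_realizations_adj g X hau hua]
  have e1 : ∀ H : SimpleGraph V, adjInd (addEdge H u a) a b = adjInd H a b := fun H =>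
    adjInd_addEdge_of_ne H hau (by tauto) (by tauto)
  have e2 : ∀ H : SimpleGraph V, adjInd (addEdge H u a) b v = adjInd H b v := fun H =>
    adjInd_addEdge_of_ne H hau (by tauto) (by tauto)
  simp only [e1, e2]
  rcases realizations_eq_empty_or (dropEdge g u a) (addEdge X u a) with ⟨h, h'⟩ | ⟨G₁, hG₁⟩
  · rwa [h, Finset.sum_empty]
  have s1 := sum_path_two_le (hB.dropEdge_addEdge hau hua) hΔ hW
    (by rw [sum_dropEdge]; linarith) hav b
  have s2 := sum_adjInd_le hB hΔ hW (by linarith) hau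
  rw [sum_realizations_adjInd g X hau hua] at s2
  refine s1.trans ?_
  have hc : 0 ≤ dropEdge g u a a * (dropEdge g u a b * (dropEdge g u a b - 1)) *
      dropEdge g u a v / W ^ 2 :=
    div_nonneg (mul_nonneg (mul_nonneg (nonneg_of_mem hG₁ a) (mul_sub_one_nonneg_of_mem hG₁ b))
      (nonneg_of_mem hG₁ v)) (by positivity)
  refine (mul_le_mul_of_nonneg_left s2 hc).trans (le_of_eq ?_)
  simp only [dropEdge, eqInd_self, eqInd_of_ne (Ne.symm hau), eqInd_of_ne (Ne.symm huv),
    eqInd_of_ne (Ne.symm hav), eqInd_of_ne hbu, eqInd_of_ne (Ne.symm hab)]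
  field_simp
  ring

/-- Two disjoint edges at `u` and `v`. -/
lemma sum_two_edges_le {g : V → ℝ} {X : SimpleGraph V} {Δ D W : ℝ} (hB : DegBound g X Δ D)
    (hΔ : 0 ≤ Δ) (hW : 0 < W) (hWM : W ≤ ∑ j, g j - 4 - 2 * Δ * (D + 1)) {u v : V} (huv : u ≠ v)
    (hX : X.Adj u v) {a b : V} (hab : a ≠ b) :
    ∑ G ∈ realizations g X, adjInd G u a * adjInd G v b ≤
      g u * g v * (g a * g b) / W ^ 2 * numReal g X := by
  rcases realizations_eq_empty_or g X with ⟨h, h'⟩ | ⟨G₀, hG₀⟩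
  · simp [h, h']
  have hn : 0 ≤ g u * g v * (g a * g b) :=
    mul_nonneg (mul_nonneg (nonneg_of_mem hG₀ u) (nonneg_of_mem hG₀ v))
      (mul_nonneg (nonneg_of_mem hG₀ a) (nonneg_of_mem hG₀ b))
  have hr : 0 ≤ g u * g v * (g a * g b) / W ^ 2 * numReal g X :=
    mul_nonneg (by positivity) (numReal_nonneg _ _)
  by_cases hau : u = a
  · subst hau; simpa only [adjInd_self, zero_mul, Finset.sum_const_zero]
  by_cases hbv : v = b
  · subst hbv; simpa only [adjInd_self, mul_zero, Finset.sum_const_zero]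
  by_cases hav : a = v
  · subst hav
    rwa [Finset.sum_eq_zero fun G hG => by rw [adjInd_eq_zero_of_mem hG hX, zero_mul]]
  by_cases hbu : b = u
  · subst hbu
    rwa [Finset.sum_eq_zero fun G hG => by rw [adjInd_eq_zero_of_mem hG hX.symm, mul_zero]]
  have e : g u * g a * (dropEdge g u a v * dropEdge g u a b) = g u * g v * (g a * g b) := by
    simp only [dropEdge, eqInd_of_ne (Ne.symm huv), eqInd_of_ne (Ne.symm hav),
      eqInd_of_ne hbu, eqInd_of_ne (Ne.symm hab)]
    ring
  have := sum_adjInd_mul_le hB hΔ hW hWM hau hbv (by tauto) (by tauto) (by rw [e]; tauto)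
  rwa [e] at this

end Switching

section FirstOrder

variable {V : Type*} [Fintype V]

/-- The sum of the second falling factorials of the degrees. -/
noncomputable def fallTwo (g : V → ℝ) : ℝ := ∑ a, g a * (g a - 1)

/-- The sum of `g a * g b` over the ordered adjacent pairs of `Y`. -/
noncomputable def edgeWeight (g : V → ℝ) (Y : SimpleGraph V) : ℝ :=
  ∑ a, ∑ b, adjInd Y a b * (g a * g b)

lemma sum_switchBad (g : V → ℝ) (Y : SimpleGraph V) (u v : V) :
    ∑ G ∈ realizations g Y, switchBad Y G u v =
      ∑ a, ∑ b, ∑ G ∈ realizations g Y, adjInd G u a * (adjInd G a b * adjInd G b v) +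
      ∑ a, ∑ G ∈ realizations g Y, adjInd G u a * adjInd G a v +
      ∑ a, ∑ b, adjInd Y a b * ∑ G ∈ realizations g Y, adjInd G u a * adjInd G v b := by
  have e : ∀ G : SimpleGraph V, switchBad Y G u v =
      ∑ a, ∑ b, adjInd G u a * (adjInd G a b * adjInd G b v) +
      ∑ a, adjInd G u a * adjInd G a v +
      ∑ a, ∑ b, adjInd Y a b * (adjInd G u a * adjInd G v b) := by
    intro G
    have h2 : ∀ a, adjInd G u a * adjInd G a v =
        ∑ b, eqInd b a * (adjInd G u a * adjInd G b v) := fun a => by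
      rw [sum_eqInd_mul a (fun b => adjInd G u a * adjInd G b v)]
    simp_rw [h2]
    unfold switchBad
    simp only [← Finset.sum_add_distrib]
    refine Finset.sum_congr rfl fun a _ => Finset.sum_congr rfl fun b _ => ?_
    rw [adjInd_comm G v b]
    have : eqInd a b = eqInd b a := by simp [eqInd, eq_comm]
    rw [this]; ring
  simp_rw [e, Finset.sum_add_distrib, Finset.mul_sum]
  congr 1
  · congr 1
    · rw [Finset.sum_comm]
      exact Finset.sum_congr rfl fun a _ => Finset.sum_comm
    · rw [Finset.sum_comm]
  · rw [Finset.sum_comm]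
    exact Finset.sum_congr rfl fun a _ => Finset.sum_comm

lemma sum_switchBad_le {g : V → ℝ} {Y : SimpleGraph V} {Δ D W : ℝ} (hB : DegBound g Y Δ D)
    (hΔ : 0 ≤ Δ) (hW : 0 < W) (hWM : W ≤ ∑ j, g j - 6 - 2 * Δ * (D + 1)) {u v : V} (huv : u ≠ v)
    (hY : Y.Adj u v) :
    ∑ G ∈ realizations g Y, switchBad Y G u v ≤ g u * g v *
      (fallTwo g ^ 2 / W ^ 3 + fallTwo g / W ^ 2 + edgeWeight g Y / W ^ 2) * numReal g Y := by
  rw [sum_switchBad]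
  have h1 : ∑ a, ∑ b, ∑ G ∈ realizations g Y, adjInd G u a * (adjInd G a b * adjInd G b v) ≤
      g u * g v * (fallTwo g ^ 2 / W ^ 3) * numReal g Y := by
    calc _ ≤ ∑ a, ∑ b, g u * (g a * (g a - 1)) * (g b * (g b - 1)) * g v / W ^ 3 * numReal g Y :=
          Finset.sum_le_sum fun a _ => Finset.sum_le_sum fun b _ =>
            sum_path_three_le hB hΔ hW hWM huv hY a b
      _ = _ := by
          rw [fallTwo, sq, Finset.sum_mul_sum, Finset.sum_div, Finset.mul_sum, Finset.sum_mul]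
          refine Finset.sum_congr rfl fun a _ => ?_
          rw [Finset.sum_div, Finset.mul_sum, Finset.sum_mul]
          refine Finset.sum_congr rfl fun b _ => ?_
          ring
  have h2 : ∑ a, ∑ G ∈ realizations g Y, adjInd G u a * adjInd G a v ≤
      g u * g v * (fallTwo g / W ^ 2) * numReal g Y := by
    calc _ ≤ ∑ a, g u * (g a * (g a - 1)) * g v / W ^ 2 * numReal g Y :=
          Finset.sum_le_sum fun a _ => sum_path_two_le hB hΔ hW (by linarith) huv a
      _ = _ := by
          rw [fallTwo, Finset.sum_div, Finset.mul_sum, Finset.sum_mul]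
          refine Finset.sum_congr rfl fun a _ => ?_
          ring
  have h3 : ∑ a, ∑ b, adjInd Y a b * ∑ G ∈ realizations g Y, adjInd G u a * adjInd G v b ≤
      g u * g v * (edgeWeight g Y / W ^ 2) * numReal g Y := by
    calc _ ≤ ∑ a, ∑ b, adjInd Y a b * (g u * g v * (g a * g b) / W ^ 2 * numReal g Y) := by
          refine Finset.sum_le_sum fun a _ => Finset.sum_le_sum fun b _ => ?_
          by_cases hab : a = b
          · subst hab; simp [adjInd_self]
          · exact mul_le_mul_of_nonneg_left
              (sum_two_edges_le hB hΔ hW (by linarith) huv hY hab) (adjInd_nonneg _ _ _)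
      _ = _ := by
          rw [edgeWeight, Finset.sum_div, Finset.mul_sum, Finset.sum_mul]
          refine Finset.sum_congr rfl fun a _ => ?_
          rw [Finset.sum_div, Finset.mul_sum, Finset.sum_mul]
          refine Finset.sum_congr rfl fun b _ => ?_
          ring
  linarith

lemma fallTwo_nonneg_of_mem {g : V → ℝ} {X G : SimpleGraph V} (hG : G ∈ realizations g X) :
    0 ≤ fallTwo g := Finset.sum_nonneg fun a _ => mul_sub_one_nonneg_of_mem hG a

lemma fallTwo_le_of_mem {g : V → ℝ} {X G : SimpleGraph V} (hG : G ∈ realizations g X) {Δ : ℝ}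
    (hg : ∀ j, g j ≤ Δ) : fallTwo g ≤ (Δ - 1) * ∑ j, g j := by
  rw [fallTwo, Finset.mul_sum]
  refine Finset.sum_le_sum fun a _ => ?_
  have := nonneg_of_mem hG a
  nlinarith [hg a]

lemma edgeWeight_nonneg_of_mem {g : V → ℝ} {X G : SimpleGraph V} (hG : G ∈ realizations g X)
    (Y : SimpleGraph V) : 0 ≤ edgeWeight g Y :=
  Finset.sum_nonneg fun a _ => Finset.sum_nonneg fun b _ =>
    mul_nonneg (adjInd_nonneg _ _ _) (mul_nonneg (nonneg_of_mem hG a) (nonneg_of_mem hG b))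

lemma edgeWeight_le_of_mem {g : V → ℝ} {X G : SimpleGraph V} (hG : G ∈ realizations g X)
    {Δ D : ℝ} (hB : DegBound g X Δ D) : edgeWeight g X ≤ Δ * (D - 1) * ∑ j, g j := by
  rw [edgeWeight, Finset.mul_sum]
  refine Finset.sum_le_sum fun a _ => ?_
  have h0 := nonneg_of_mem hG a
  have hΔ : 0 ≤ Δ := h0.trans (hB.le a)
  have hm := mul_sub_one_nonneg_of_mem hG a
  calc ∑ b, adjInd X a b * (g a * g b) ≤ ∑ b, adjInd X a b * (g a * Δ) :=
        Finset.sum_le_sum fun b _ => mul_le_mul_of_nonneg_left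
          (mul_le_mul_of_nonneg_left (hB.le b) h0) (adjInd_nonneg _ _ _)
    _ = (∑ b, adjInd X a b) * (g a * Δ) := by rw [Finset.sum_mul]
    _ ≤ (D - g a) * (g a * Δ) :=
        mul_le_mul_of_nonneg_right (by linarith [hB.add_le a]) (mul_nonneg h0 hΔ)
    _ ≤ Δ * (D - 1) * g a := by nlinarith [mul_nonneg hΔ hm]

lemma switch_ratio_le {S T W M Δ : ℝ} (hM0 : 0 < M) (hΔ : 3 ≤ Δ) (hWM : 4 / 9 * M ≤ W)
    (s0 : 0 ≤ S) (s1 : S ≤ Δ * M) (s2 : T ≤ 4 / 3 * Δ ^ 2 * M) :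
    S ^ 2 / W ^ 3 + S / W ^ 2 + T / W ^ 2 ≤ 22 * (Δ ^ 2 / M) := by
  have hW : 0 < W := by linarith
  have w3 : (4 / 9 * M) ^ 3 ≤ W ^ 3 := pow_le_pow_left₀ (by positivity) hWM 3
  have w2 : (4 / 9 * M) ^ 2 ≤ W ^ 2 := pow_le_pow_left₀ (by positivity) hWM 2
  have t1 : S ^ 2 / W ^ 3 ≤ 12 * (Δ ^ 2 / M) := by
    calc S ^ 2 / W ^ 3 ≤ (Δ * M) ^ 2 / (4 / 9 * M) ^ 3 :=
          div_le_div₀ (by positivity) (pow_le_pow_left₀ s0 s1 2) (by positivity) w3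
      _ = 729 / 64 * (Δ ^ 2 / M) := by field_simp; norm_num
      _ ≤ _ := by
          have : 0 ≤ Δ ^ 2 / M := by positivity
          linarith
  have t2 : S / W ^ 2 ≤ 2 * (Δ ^ 2 / M) := by
    calc S / W ^ 2 ≤ (Δ * M) / (4 / 9 * M) ^ 2 :=
          div_le_div₀ (by positivity) s1 (by positivity) w2
      _ = 81 / 16 * Δ / M := by field_simp; norm_num
      _ ≤ 2 * Δ ^ 2 / M := by
          have : 81 / 16 * Δ ≤ 2 * Δ ^ 2 := by nlinarith
          gcongr
      _ = _ := by ring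
  have t3 : T / W ^ 2 ≤ 8 * (Δ ^ 2 / M) := by
    calc T / W ^ 2 ≤ (4 / 3 * Δ ^ 2 * M) / (4 / 9 * M) ^ 2 :=
          div_le_div₀ (by positivity) s2 (by positivity) w2
      _ = 27 / 4 * (Δ ^ 2 / M) := by field_simp; norm_num
      _ ≤ _ := by
          have : 0 ≤ Δ ^ 2 / M := by positivity
          linarith
  linarith

lemma one_div_sub_le {M δ : ℝ} (hM0 : 0 < M) (hδ0 : 0 ≤ δ) (h9 : δ ≤ 1 / 9) :
    1 / (M * (1 - 5 * δ)) ≤ (1 + 12 * δ) / M := by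
  have : 0 < 1 - 5 * δ := by linarith
  rw [div_le_div_iff₀ (by positivity) hM0]
  have h : 1 ≤ (1 + 12 * δ) * (1 - 5 * δ) := by nlinarith
  nlinarith

/-- A switching inequality bounds `N₁` from below. -/
lemma le_of_switching {P M N N₀ N₁ δ B : ℝ} (hP : 0 ≤ P) (hN : 0 ≤ N) (hM0 : 0 < M)
    (hδ0 : 0 ≤ δ) (hN1 : 0 ≤ N₁) (hNlow : (1 - 9 / 4 * δ) * N ≤ N₀)
    (hB : B ≤ 22 * δ * (P * N₀)) (h : P * N₀ - B ≤ M * N₁) :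
    (1 - 25 * δ) * (P / M * N) ≤ N₁ := by
  have h5 : (1 - 25 * δ) * (P / M * N) = (1 - 25 * δ) * (P * N) / M := by ring
  have hPN : 0 ≤ P * N := mul_nonneg hP hN
  rw [h5, div_le_iff₀ hM0, mul_comm N₁]
  by_cases hbig : 1 ≤ 22 * δ
  · have : (1 - 25 * δ) * (P * N) ≤ 0 := mul_nonpos_of_nonpos_of_nonneg (by linarith) hPN
    exact this.trans (mul_nonneg hM0.le hN1)
  push Not at hbig
  have hmain : (1 - 22 * δ) * (P * N₀) ≤ M * N₁ := by linarith
  have : (1 - 22 * δ) * (P * ((1 - 9 / 4 * δ) * N)) ≤ M * N₁ := by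
    refine le_trans ?_ hmain
    exact mul_le_mul_of_nonneg_left (mul_le_mul_of_nonneg_left hNlow hP) (by linarith)
  have e : (1 - 22 * δ) * (P * ((1 - 9 / 4 * δ) * N)) =
      (1 - 25 * δ) * (P * N) + (3 / 4 * δ + 99 / 2 * δ ^ 2) * (P * N) := by ring
  have : 0 ≤ (3 / 4 * δ + 99 / 2 * δ ^ 2) * (P * N) := by positivity
  linarith

lemma sum_switchIn {g : V → ℝ} {Y : SimpleGraph V} (u v : V) :
    ∑ G ∈ realizations g Y, switchIn Y G u v =
      g u * g v * numReal g Y - ∑ G ∈ realizations g Y, switchBad Y G u v := by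
  rw [Finset.sum_congr rfl fun G hG => switchIn_eq hG u v, Finset.sum_sub_distrib,
    Finset.sum_const, nsmul_eq_mul, numReal, mul_comm]

lemma sum_switchOut_le {g : V → ℝ} {Y : SimpleGraph V} (u v : V) :
    ∑ H ∈ realizations g Y, switchOut Y H u v ≤ (∑ j, g j) * numReal g Y := by
  rw [mul_comm, numReal, ← nsmul_eq_mul]
  exact Finset.sum_le_card_nsmul _ _ _ fun H hH => switchOut_le hH u v

/-- Each edge probability is `g u * g v / M` up to a relative error of order `Δ² / M`. -/
lemma abs_sum_adjInd_sub_le_aux {g : V → ℝ} {X : SimpleGraph V} {Δ M : ℝ}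
    (hB : DegBound g X Δ (Δ + 1)) (hΔ : 3 ≤ Δ) (hM : ∑ j, g j = M) (hMΔ : 9 * Δ ^ 2 ≤ M) {u v : V}
    (huv : u ≠ v) (hX : ¬ X.Adj u v) :
    |∑ G ∈ realizations g X, adjInd G u v - g u * g v / M * numReal g X| ≤
      25 * (Δ ^ 2 / M) * (g u * g v / M * numReal g X) := by
  rcases realizations_eq_empty_or g X with ⟨h, h'⟩ | ⟨G₀, hG₀⟩
  · simp [h, h']
  have hu := nonneg_of_mem hG₀ u
  have hv := nonneg_of_mem hG₀ v
  have hN := numReal_nonneg g X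
  have hM0 : 0 < M := by nlinarith
  have hWM : 4 / 9 * M ≤ M - 5 * Δ ^ 2 := by linarith
  have hW : 0 < M - 5 * Δ ^ 2 := by linarith
  have hδM : Δ ^ 2 / M * M = Δ ^ 2 := by field_simp
  have hδ0 : 0 ≤ Δ ^ 2 / M := by positivity
  have hδ9 : Δ ^ 2 / M ≤ 1 / 9 := by rw [div_le_iff₀ hM0]; linarith
  have hcond : M - 5 * Δ ^ 2 ≤ M - 6 - 2 * Δ * (Δ + 1 + 1 + 1) := by nlinarith
  have hcond' : M - 5 * Δ ^ 2 ≤ M - 2 - 2 * Δ * (Δ + 1 + 1) := by nlinarith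
  have hP0 : 0 ≤ g u * g v := mul_nonneg hu hv
  have hPΔ : g u * g v ≤ Δ ^ 2 := by
    rw [sq]; exact mul_le_mul (hB.le u) (hB.le v) hv (by linarith)
  have hup := sum_adjInd_le hB (by linarith) hW (by rw [hM]; exact hcond') huv
  rw [sum_realizations_adjInd g X huv hX] at hup ⊢
  have hY : (addEdge X u v).Adj u v := addEdge_adj_self X huv
  have hsplit := numReal_eq_add g X huv hX
  have hid := sum_switchOut_eq_sum_switchIn g (addEdge X u v) huv hY
  rw [sum_switchIn] at hid
  have ho : ∑ H ∈ realizations (dropEdge g u v) (addEdge X u v), switchOut (addEdge X u v) H u v ≤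
      M * numReal (dropEdge g u v) (addEdge X u v) := by
    refine (sum_switchOut_le u v).trans ?_
    rw [sum_dropEdge]
    exact mul_le_mul_of_nonneg_right (by linarith) (numReal_nonneg _ _)
  have hbad := sum_switchBad_le (hB.addEdge huv hX) (by linarith) hW
    (by rw [hM]; exact hcond) huv hY
  have hbad' : ∑ G ∈ realizations g (addEdge X u v), switchBad (addEdge X u v) G u v ≤
      22 * (Δ ^ 2 / M) * (g u * g v * numReal g (addEdge X u v)) := by
    rcases realizations_eq_empty_or g (addEdge X u v) with ⟨h, h'⟩ | ⟨G₁, hG₁⟩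
    · rw [h, h']; simp
    have s1 := fallTwo_le_of_mem hG₁ hB.le
    have s0 := fallTwo_nonneg_of_mem hG₁
    have s2 := edgeWeight_le_of_mem hG₁ (hB.addEdge huv hX)
    rw [hM] at s1 s2
    have s1' : fallTwo g ≤ Δ * M := by linarith
    have s2' : edgeWeight g (addEdge X u v) ≤ 4 / 3 * Δ ^ 2 * M :=
      s2.trans (mul_le_mul_of_nonneg_right (by nlinarith) hM0.le)
    have hρ := switch_ratio_le hM0 hΔ hWM s0 s1' s2'
    refine hbad.trans ?_
    calc _ = _ * (g u * g v * numReal g (addEdge X u v)) := by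
          rw [mul_right_comm, mul_comm]
      _ ≤ _ := mul_le_mul_of_nonneg_right hρ (mul_nonneg hP0 (numReal_nonneg _ _))
  have hNlow : (1 - 9 / 4 * (Δ ^ 2 / M)) * numReal g X ≤ numReal g (addEdge X u v) := by
    have hPW : g u * g v / (M - 5 * Δ ^ 2) ≤ 9 / 4 * (Δ ^ 2 / M) := by
      calc _ ≤ Δ ^ 2 / (4 / 9 * M) := div_le_div₀ (sq_nonneg _) hPΔ (by positivity) hWM
        _ = _ := by field_simp
    have := mul_le_mul_of_nonneg_right hPW hN
    rw [sub_mul]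
    linarith
  have hlow := le_of_switching hP0 hN hM0 hδ0 (numReal_nonneg _ _) hNlow hbad' (hid ▸ ho)
  have hPMN : 0 ≤ g u * g v / M * numReal g X := mul_nonneg (div_nonneg hP0 hM0.le) hN
  have hupper : numReal (dropEdge g u v) (addEdge X u v) ≤
      (1 + 12 * (Δ ^ 2 / M)) * (g u * g v / M * numReal g X) := by
    refine hup.trans ?_
    have hW' : M - 5 * Δ ^ 2 = M * (1 - 5 * (Δ ^ 2 / M)) := by
      rw [mul_sub, mul_one, mul_left_comm, mul_comm M, hδM]
    have := one_div_sub_le hM0 hδ0 hδ9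
    rw [← hW'] at this
    calc _ = g u * g v * numReal g X * (1 / (M - 5 * Δ ^ 2)) := by ring
      _ ≤ g u * g v * numReal g X * ((1 + 12 * (Δ ^ 2 / M)) / M) :=
          mul_le_mul_of_nonneg_left this (mul_nonneg hP0 hN)
      _ = _ := by ring
  have hprod := mul_nonneg hδ0 hPMN
  rw [abs_le]
  constructor <;> linarith

/-- The same estimate with respect to a slightly larger reference value `M`. -/
lemma abs_sum_adjInd_sub_le {g : V → ℝ} {X : SimpleGraph V} {Δ M : ℝ}
    (hB : DegBound g X Δ (Δ + 1)) (hΔ : 3 ≤ Δ) (hM : ∑ j, g j ≤ M) (hM' : M - 4 ≤ ∑ j, g j)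
    (hMΔ : 9 * Δ ^ 2 + 4 ≤ M) {u v : V} (huv : u ≠ v) (hX : ¬ X.Adj u v) :
    |∑ G ∈ realizations g X, adjInd G u v - g u * g v / M * numReal g X| ≤
      30 * (Δ ^ 2 / M) * (g u * g v / M * numReal g X) := by
  rcases realizations_eq_empty_or g X with ⟨h, h'⟩ | ⟨G₀, hG₀⟩
  · simp [h, h']
  have h := abs_sum_adjInd_sub_le_aux hB hΔ rfl (by linarith) huv hX
  set m := ∑ j, g j with hm
  set Q : ℝ := g u * g v * numReal g X with hQ
  have hQ0 : 0 ≤ Q := mul_nonneg (mul_nonneg (nonneg_of_mem hG₀ u) (nonneg_of_mem hG₀ v))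
    (numReal_nonneg _ _)
  have hm0 : 81 ≤ m := by nlinarith
  have hM0 : 0 < M := by linarith
  have e1 : g u * g v / m * numReal g X = Q / m := by ring
  have e2 : g u * g v / M * numReal g X = Q / M := by ring
  rw [e1] at h; rw [e2]
  have hmM : 81 / 85 * M ≤ m := by linarith
  have h1 : |Q / m - Q / M| ≤ Δ ^ 2 / M * (Q / M) := by
    rw [div_sub_div _ _ (by positivity) (by positivity), abs_of_nonneg
      (div_nonneg (by nlinarith) (by positivity)), div_le_iff₀ (by positivity)]
    have : Δ ^ 2 / M * (Q / M) * (m * M) = Δ ^ 2 * Q * (m / M) := by field_simp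
    rw [this]
    have h2 : 81 / 85 ≤ m / M := by rw [le_div_iff₀ hM0]; linarith
    have h3 : Q * M - m * Q ≤ 4 * Q := by nlinarith
    have h4 : 9 * Q ≤ Δ ^ 2 * Q := mul_le_mul_of_nonneg_right (by nlinarith) hQ0
    nlinarith [mul_nonneg (sq_nonneg Δ) hQ0]
  have h2 : Δ ^ 2 / m * (Q / m) ≤ 29 / 25 * (Δ ^ 2 / M * (Q / M)) := by
    have e : Δ ^ 2 / m * (Q / m) = Δ ^ 2 * Q / m ^ 2 := by ring
    have e' : 29 / 25 * (Δ ^ 2 / M * (Q / M)) = 29 / 25 * (Δ ^ 2 * Q) / M ^ 2 := by ring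
    rw [e, e', div_le_div_iff₀ (by positivity) (by positivity)]
    have : (81 / 85 * M) ^ 2 ≤ m ^ 2 := pow_le_pow_left₀ (by positivity) hmM 2
    nlinarith [mul_nonneg (sq_nonneg Δ) hQ0]
  have := abs_sub_le (∑ G ∈ realizations g X, adjInd G u v) (Q / m) (Q / M)
  linarith

lemma abs_sub_mul_le_of_abs_sub_le {T N₁ N α β δ k l : ℝ} (hα : 0 ≤ α)
    (hδ0 : 0 ≤ δ) (hδ : δ ≤ 1 / 9) (hk : 0 ≤ k)
    (h1 : |T - α * N₁| ≤ k * δ * (α * N₁)) (h2 : |N₁ - β * N| ≤ l * δ * (β * N)) :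
    |T - α * β * N| ≤ (k + l + k * l / 9) * δ * (α * β * N) := by
  obtain ⟨a1, a2⟩ := abs_le.1 h1
  obtain ⟨b1, b2⟩ := abs_le.1 h2
  have hlbn : 0 ≤ l * δ * (β * N) := (abs_nonneg _).trans h2
  have c1 : α * N₁ ≤ α * (β * N + l * δ * (β * N)) := mul_le_mul_of_nonneg_left (by linarith) hα
  have c2 : α * (β * N - l * δ * (β * N)) ≤ α * N₁ := mul_le_mul_of_nonneg_left (by linarith) hα
  have hkd : 0 ≤ k * δ := mul_nonneg hk hδ0
  have c3 : k * δ * (α * N₁) ≤ k * δ * (α * (β * N + l * δ * (β * N))) :=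
    mul_le_mul_of_nonneg_left c1 hkd
  have c4 : k * δ * (α * (l * δ * (β * N))) ≤ k * (1 / 9) * (α * (l * δ * (β * N))) :=
    mul_le_mul_of_nonneg_right (mul_le_mul_of_nonneg_left hδ hk) (mul_nonneg hα hlbn)
  rw [abs_le]
  constructor <;> nlinarith

/-- Two distinct edges, to first order. -/
lemma abs_sum_adjInd_mul_sub_le {g : V → ℝ} {X : SimpleGraph V} {Δ M : ℝ}
    (hB : DegBound g X Δ (Δ + 1)) (hΔ : 3 ≤ Δ) (hM : ∑ j, g j ≤ M) (hM' : M - 2 ≤ ∑ j, g j)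
    (hMΔ : 9 * Δ ^ 2 + 4 ≤ M) {p q r s : V} (hpq : p ≠ q) (hrs : r ≠ s)
    (h1 : ¬ (r = p ∧ s = q)) (h2 : ¬ (r = q ∧ s = p))
    (hpqX : ¬ X.Adj p q) (hrsX : ¬ X.Adj r s)
    (hn : ∀ G ∈ realizations g X, 0 ≤ g p * g q * (dropEdge g p q r * dropEdge g p q s)) :
    |∑ G ∈ realizations g X, adjInd G p q * adjInd G r s -
      g p * g q * (dropEdge g p q r * dropEdge g p q s) / M ^ 2 * numReal g X| ≤
      160 * (Δ ^ 2 / M) *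
        (g p * g q * (dropEdge g p q r * dropEdge g p q s) / M ^ 2 * numReal g X) := by
  rcases realizations_eq_empty_or g X with ⟨h, h'⟩ | ⟨G₀, hG₀⟩
  · simp [h, h']
  have hM0 : 0 < M := by nlinarith
  have hδ : Δ ^ 2 / M ≤ 1 / 9 := by rw [div_le_iff₀ hM0]; linarith
  have hδ0 : 0 ≤ Δ ^ 2 / M := by positivity
  have hrsX' : ¬ (addEdge X p q).Adj r s := by
    rw [addEdge_adj X hpq]; tauto
  have s2 := abs_sum_adjInd_sub_le hB hΔ hM (by linarith) hMΔ hpq hpqX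
  rw [sum_realizations_adjInd g X hpq hpqX] at s2
  have s1 := abs_sum_adjInd_sub_le (hB.dropEdge_addEdge hpq hpqX) hΔ
    (by rw [sum_dropEdge]; linarith) (by rw [sum_dropEdge]; linarith) hMΔ hrs hrsX'
  rw [sum_realizations_adj g X hpq hpqX]
  simp only [adjInd_addEdge_of_ne _ hpq h1 h2]
  have e : g p * g q * (dropEdge g p q r * dropEdge g p q s) / M ^ 2 * numReal g X =
      dropEdge g p q r * dropEdge g p q s / M * (g p * g q / M) * numReal g X := by
    field_simp
  rcases realizations_eq_empty_or (dropEdge g p q) (addEdge X p q) with ⟨h, h'⟩ | ⟨G₁, hG₁⟩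
  · rw [h, Finset.sum_empty]
    rw [h', zero_sub, abs_neg] at s2
    have hPN : 0 ≤ g p * g q / M * numReal g X := mul_nonneg (div_nonneg
      (mul_nonneg (nonneg_of_mem hG₀ p) (nonneg_of_mem hG₀ q)) hM0.le) (numReal_nonneg _ _)
    rw [abs_of_nonneg hPN] at s2
    have hz := mul_nonneg (div_nonneg (hn G₀ hG₀) (by positivity : (0:ℝ) ≤ M ^ 2))
      (numReal_nonneg g X)
    rw [zero_sub, abs_neg, abs_of_nonneg hz]
    by_cases hz0 : g p * g q / M * numReal g X = 0
    · have : g p * g q * (dropEdge g p q r * dropEdge g p q s) / M ^ 2 * numReal g X = 0 := by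
        rw [e, mul_assoc, hz0, mul_zero]
      rw [this]; simp
    · have hpos : 0 < g p * g q / M * numReal g X := lt_of_le_of_ne hPN (Ne.symm hz0)
      have h30 : 1 ≤ 30 * (Δ ^ 2 / M) := by
        by_contra hc
        push Not at hc
        nlinarith
      nlinarith
  have := abs_sub_mul_le_of_abs_sub_le (div_nonneg (mul_nonneg (nonneg_of_mem hG₁ r)
    (nonneg_of_mem hG₁ s)) hM0.le) hδ0 hδ (by norm_num) s1 s2
  rw [e]
  refine this.trans (le_of_eq ?_)
  norm_num

/-- Paths of length two, to first order. -/
lemma abs_sum_path_two_sub_le {g : V → ℝ} {X : SimpleGraph V} {Δ M : ℝ}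
    (hB : DegBound g X Δ (Δ + 1)) (hΔ : 3 ≤ Δ) (hM : ∑ j, g j ≤ M) (hM' : M - 2 ≤ ∑ j, g j)
    (hMΔ : 9 * Δ ^ 2 + 4 ≤ M) {u v a : V} (huv : u ≠ v) (hua : u ≠ a) (hav : a ≠ v)
    (huaX : ¬ X.Adj u a) (havX : ¬ X.Adj a v) :
    |∑ G ∈ realizations g X, adjInd G u a * adjInd G a v -
      g u * (g a * (g a - 1)) * g v / M ^ 2 * numReal g X| ≤
      160 * (Δ ^ 2 / M) * (g u * (g a * (g a - 1)) * g v / M ^ 2 * numReal g X) := by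
  have e : g u * g a * (dropEdge g u a a * dropEdge g u a v) =
      g u * (g a * (g a - 1)) * g v := by
    simp only [dropEdge, eqInd_self, eqInd_of_ne (Ne.symm hua), eqInd_of_ne (Ne.symm huv),
      eqInd_of_ne (Ne.symm hav)]
    ring
  have := abs_sum_adjInd_mul_sub_le hB hΔ hM hM' hMΔ hua hav (by tauto) (by tauto) huaX havX
    (fun G hG => by
      rw [e]
      exact mul_nonneg (mul_nonneg (nonneg_of_mem hG u) (mul_sub_one_nonneg_of_mem hG a))
        (nonneg_of_mem hG v))
  rwa [e] at this

/-- Two disjoint edges, to first order. -/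
lemma abs_sum_two_edges_sub_le {g : V → ℝ} {X : SimpleGraph V} {Δ M : ℝ}
    (hB : DegBound g X Δ (Δ + 1)) (hΔ : 3 ≤ Δ) (hM : ∑ j, g j ≤ M) (hM' : M - 2 ≤ ∑ j, g j)
    (hMΔ : 9 * Δ ^ 2 + 4 ≤ M) {u v a b : V} (huv : u ≠ v) (hua : u ≠ a) (hav : a ≠ v)
    (hbu : b ≠ u) (hvb : v ≠ b) (hab : a ≠ b) (huaX : ¬ X.Adj u a) (hvbX : ¬ X.Adj v b) :
    |∑ G ∈ realizations g X, adjInd G u a * adjInd G v b -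
      g u * g v * (g a * g b) / M ^ 2 * numReal g X| ≤
      160 * (Δ ^ 2 / M) * (g u * g v * (g a * g b) / M ^ 2 * numReal g X) := by
  have e : g u * g a * (dropEdge g u a v * dropEdge g u a b) = g u * g v * (g a * g b) := by
    simp only [dropEdge, eqInd_of_ne (Ne.symm huv), eqInd_of_ne (Ne.symm hav),
      eqInd_of_ne hbu, eqInd_of_ne (Ne.symm hab)]
    ring
  have := abs_sum_adjInd_mul_sub_le hB hΔ hM hM' hMΔ hua hvb (by tauto) (by tauto) huaX hvbX
    (fun G hG => by
      rw [e]
      exact mul_nonneg (mul_nonneg (nonneg_of_mem hG u) (nonneg_of_mem hG v))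
        (mul_nonneg (nonneg_of_mem hG a) (nonneg_of_mem hG b)))
  rwa [e] at this

end FirstOrder

section SecondOrder

variable {V : Type*} [Fintype V]

set_option maxHeartbeats 1000000 in
/-- Paths of length three, to first order. -/
lemma abs_sum_path_three_sub_le {g : V → ℝ} {X : SimpleGraph V} {Δ M : ℝ}
    (hB : DegBound g X Δ (Δ + 1)) (hΔ : 3 ≤ Δ) (hM : ∑ j, g j = M)
    (hMΔ : 9 * Δ ^ 2 + 4 ≤ M) {u v a b : V} (huv : u ≠ v) (hua : u ≠ a) (hav : a ≠ v)
    (hub : u ≠ b) (hbv : b ≠ v) (hab : a ≠ b) (huaX : ¬ X.Adj u a) (habX : ¬ X.Adj a b)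
    (hbvX : ¬ X.Adj b v) :
    |∑ G ∈ realizations g X, adjInd G u a * (adjInd G a b * adjInd G b v) -
      g u * (g a * (g a - 1)) * (g b * (g b - 1)) * g v / M ^ 3 * numReal g X| ≤
      730 * (Δ ^ 2 / M) *
        (g u * (g a * (g a - 1)) * (g b * (g b - 1)) * g v / M ^ 3 * numReal g X) := by
  rcases realizations_eq_empty_or g X with ⟨h, h'⟩ | ⟨G₀, hG₀⟩
  · simp [h, h']
  have hM0 : 0 < M := by nlinarith
  have hδ : Δ ^ 2 / M ≤ 1 / 9 := by rw [div_le_iff₀ hM0]; linarith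
  have hδ0 : 0 ≤ Δ ^ 2 / M := by positivity
  have s2 := abs_sum_adjInd_sub_le hB hΔ hM.le (by linarith) hMΔ hua huaX
  rw [sum_realizations_adjInd g X hua huaX] at s2
  have habX' : ¬ (addEdge X u a).Adj a b := by
    rw [addEdge_adj X hua]; tauto
  have hbvX' : ¬ (addEdge X u a).Adj b v := by
    rw [addEdge_adj X hua]; tauto
  have s1 := abs_sum_path_two_sub_le (hB.dropEdge_addEdge hua huaX) hΔ
    (by rw [sum_dropEdge]; linarith) (by rw [sum_dropEdge]; linarith) hMΔ hav hab hbv habX' hbvX'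
  rw [sum_realizations_adj g X hua huaX]
  have n1 : ¬ (a = u ∧ b = a) := by tauto
  have n2 : ¬ (a = a ∧ b = u) := by tauto
  have n3 : ¬ (b = u ∧ v = a) := by tauto
  have n4 : ¬ (b = a ∧ v = u) := by tauto
  simp only [adjInd_addEdge_of_ne _ hua n1 n2, adjInd_addEdge_of_ne _ hua n3 n4]
  have d1 : dropEdge g u a a = g a - 1 := by
    simp [dropEdge, eqInd_self, eqInd_of_ne (Ne.symm hua)]
  have d2 : dropEdge g u a b = g b := by
    simp [dropEdge, eqInd_of_ne (Ne.symm hub), eqInd_of_ne (Ne.symm hab)]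
  have d3 : dropEdge g u a v = g v := by
    simp [dropEdge, eqInd_of_ne (Ne.symm huv), eqInd_of_ne (Ne.symm hav)]
  rw [d1, d2, d3] at s1
  have e : g u * (g a * (g a - 1)) * (g b * (g b - 1)) * g v / M ^ 3 * numReal g X =
      (g a - 1) * (g b * (g b - 1)) * g v / M ^ 2 * (g u * g a / M) * numReal g X := by
    field_simp
  have hu := nonneg_of_mem hG₀ u
  have hv := nonneg_of_mem hG₀ v
  have ha := nonneg_of_mem hG₀ a
  have ha' := mul_sub_one_nonneg_of_mem hG₀ a
  have hb' := mul_sub_one_nonneg_of_mem hG₀ b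
  have hNn := numReal_nonneg g X
  rcases realizations_eq_empty_or (dropEdge g u a) (addEdge X u a) with ⟨h, h'⟩ | ⟨G₁, hG₁⟩
  · rw [h, Finset.sum_empty]
    rw [h', zero_sub, abs_neg] at s2
    have hPN : 0 ≤ g u * g a / M * numReal g X := by positivity
    rw [abs_of_nonneg hPN] at s2
    have hz : 0 ≤ g u * (g a * (g a - 1)) * (g b * (g b - 1)) * g v / M ^ 3 * numReal g X :=
      mul_nonneg (div_nonneg (mul_nonneg (mul_nonneg (mul_nonneg hu ha') hb') hv)
        (by positivity)) hNn
    rw [zero_sub, abs_neg, abs_of_nonneg hz]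
    by_cases hz0 : g u * g a / M * numReal g X = 0
    · have : g u * (g a * (g a - 1)) * (g b * (g b - 1)) * g v / M ^ 3 * numReal g X = 0 := by
        rw [e, mul_assoc, hz0, mul_zero]
      rw [this]; simp
    · have hpos : 0 < g u * g a / M * numReal g X := lt_of_le_of_ne hPN (Ne.symm hz0)
      have h30 : 1 ≤ 30 * (Δ ^ 2 / M) := by
        by_contra hc
        push Not at hc
        have := mul_lt_mul_of_pos_right hc hpos
        linarith
      have := mul_le_mul_of_nonneg_right (by linarith : 1 ≤ 730 * (Δ ^ 2 / M)) hz
      linarith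
  have p1 : 0 ≤ g a - 1 := d1 ▸ nonneg_of_mem hG₁ a
  have hα : 0 ≤ (g a - 1) * (g b * (g b - 1)) * g v / M ^ 2 :=
    div_nonneg (mul_nonneg (mul_nonneg p1 hb') hv) (by positivity)
  have := abs_sub_mul_le_of_abs_sub_le hα hδ0 hδ (by norm_num) s1 s2
  rw [e]
  refine this.trans ?_
  refine mul_le_mul_of_nonneg_right (mul_le_mul_of_nonneg_right (by norm_num) hδ0) ?_
  exact mul_nonneg (mul_nonneg hα (by positivity)) hNn

lemma abs_zero_sub_le {t k s : ℝ} (ht : 0 ≤ t) (hk : 0 ≤ k) (hs : 1 ≤ s) :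
    |0 - t| ≤ (k + s) * t := by
  rw [zero_sub, abs_neg, abs_of_nonneg ht]
  nlinarith [mul_nonneg hk ht]

/-- Edge probabilities for all pairs, with excluded pairs entering the error term. -/
lemma abs_sum_adjInd_sub_le_all {g : V → ℝ} {X : SimpleGraph V} {Δ M : ℝ}
    (hB : DegBound g X Δ (Δ + 1)) (hΔ : 3 ≤ Δ) (hM : ∑ j, g j ≤ M) (hM' : M - 4 ≤ ∑ j, g j)
    (hMΔ : 9 * Δ ^ 2 + 4 ≤ M) (u a : V) :
    |∑ G ∈ realizations g X, adjInd G u a - g u * g a / M * numReal g X| ≤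
      (30 * (Δ ^ 2 / M) + (eqInd a u + adjInd X u a)) * (g u * g a / M * numReal g X) := by
  rcases realizations_eq_empty_or g X with ⟨h, h'⟩ | ⟨G₀, hG₀⟩
  · simp [h, h']
  have hM0 : 0 < M := by nlinarith
  have hu := nonneg_of_mem hG₀ u
  have ha := nonneg_of_mem hG₀ a
  have hNn := numReal_nonneg g X
  have ht : 0 ≤ g u * g a / M * numReal g X := by positivity
  by_cases hua : u = a
  · subst hua
    rw [Finset.sum_eq_zero fun G _ => adjInd_self G u]
    exact abs_zero_sub_le ht (by positivity) (by
      rw [eqInd_self]; linarith [adjInd_nonneg X u u])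
  by_cases hX : X.Adj u a
  · rw [Finset.sum_eq_zero fun G hG => adjInd_eq_zero_of_mem hG hX]
    exact abs_zero_sub_le ht (by positivity) (by
      rw [adjInd_of_adj hX]; linarith [eqInd_nonneg a u])
  · rw [eqInd_of_ne (Ne.symm hua), adjInd_of_not_adj hX]
    simpa using abs_sum_adjInd_sub_le hB hΔ hM hM' hMΔ hua hX

lemma abs_sum_path_two_sub_le_all {g : V → ℝ} {X : SimpleGraph V} {Δ M : ℝ}
    (hB : DegBound g X Δ (Δ + 1)) (hΔ : 3 ≤ Δ) (hM : ∑ j, g j = M)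
    (hMΔ : 9 * Δ ^ 2 + 4 ≤ M) {u v : V} (huv : u ≠ v) (a : V) :
    |∑ G ∈ realizations g X, adjInd G u a * adjInd G a v -
      g u * (g a * (g a - 1)) * g v / M ^ 2 * numReal g X| ≤
      (160 * (Δ ^ 2 / M) + (eqInd a u + eqInd a v + adjInd X u a + adjInd X v a)) *
        (g u * (g a * (g a - 1)) * g v / M ^ 2 * numReal g X) := by
  rcases realizations_eq_empty_or g X with ⟨h, h'⟩ | ⟨G₀, hG₀⟩
  · simp [h, h']
  have hM0 : 0 < M := by nlinarith
  have hu := nonneg_of_mem hG₀ u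
  have hv := nonneg_of_mem hG₀ v
  have ha := mul_sub_one_nonneg_of_mem hG₀ a
  have hNn := numReal_nonneg g X
  have ht : 0 ≤ g u * (g a * (g a - 1)) * g v / M ^ 2 * numReal g X := by positivity
  have n1 := eqInd_nonneg a u
  have n2 := eqInd_nonneg a v
  have n3 := adjInd_nonneg X u a
  have n4 := adjInd_nonneg X v a
  by_cases hua : u = a
  · subst hua
    rw [Finset.sum_eq_zero fun G _ => by rw [adjInd_self, zero_mul]]
    exact abs_zero_sub_le ht (by positivity) (by rw [eqInd_self]; linarith)
  by_cases hav : a = v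
  · subst hav
    rw [Finset.sum_eq_zero fun G _ => by rw [adjInd_self, mul_zero]]
    exact abs_zero_sub_le ht (by positivity) (by rw [eqInd_self]; linarith)
  by_cases hX : X.Adj u a
  · rw [Finset.sum_eq_zero fun G hG => by rw [adjInd_eq_zero_of_mem hG hX, zero_mul]]
    exact abs_zero_sub_le ht (by positivity) (by rw [adjInd_of_adj hX]; linarith)
  by_cases hX' : X.Adj v a
  · rw [Finset.sum_eq_zero fun G hG => by rw [adjInd_eq_zero_of_mem hG hX'.symm, mul_zero]]
    exact abs_zero_sub_le ht (by positivity) (by rw [adjInd_of_adj hX']; linarith)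
  · rw [eqInd_of_ne (Ne.symm hua), eqInd_of_ne hav, adjInd_of_not_adj hX, adjInd_of_not_adj hX']
    simpa using abs_sum_path_two_sub_le hB hΔ hM.le (by linarith) hMΔ huv hua hav hX
      (fun h => hX' h.symm)

lemma abs_sum_two_edges_sub_le_all {g : V → ℝ} {X : SimpleGraph V} {Δ M : ℝ}
    (hB : DegBound g X Δ (Δ + 1)) (hΔ : 3 ≤ Δ) (hM : ∑ j, g j = M)
    (hMΔ : 9 * Δ ^ 2 + 4 ≤ M) {u v : V} (huv : u ≠ v) (hX : X.Adj u v) {a b : V} (hab : a ≠ b) :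
    |∑ G ∈ realizations g X, adjInd G u a * adjInd G v b -
      g u * g v * (g a * g b) / M ^ 2 * numReal g X| ≤
      (160 * (Δ ^ 2 / M) + (eqInd a u + eqInd b v + adjInd X u a + adjInd X v b)) *
        (g u * g v * (g a * g b) / M ^ 2 * numReal g X) := by
  rcases realizations_eq_empty_or g X with ⟨h, h'⟩ | ⟨G₀, hG₀⟩
  · simp [h, h']
  have hM0 : 0 < M := by nlinarith
  have hu := nonneg_of_mem hG₀ u
  have hv := nonneg_of_mem hG₀ v
  have ha := nonneg_of_mem hG₀ a
  have hb := nonneg_of_mem hG₀ b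
  have hNn := numReal_nonneg g X
  have ht : 0 ≤ g u * g v * (g a * g b) / M ^ 2 * numReal g X := by positivity
  have n1 := eqInd_nonneg a u
  have n2 := eqInd_nonneg b v
  have n3 := adjInd_nonneg X u a
  have n4 := adjInd_nonneg X v b
  by_cases hua : u = a
  · subst hua
    rw [Finset.sum_eq_zero fun G _ => by rw [adjInd_self, zero_mul]]
    exact abs_zero_sub_le ht (by positivity) (by rw [eqInd_self]; linarith)
  by_cases hbv : b = v
  · subst hbv
    rw [Finset.sum_eq_zero fun G _ => by rw [adjInd_self, mul_zero]]
    exact abs_zero_sub_le ht (by positivity) (by rw [eqInd_self]; linarith)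
  by_cases hXa : X.Adj u a
  · rw [Finset.sum_eq_zero fun G hG => by rw [adjInd_eq_zero_of_mem hG hXa, zero_mul]]
    exact abs_zero_sub_le ht (by positivity) (by rw [adjInd_of_adj hXa]; linarith)
  by_cases hXb : X.Adj v b
  · rw [Finset.sum_eq_zero fun G hG => by rw [adjInd_eq_zero_of_mem hG hXb, mul_zero]]
    exact abs_zero_sub_le ht (by positivity) (by rw [adjInd_of_adj hXb]; linarith)
  have hav : a ≠ v := by rintro rfl; exact hXa hX
  have hbu : b ≠ u := by rintro rfl; exact hXb hX.symm
  rw [eqInd_of_ne (Ne.symm hua), eqInd_of_ne hbv, adjInd_of_not_adj hXa, adjInd_of_not_adj hXb]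
  simpa using abs_sum_two_edges_sub_le hB hΔ hM.le (by linarith) hMΔ huv hua hav hbu
      (Ne.symm hbv) hab hXa hXb

lemma abs_sum_path_three_sub_le_all {g : V → ℝ} {X : SimpleGraph V} {Δ M : ℝ}
    (hB : DegBound g X Δ (Δ + 1)) (hΔ : 3 ≤ Δ) (hM : ∑ j, g j = M)
    (hMΔ : 9 * Δ ^ 2 + 4 ≤ M) {u v : V} (huv : u ≠ v) (hX : X.Adj u v) (a b : V) :
    |∑ G ∈ realizations g X, adjInd G u a * (adjInd G a b * adjInd G b v) -
      g u * (g a * (g a - 1)) * (g b * (g b - 1)) * g v / M ^ 3 * numReal g X| ≤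
      (730 * (Δ ^ 2 / M) + (eqInd a u + eqInd b v + eqInd b a + adjInd X u a + adjInd X v b +
        adjInd X a b)) *
        (g u * (g a * (g a - 1)) * (g b * (g b - 1)) * g v / M ^ 3 * numReal g X) := by
  rcases realizations_eq_empty_or g X with ⟨h, h'⟩ | ⟨G₀, hG₀⟩
  · simp [h, h']
  have hM0 : 0 < M := by nlinarith
  have hu := nonneg_of_mem hG₀ u
  have hv := nonneg_of_mem hG₀ v
  have ha := mul_sub_one_nonneg_of_mem hG₀ a
  have hb := mul_sub_one_nonneg_of_mem hG₀ b
  have hNn := numReal_nonneg g X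
  have ht : 0 ≤ g u * (g a * (g a - 1)) * (g b * (g b - 1)) * g v / M ^ 3 * numReal g X := by
    positivity
  have n1 := eqInd_nonneg a u
  have n2 := eqInd_nonneg b v
  have n3 := adjInd_nonneg X u a
  have n4 := adjInd_nonneg X v b
  have n5 := adjInd_nonneg X a b
  have n6 := eqInd_nonneg b a
  by_cases hua : u = a
  · subst hua
    rw [Finset.sum_eq_zero fun G _ => by rw [adjInd_self, zero_mul]]
    exact abs_zero_sub_le ht (by positivity) (by rw [eqInd_self u]; linarith)
  by_cases hbv : b = v
  · subst hbv
    rw [Finset.sum_eq_zero fun G _ => by rw [adjInd_self, mul_zero, mul_zero]]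
    exact abs_zero_sub_le ht (by positivity) (by rw [eqInd_self b]; linarith)
  by_cases hab : b = a
  · subst hab
    rw [Finset.sum_eq_zero fun G _ => by rw [adjInd_self, zero_mul, mul_zero]]
    exact abs_zero_sub_le ht (by positivity) (by rw [eqInd_self b]; linarith)
  by_cases hXa : X.Adj u a
  · rw [Finset.sum_eq_zero fun G hG => by rw [adjInd_eq_zero_of_mem hG hXa, zero_mul]]
    exact abs_zero_sub_le ht (by positivity) (by rw [adjInd_of_adj hXa]; linarith)
  by_cases hXb : X.Adj v b
  · rw [Finset.sum_eq_zero fun G hG => by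
      rw [adjInd_eq_zero_of_mem hG hXb.symm, mul_zero, mul_zero]]
    exact abs_zero_sub_le ht (by positivity) (by rw [adjInd_of_adj hXb]; linarith)
  by_cases hXab : X.Adj a b
  · rw [Finset.sum_eq_zero fun G hG => by
      rw [adjInd_eq_zero_of_mem hG hXab, zero_mul, mul_zero]]
    exact abs_zero_sub_le ht (by positivity) (by rw [adjInd_of_adj hXab]; linarith)
  have hav : a ≠ v := by rintro rfl; exact hXa hX
  have hub : u ≠ b := by rintro rfl; exact hXb hX.symm
  rw [eqInd_of_ne (Ne.symm hua), eqInd_of_ne hbv, adjInd_of_not_adj hXa, adjInd_of_not_adj hXb,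
    adjInd_of_not_adj hXab, eqInd_of_ne hab]
  simpa using abs_sum_path_three_sub_le hB hΔ hM hMΔ huv hua hav hub hbv (Ne.symm hab) hXa hXab
      (fun h => hXb h.symm)

end SecondOrder

section SwitchSums

variable {V : Type*} [Fintype V]

lemma abs_sum_sub_sum_le {ι : Type*} (s : Finset ι) {A t e : ι → ℝ}
    (h : ∀ i ∈ s, |A i - t i| ≤ e i) : |∑ i ∈ s, A i - ∑ i ∈ s, t i| ≤ ∑ i ∈ s, e i := by
  rw [← Finset.sum_sub_distrib]
  exact (Finset.abs_sum_le_sum_abs _ _).trans (Finset.sum_le_sum h)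

lemma DegBound.sum_adjInd_le {g : V → ℝ} {X G : SimpleGraph V} {Δ D : ℝ} (hB : DegBound g X Δ D)
    (hG : G ∈ realizations g X) (u : V) : ∑ b, adjInd X u b ≤ D := by
  linarith [hB.add_le u, nonneg_of_mem hG u]

lemma sum_adjInd_mul_le_of_le {Y : SimpleGraph V} {K B : ℝ} {u : V} {p : V → ℝ} (hB : 0 ≤ B)
    (hK : ∑ b, adjInd Y u b ≤ K) (hp : ∀ a, p a ≤ B) : ∑ a, adjInd Y u a * p a ≤ B * K := by
  calc _ ≤ ∑ a, adjInd Y u a * B :=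
        Finset.sum_le_sum fun a _ => mul_le_mul_of_nonneg_left (hp a) (adjInd_nonneg _ _ _)
    _ = (∑ a, adjInd Y u a) * B := by rw [Finset.sum_mul]
    _ ≤ K * B := mul_le_mul_of_nonneg_right hK hB
    _ = _ := mul_comm _ _

lemma sum_excluded_mul_le {Y : SimpleGraph V} {K B : ℝ} {u v : V} {p : V → ℝ} (hB : 0 ≤ B)
    (hK : ∀ a, ∑ b, adjInd Y a b ≤ K) (hp : ∀ a, p a ≤ B) :
    ∑ a, (eqInd a u + eqInd a v + adjInd Y u a + adjInd Y v a) * p a ≤ B * (2 + 2 * K) := by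
  have e : ∑ a, (eqInd a u + eqInd a v + adjInd Y u a + adjInd Y v a) * p a =
      p u + p v + ∑ a, adjInd Y u a * p a + ∑ a, adjInd Y v a * p a := by
    simp only [add_mul, Finset.sum_add_distrib, sum_eqInd_mul]
  rw [e]
  have h1 := sum_adjInd_mul_le_of_le hB (hK u) hp
  have h2 := sum_adjInd_mul_le_of_le hB (hK v) hp
  linarith [hp u, hp v]

lemma sum_excluded_mul_mul_le {Y : SimpleGraph V} {K B : ℝ} {u v : V} {p : V → ℝ}
    (hK : ∀ a, ∑ b, adjInd Y a b ≤ K) (hp0 : ∀ a, 0 ≤ p a) (hp : ∀ a, p a ≤ B) :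
    ∑ a, ∑ b, (eqInd a u + eqInd b v + eqInd b a + adjInd Y u a + adjInd Y v b + adjInd Y a b) *
      (p a * p b) ≤ B * (3 + 3 * K) * ∑ a, p a := by
  have hB : 0 ≤ B := (hp0 u).trans (hp u)
  have e : ∑ a, ∑ b, (eqInd a u + eqInd b v + eqInd b a + adjInd Y u a + adjInd Y v b +
      adjInd Y a b) * (p a * p b) = p u * ∑ b, p b + (∑ a, p a) * p v + ∑ a, p a * p a +
      (∑ a, adjInd Y u a * p a) * ∑ b, p b + (∑ a, p a) * ∑ b, adjInd Y v b * p b +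
      ∑ a, p a * ∑ b, adjInd Y a b * p b := by
    have e1 : p u * ∑ b, p b = ∑ a, eqInd a u * (p a * ∑ b, p b) :=
      (sum_eqInd_mul u (fun a => p a * ∑ b, p b)).symm
    have e2 : p v = ∑ b, eqInd b v * p b := (sum_eqInd_mul v p).symm
    have e3 : ∀ a, p a * p a = ∑ b, eqInd b a * (p a * p b) := fun a =>
      (sum_eqInd_mul a (fun b => p a * p b)).symm
    simp_rw [e1, e3]
    conv_rhs => enter [1, 1, 1, 1, 2]; rw [e2]
    rw [Finset.sum_mul_sum, Finset.sum_mul_sum, Finset.sum_mul_sum]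
    simp_rw [Finset.mul_sum]
    simp only [← Finset.sum_add_distrib]
    refine Finset.sum_congr rfl fun a _ => Finset.sum_congr rfl fun b _ => ?_
    ring
  have hS : 0 ≤ ∑ a, p a := Finset.sum_nonneg fun a _ => hp0 a
  have h1 := mul_le_mul_of_nonneg_right (sum_adjInd_mul_le_of_le hB (hK u) hp) hS
  have h2 := mul_le_mul_of_nonneg_left (sum_adjInd_mul_le_of_le hB (hK v) hp) hS
  have h3 : ∑ a, p a * ∑ b, adjInd Y a b * p b ≤ (∑ a, p a) * (B * K) := by
    rw [Finset.sum_mul]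
    exact Finset.sum_le_sum fun a _ =>
      mul_le_mul_of_nonneg_left (sum_adjInd_mul_le_of_le hB (hK a) hp) (hp0 a)
  have h4 : ∑ a, p a * p a ≤ (∑ a, p a) * B := by
    rw [Finset.sum_mul]
    exact Finset.sum_le_sum fun a _ => mul_le_mul_of_nonneg_left (hp a) (hp0 a)
  have h5 := mul_le_mul_of_nonneg_right (hp u) hS
  have h6 := mul_le_mul_of_nonneg_left (hp v) hS
  rw [e]
  linarith

lemma sum_adjInd_excluded_le {Y : SimpleGraph V} {K B : ℝ} {u v : V} {p : V → ℝ}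
    (hK : ∀ a, ∑ b, adjInd Y a b ≤ K) (hp0 : ∀ a, 0 ≤ p a) (hp : ∀ a, p a ≤ B) :
    ∑ a, ∑ b, adjInd Y a b * ((eqInd a u + eqInd b v + adjInd Y u a + adjInd Y v b) *
      (p a * p b)) ≤ B ^ 2 * (2 * K + 2 * K ^ 2) := by
  have hB : 0 ≤ B := (hp0 u).trans (hp u)
  have hK0 : 0 ≤ K := (Finset.sum_nonneg fun b _ => adjInd_nonneg Y u b).trans (hK u)
  have e : ∑ a, ∑ b, adjInd Y a b * ((eqInd a u + eqInd b v + adjInd Y u a + adjInd Y v b) *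
      (p a * p b)) = p u * ∑ b, adjInd Y u b * p b + p v * ∑ a, adjInd Y v a * p a +
      ∑ a, adjInd Y u a * (p a * ∑ b, adjInd Y a b * p b) +
      ∑ b, adjInd Y v b * (p b * ∑ a, adjInd Y b a * p a) := by
    have e1 : p u * ∑ b, adjInd Y u b * p b =
        ∑ a, eqInd a u * (p a * ∑ b, adjInd Y a b * p b) :=
      (sum_eqInd_mul u (fun a => p a * ∑ b, adjInd Y a b * p b)).symm
    have e2 : p v * ∑ a, adjInd Y v a * p a =
        ∑ a, ∑ b, eqInd b v * (p b * (adjInd Y b a * p a)) := by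
      rw [Finset.sum_comm, ← sum_eqInd_mul v (fun b => p b * ∑ a, adjInd Y b a * p a)]
      refine Finset.sum_congr rfl fun b _ => ?_
      rw [Finset.mul_sum, Finset.mul_sum]
    have e3 : ∑ b, adjInd Y v b * (p b * ∑ a, adjInd Y b a * p a) =
        ∑ a, ∑ b, adjInd Y v b * (p b * (adjInd Y b a * p a)) := by
      rw [Finset.sum_comm]
      refine Finset.sum_congr rfl fun b _ => ?_
      rw [Finset.mul_sum, Finset.mul_sum]
    rw [e1, e2, e3]
    simp_rw [Finset.mul_sum]
    simp only [← Finset.sum_add_distrib]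
    refine Finset.sum_congr rfl fun a _ => Finset.sum_congr rfl fun b _ => ?_
    rw [adjInd_comm Y b a]
    ring
  have hin : ∀ a, p a * ∑ b, adjInd Y a b * p b ≤ B * (B * K) := fun a =>
    mul_le_mul (hp a) (sum_adjInd_mul_le_of_le hB (hK a) hp)
      (Finset.sum_nonneg fun b _ => mul_nonneg (adjInd_nonneg _ _ _) (hp0 b)) hB
  have h1 := sum_adjInd_mul_le_of_le (by positivity : 0 ≤ B * (B * K)) (hK u) hin
  have h2 := sum_adjInd_mul_le_of_le (by positivity : 0 ≤ B * (B * K)) (hK v) hin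
  have h3 := hin u
  have h4 := hin v
  rw [e]
  nlinarith

lemma mul_sub_one_le_of_mem {g : V → ℝ} {X G : SimpleGraph V} (hG : G ∈ realizations g X) {Δ : ℝ}
    (hg : ∀ j, g j ≤ Δ) (a : V) : g a * (g a - 1) ≤ Δ ^ 2 := by
  nlinarith [hg a, nonneg_of_mem hG a]

/-- Second order expansion of the number of failed switchings towards `uv`. -/
lemma abs_sum_switchBad_sub_le {g : V → ℝ} {Y : SimpleGraph V} {Δ M : ℝ}
    (hB : DegBound g Y Δ (Δ + 1)) (hΔ : 3 ≤ Δ) (hM : ∑ j, g j = M)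
    (hMΔ : 9 * Δ ^ 2 + 4 ≤ M) {u v : V} (huv : u ≠ v) (hY : Y.Adj u v) :
    |∑ G ∈ realizations g Y, switchBad Y G u v - g u * g v *
      (fallTwo g ^ 2 / M ^ 3 + fallTwo g / M ^ 2 + edgeWeight g Y / M ^ 2) * numReal g Y| ≤
      1100 * (Δ ^ 4 / M ^ 2) * (g u * g v * numReal g Y) := by
  rcases realizations_eq_empty_or g Y with ⟨h, h'⟩ | ⟨G₀, hG₀⟩
  · simp [h, h']
  have hM0 : 0 < M := by nlinarith
  have hu := nonneg_of_mem hG₀ u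
  have hv := nonneg_of_mem hG₀ v
  have hNn := numReal_nonneg g Y
  have hQ0 : 0 ≤ g u * g v * numReal g Y := by positivity
  have hK := hB.sum_adjInd_le hG₀
  have s0 := fallTwo_nonneg_of_mem hG₀
  have s1 : fallTwo g ≤ Δ * M := by
    have := fallTwo_le_of_mem hG₀ hB.le
    rw [hM] at this; linarith
  have x0 := edgeWeight_nonneg_of_mem hG₀ Y
  have x1 : edgeWeight g Y ≤ Δ ^ 2 * M := by
    have := edgeWeight_le_of_mem hG₀ hB
    rw [hM] at this; nlinarith
  rw [sum_switchBad]
  have hp0 := mul_sub_one_nonneg_of_mem hG₀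
  have hp1 := mul_sub_one_le_of_mem hG₀ hB.le
  have h1 : |∑ a, ∑ b, ∑ G ∈ realizations g Y, adjInd G u a * (adjInd G a b * adjInd G b v) -
      fallTwo g ^ 2 / M ^ 3 * (g u * g v * numReal g Y)| ≤
      735 * (Δ ^ 4 / M ^ 2) * (g u * g v * numReal g Y) := by
    have t : fallTwo g ^ 2 / M ^ 3 * (g u * g v * numReal g Y) = ∑ a, ∑ b,
        g u * (g a * (g a - 1)) * (g b * (g b - 1)) * g v / M ^ 3 * numReal g Y := by
      rw [fallTwo, sq, Finset.sum_mul_sum, Finset.sum_div, Finset.sum_mul]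
      refine Finset.sum_congr rfl fun a _ => ?_
      rw [Finset.sum_div, Finset.sum_mul]
      exact Finset.sum_congr rfl fun b _ => by ring
    rw [t]
    refine (abs_sum_sub_sum_le _ fun a _ => abs_sum_sub_sum_le _ fun b _ =>
      abs_sum_path_three_sub_le_all hB hΔ hM hMΔ huv hY a b).trans ?_
    have t2 : ∑ a, ∑ b, (730 * (Δ ^ 2 / M) + (eqInd a u + eqInd b v + eqInd b a + adjInd Y u a +
        adjInd Y v b + adjInd Y a b)) *
        (g u * (g a * (g a - 1)) * (g b * (g b - 1)) * g v / M ^ 3 * numReal g Y) =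
        (730 * (Δ ^ 2 / M) * fallTwo g ^ 2 + ∑ a, ∑ b, (eqInd a u + eqInd b v + eqInd b a +
          adjInd Y u a + adjInd Y v b + adjInd Y a b) * ((g a * (g a - 1)) * (g b * (g b - 1)))) *
        (g u * g v * numReal g Y / M ^ 3) := by
      rw [fallTwo, sq (∑ a, g a * (g a - 1)), Finset.sum_mul_sum, Finset.mul_sum,
        ← Finset.sum_add_distrib, Finset.sum_mul]
      refine Finset.sum_congr rfl fun a _ => ?_
      rw [Finset.mul_sum, ← Finset.sum_add_distrib, Finset.sum_mul]
      exact Finset.sum_congr rfl fun b _ => by ring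
    rw [t2]
    have t3 := sum_excluded_mul_mul_le (u := u) (v := v) hK hp0 hp1
    rw [← fallTwo] at t3
    have t4 : Δ ^ 2 * (3 + 3 * (Δ + 1)) * fallTwo g ≤ 5 * Δ ^ 4 * M := by
      calc Δ ^ 2 * (3 + 3 * (Δ + 1)) * fallTwo g ≤ Δ ^ 2 * (5 * Δ) * (Δ * M) :=
            mul_le_mul (mul_le_mul_of_nonneg_left (by linarith) (sq_nonneg _)) s1 s0 (by positivity)
        _ = _ := by ring
    have t5 : 730 * (Δ ^ 2 / M) * fallTwo g ^ 2 ≤ 730 * Δ ^ 4 * M := by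
      calc 730 * (Δ ^ 2 / M) * fallTwo g ^ 2 ≤ 730 * (Δ ^ 2 / M) * (Δ * M) ^ 2 :=
            mul_le_mul_of_nonneg_left (pow_le_pow_left₀ s0 s1 2) (by positivity)
        _ = _ := by field_simp
    calc _ ≤ (730 * Δ ^ 4 * M + 5 * Δ ^ 4 * M) * (g u * g v * numReal g Y / M ^ 3) :=
          mul_le_mul_of_nonneg_right (by linarith) (by positivity)
      _ = _ := by field_simp; ring
  have h2 : |∑ a, ∑ G ∈ realizations g Y, adjInd G u a * adjInd G a v -
      fallTwo g / M ^ 2 * (g u * g v * numReal g Y)| ≤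
      162 * (Δ ^ 4 / M ^ 2) * (g u * g v * numReal g Y) := by
    have t : fallTwo g / M ^ 2 * (g u * g v * numReal g Y) = ∑ a,
        g u * (g a * (g a - 1)) * g v / M ^ 2 * numReal g Y := by
      rw [fallTwo, Finset.sum_div, Finset.sum_mul]
      exact Finset.sum_congr rfl fun a _ => by ring
    rw [t]
    refine (abs_sum_sub_sum_le _ fun a _ =>
      abs_sum_path_two_sub_le_all hB hΔ hM hMΔ huv a).trans ?_
    have t2 : ∑ a, (160 * (Δ ^ 2 / M) + (eqInd a u + eqInd a v + adjInd Y u a + adjInd Y v a)) *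
        (g u * (g a * (g a - 1)) * g v / M ^ 2 * numReal g Y) =
        (160 * (Δ ^ 2 / M) * fallTwo g + ∑ a, (eqInd a u + eqInd a v + adjInd Y u a +
          adjInd Y v a) * (g a * (g a - 1))) * (g u * g v * numReal g Y / M ^ 2) := by
      rw [fallTwo, Finset.mul_sum, ← Finset.sum_add_distrib, Finset.sum_mul]
      exact Finset.sum_congr rfl fun a _ => by ring
    rw [t2]
    have t3 := sum_excluded_mul_le (u := u) (v := v) (sq_nonneg Δ) hK hp1
    have t4 : Δ ^ 2 * (2 + 2 * (Δ + 1)) ≤ 2 * Δ ^ 4 := by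
      calc Δ ^ 2 * (2 + 2 * (Δ + 1)) ≤ Δ ^ 2 * (2 * Δ ^ 2) :=
            mul_le_mul_of_nonneg_left (by nlinarith) (sq_nonneg _)
        _ = _ := by ring
    have t5 : 160 * (Δ ^ 2 / M) * fallTwo g ≤ 160 * Δ ^ 4 := by
      calc 160 * (Δ ^ 2 / M) * fallTwo g ≤ 160 * (Δ ^ 2 / M) * (Δ * M) :=
            mul_le_mul_of_nonneg_left s1 (by positivity)
        _ = 160 * Δ ^ 3 := by field_simp
        _ ≤ 160 * Δ ^ 4 := by
            have : Δ ^ 3 ≤ Δ ^ 4 := pow_le_pow_right₀ (by linarith) (by norm_num)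
            linarith
    calc _ ≤ (160 * Δ ^ 4 + 2 * Δ ^ 4) * (g u * g v * numReal g Y / M ^ 2) :=
          mul_le_mul_of_nonneg_right (by linarith) (by positivity)
      _ = _ := by ring
  have h3 : |∑ a, ∑ b, adjInd Y a b * ∑ G ∈ realizations g Y, adjInd G u a * adjInd G v b -
      edgeWeight g Y / M ^ 2 * (g u * g v * numReal g Y)| ≤
      167 * (Δ ^ 4 / M ^ 2) * (g u * g v * numReal g Y) := by
    have t : edgeWeight g Y / M ^ 2 * (g u * g v * numReal g Y) = ∑ a, ∑ b,
        adjInd Y a b * (g u * g v * (g a * g b) / M ^ 2 * numReal g Y) := by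
      rw [edgeWeight, Finset.sum_div, Finset.sum_mul]
      refine Finset.sum_congr rfl fun a _ => ?_
      rw [Finset.sum_div, Finset.sum_mul]
      exact Finset.sum_congr rfl fun b _ => by ring
    rw [t]
    refine (abs_sum_sub_sum_le (e := fun a => ∑ b, adjInd Y a b * ((160 * (Δ ^ 2 / M) +
      (eqInd a u + eqInd b v + adjInd Y u a + adjInd Y v b)) *
        (g u * g v * (g a * g b) / M ^ 2 * numReal g Y))) _ fun a _ =>
          abs_sum_sub_sum_le _ fun b _ => ?_).trans ?_
    · rw [← mul_sub, abs_mul, abs_of_nonneg (adjInd_nonneg _ _ _)]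
      by_cases hab : a = b
      · subst hab; simp [adjInd_self]
      · exact mul_le_mul_of_nonneg_left (abs_sum_two_edges_sub_le_all hB hΔ hM hMΔ huv hY hab)
          (adjInd_nonneg _ _ _)
    have t2 : ∑ a, ∑ b, adjInd Y a b * ((160 * (Δ ^ 2 / M) +
        (eqInd a u + eqInd b v + adjInd Y u a + adjInd Y v b)) *
        (g u * g v * (g a * g b) / M ^ 2 * numReal g Y)) =
        (160 * (Δ ^ 2 / M) * edgeWeight g Y + ∑ a, ∑ b, adjInd Y a b * ((eqInd a u + eqInd b v +
          adjInd Y u a + adjInd Y v b) * (g a * g b))) * (g u * g v * numReal g Y / M ^ 2) := by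
      rw [edgeWeight, Finset.mul_sum, ← Finset.sum_add_distrib, Finset.sum_mul]
      refine Finset.sum_congr rfl fun a _ => ?_
      rw [Finset.mul_sum, ← Finset.sum_add_distrib, Finset.sum_mul]
      exact Finset.sum_congr rfl fun b _ => by ring
    rw [t2]
    have t3 := sum_adjInd_excluded_le (u := u) (v := v) hK (nonneg_of_mem hG₀) hB.le
    have t4 : Δ ^ 2 * (2 * (Δ + 1) + 2 * (Δ + 1) ^ 2) ≤ 7 * Δ ^ 4 := by
      calc Δ ^ 2 * (2 * (Δ + 1) + 2 * (Δ + 1) ^ 2) ≤ Δ ^ 2 * (7 * Δ ^ 2) :=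
            mul_le_mul_of_nonneg_left (by nlinarith) (sq_nonneg _)
        _ = _ := by ring
    have t5 : 160 * (Δ ^ 2 / M) * edgeWeight g Y ≤ 160 * Δ ^ 4 := by
      calc 160 * (Δ ^ 2 / M) * edgeWeight g Y ≤ 160 * (Δ ^ 2 / M) * (Δ ^ 2 * M) :=
            mul_le_mul_of_nonneg_left x1 (by positivity)
        _ = _ := by field_simp
    calc _ ≤ (160 * Δ ^ 4 + 7 * Δ ^ 4) * (g u * g v * numReal g Y / M ^ 2) :=
          mul_le_mul_of_nonneg_right (by linarith) (by positivity)
      _ = _ := by ring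
  have hR : 0 ≤ Δ ^ 4 / M ^ 2 * (g u * g v * numReal g Y) := by positivity
  rw [abs_le] at h1 h2 h3 ⊢
  have e : g u * g v * (fallTwo g ^ 2 / M ^ 3 + fallTwo g / M ^ 2 + edgeWeight g Y / M ^ 2) *
      numReal g Y = fallTwo g ^ 2 / M ^ 3 * (g u * g v * numReal g Y) +
      fallTwo g / M ^ 2 * (g u * g v * numReal g Y) +
      edgeWeight g Y / M ^ 2 * (g u * g v * numReal g Y) := by ring
  rw [e]
  constructor <;> linarith [h1.1, h1.2, h2.1, h2.2, h3.1, h3.2]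

end SwitchSums

section SwitchOut

variable {V : Type*} [Fintype V]

lemma sum_adjInd_blocked (Y H : SimpleGraph V) (u v : V) :
    ∑ a, ∑ b, adjInd H a b * blocked Y H u a * blocked Y H v b =
      adjInd H u v + ∑ b, adjInd H u b * adjInd H b v + ∑ b, adjInd Y v b * adjInd H u b +
      ∑ a, adjInd H u a * adjInd H a v + ∑ a, adjInd Y u a * adjInd H v a +
      ∑ a, ∑ b, adjInd H u a * (adjInd H a b * adjInd H b v) +
      ∑ b, adjInd Y v b * ∑ a, adjInd H u a * adjInd H a b +
      ∑ a, adjInd Y u a * ∑ b, adjInd H v b * adjInd H b a +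
      ∑ a, adjInd Y u a * ∑ b, adjInd Y v b * adjInd H a b := by
  have hx : ∀ a, ∑ b, adjInd H a b * blocked Y H v b = adjInd H a v +
      ∑ b, adjInd H a b * adjInd H b v + ∑ b, adjInd Y v b * adjInd H a b := by
    intro a
    have : adjInd H a v = ∑ b, eqInd b v * adjInd H a b :=
      (sum_eqInd_mul v fun b => adjInd H a b).symm
    rw [this]
    simp only [← Finset.sum_add_distrib]
    refine Finset.sum_congr rfl fun b _ => ?_
    rw [blocked, adjInd_comm H b v]; ring
  have h0 : ∑ a, ∑ b, adjInd H a b * blocked Y H u a * blocked Y H v b =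
      ∑ a, (eqInd a u + adjInd H u a + adjInd Y u a) * (adjInd H a v +
      ∑ b, adjInd H a b * adjInd H b v + ∑ b, adjInd Y v b * adjInd H a b) := by
    refine Finset.sum_congr rfl fun a _ => ?_
    rw [← hx, Finset.mul_sum]
    refine Finset.sum_congr rfl fun b _ => ?_
    rw [blocked]; ring
  have h1 : ∑ b, adjInd Y v b * ∑ a, adjInd H u a * adjInd H a b =
      ∑ a, adjInd H u a * ∑ b, adjInd Y v b * adjInd H a b := by
    simp_rw [Finset.mul_sum]
    rw [Finset.sum_comm]
    exact Finset.sum_congr rfl fun a _ => Finset.sum_congr rfl fun b _ => by ring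
  have h2 : ∑ a, adjInd Y u a * ∑ b, adjInd H v b * adjInd H b a =
      ∑ a, adjInd Y u a * ∑ b, adjInd H a b * adjInd H b v := by
    refine Finset.sum_congr rfl fun a _ => ?_
    congr 1
    exact Finset.sum_congr rfl fun b _ => by
      rw [adjInd_comm H v b, adjInd_comm H b a, mul_comm]
  rw [h0, h1, h2]
  simp only [add_mul, Finset.sum_add_distrib, sum_eqInd_mul, mul_add, ← Finset.mul_sum,
    adjInd_comm H v]
  ring

/-- Upper bounds with a common reference value `M`. -/
lemma sum_adjInd_le_three {h : V → ℝ} {Y : SimpleGraph V} {Δ M : ℝ}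
    (hB : DegBound h Y Δ (Δ + 1)) (hΔ : 3 ≤ Δ) (hM' : M - 2 ≤ ∑ j, h j) (hMΔ : 9 * Δ ^ 2 ≤ M)
    (a b : V) :
    ∑ H ∈ realizations h Y, adjInd H a b ≤ 3 * (Δ ^ 2 / M) * numReal h Y := by
  have hM0 : 0 < M := by nlinarith
  rcases realizations_eq_empty_or h Y with ⟨he, h'⟩ | ⟨G₀, hG₀⟩
  · simp [he, h']
  have hNn := numReal_nonneg h Y
  by_cases hab : a = b
  · subst hab
    rw [Finset.sum_eq_zero fun G _ => adjInd_self G a]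
    positivity
  refine (sum_adjInd_le hB (by linarith) (by positivity : 0 < 4 / 9 * M) (by nlinarith) hab).trans ?_
  refine mul_le_mul_of_nonneg_right ?_ hNn
  calc h a * h b / (4 / 9 * M) ≤ Δ ^ 2 / (4 / 9 * M) := by
        refine div_le_div_of_nonneg_right ?_ (by positivity)
        rw [sq]
        exact mul_le_mul (hB.le a) (hB.le b) (nonneg_of_mem hG₀ b) (by linarith)
    _ = 9 / 4 * (Δ ^ 2 / M) := by field_simp
    _ ≤ _ := mul_le_mul_of_nonneg_right (by norm_num) (by positivity)

lemma sum_path_two_le_six {h : V → ℝ} {Y : SimpleGraph V} {Δ M : ℝ}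
    (hB : DegBound h Y Δ (Δ + 1)) (hΔ : 3 ≤ Δ) (hM : ∑ j, h j ≤ M) (hM' : M - 2 ≤ ∑ j, h j)
    (hMΔ : 9 * Δ ^ 2 ≤ M) {u v : V} (huv : u ≠ v) :
    ∑ H ∈ realizations h Y, ∑ a, adjInd H u a * adjInd H a v ≤
      6 * (Δ ^ 3 / M) * numReal h Y := by
  have hM0 : 0 < M := by nlinarith
  rcases realizations_eq_empty_or h Y with ⟨he, h'⟩ | ⟨G₀, hG₀⟩
  · simp [he, h']
  have hNn := numReal_nonneg h Y
  rw [Finset.sum_comm]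
  calc _ ≤ ∑ a, h u * (h a * (h a - 1)) * h v / (4 / 9 * M) ^ 2 * numReal h Y :=
        Finset.sum_le_sum fun a _ =>
          sum_path_two_le hB (by linarith) (by positivity) (by nlinarith) huv a
    _ = h u * h v * fallTwo h / (4 / 9 * M) ^ 2 * numReal h Y := by
        rw [fallTwo, Finset.mul_sum, Finset.sum_div, Finset.sum_mul]
        exact Finset.sum_congr rfl fun a _ => by ring
    _ ≤ Δ ^ 2 * (Δ * M) / (4 / 9 * M) ^ 2 * numReal h Y := by
        refine mul_le_mul_of_nonneg_right (div_le_div_of_nonneg_right ?_ (by positivity)) hNn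
        refine mul_le_mul ?_ ?_ (fallTwo_nonneg_of_mem hG₀) (by positivity)
        · rw [sq]
          exact mul_le_mul (hB.le u) (hB.le v) (nonneg_of_mem hG₀ v) (by linarith)
        · refine (fallTwo_le_of_mem hG₀ hB.le).trans ?_
          exact mul_le_mul (by linarith) hM (Finset.sum_nonneg fun j _ => nonneg_of_mem hG₀ j)
            (by linarith)
    _ = 81 / 16 * (Δ ^ 3 / M) * numReal h Y := by field_simp; ring
    _ ≤ _ := mul_le_mul_of_nonneg_right
        (mul_le_mul_of_nonneg_right (by norm_num) (by positivity)) hNn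

lemma sum_path_three_le_twelve {h : V → ℝ} {Y : SimpleGraph V} {Δ M : ℝ}
    (hB : DegBound h Y Δ (Δ + 1)) (hΔ : 3 ≤ Δ) (hM : ∑ j, h j ≤ M) (hM' : M - 2 ≤ ∑ j, h j)
    (hMΔ : 9 * Δ ^ 2 ≤ M) {u v : V} (huv : u ≠ v) (hY : Y.Adj u v) :
    ∑ H ∈ realizations h Y, ∑ a, ∑ b, adjInd H u a * (adjInd H a b * adjInd H b v) ≤
      12 * (Δ ^ 4 / M) * numReal h Y := by
  have hM0 : 0 < M := by nlinarith
  rcases realizations_eq_empty_or h Y with ⟨he, h'⟩ | ⟨G₀, hG₀⟩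
  · simp [he, h']
  have hNn := numReal_nonneg h Y
  rw [Finset.sum_comm, Finset.sum_congr rfl fun a _ => Finset.sum_comm]
  calc _ ≤ ∑ a, ∑ b, h u * (h a * (h a - 1)) * (h b * (h b - 1)) * h v / (4 / 9 * M) ^ 3 *
          numReal h Y :=
        Finset.sum_le_sum fun a _ => Finset.sum_le_sum fun b _ =>
          sum_path_three_le hB (by linarith) (by positivity) (by nlinarith) huv hY a b
    _ = h u * h v * fallTwo h ^ 2 / (4 / 9 * M) ^ 3 * numReal h Y := by
        rw [fallTwo, sq, Finset.sum_mul_sum, Finset.mul_sum, Finset.sum_div, Finset.sum_mul]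
        refine Finset.sum_congr rfl fun a _ => ?_
        rw [Finset.mul_sum, Finset.sum_div, Finset.sum_mul]
        exact Finset.sum_congr rfl fun b _ => by ring
    _ ≤ Δ ^ 2 * (Δ * M) ^ 2 / (4 / 9 * M) ^ 3 * numReal h Y := by
        refine mul_le_mul_of_nonneg_right (div_le_div_of_nonneg_right ?_ (by positivity)) hNn
        refine mul_le_mul ?_ ?_ (sq_nonneg _) (by positivity)
        · rw [sq]
          exact mul_le_mul (hB.le u) (hB.le v) (nonneg_of_mem hG₀ v) (by linarith)
        · refine pow_le_pow_left₀ (fallTwo_nonneg_of_mem hG₀) ?_ 2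
          refine (fallTwo_le_of_mem hG₀ hB.le).trans ?_
          exact mul_le_mul (by linarith) hM (Finset.sum_nonneg fun j _ => nonneg_of_mem hG₀ j)
            (by linarith)
    _ = 729 / 64 * (Δ ^ 4 / M) * numReal h Y := by field_simp; ring
    _ ≤ _ := mul_le_mul_of_nonneg_right
        (mul_le_mul_of_nonneg_right (by norm_num) (by positivity)) hNn

/-- Closed walks of length two count the degree. -/
lemma sum_adjInd_mul_self {h : V → ℝ} {Y H : SimpleGraph V} (hH : H ∈ realizations h Y) (u : V) :
    ∑ a, adjInd H u a * adjInd H a u = h u := by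
  rw [← (mem_realizations.1 hH).2 u]
  refine Finset.sum_congr rfl fun a _ => ?_
  rw [adjInd_comm H a u]
  unfold adjInd; split_ifs <;> simp

lemma abs_sum_walks_two_sub_le {h : V → ℝ} {Y : SimpleGraph V} {Δ M : ℝ}
    (hB : DegBound h Y Δ (Δ + 1)) (hΔ : 3 ≤ Δ) (hM : ∑ j, h j ≤ M) (hM' : M - 2 ≤ ∑ j, h j)
    (hMΔ : 9 * Δ ^ 2 ≤ M) {u v : V} (hY : Y.Adj v u) :
    |∑ H ∈ realizations h Y, ∑ b, adjInd Y v b * ∑ a, adjInd H u a * adjInd H a b -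
      h u * numReal h Y| ≤ 8 * (Δ ^ 4 / M) * numReal h Y := by
  have hM0 : 0 < M := by nlinarith
  rcases realizations_eq_empty_or h Y with ⟨he, h'⟩ | ⟨G₀, hG₀⟩
  · simp [he, h']
  have hNn := numReal_nonneg h Y
  have e : h u * numReal h Y = ∑ b, eqInd b u * (adjInd Y v b * (h u * numReal h Y)) := by
    rw [sum_eqInd_mul, adjInd_of_adj hY, one_mul]
  rw [Finset.sum_comm, e]
  have step : ∀ b, |∑ H ∈ realizations h Y, adjInd Y v b * ∑ a, adjInd H u a * adjInd H a b -
      eqInd b u * (adjInd Y v b * (h u * numReal h Y))| ≤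
      adjInd Y v b * (6 * (Δ ^ 3 / M) * numReal h Y) := by
    intro b
    rw [← Finset.mul_sum]
    by_cases hb : b = u
    · subst hb
      rw [Finset.sum_congr rfl fun H hH => sum_adjInd_mul_self hH b, Finset.sum_const,
        nsmul_eq_mul, eqInd_self, one_mul, numReal, mul_comm ((realizations h Y).card : ℝ) (h b),
        sub_self, abs_zero]
      exact mul_nonneg (adjInd_nonneg _ _ _) (by positivity)
    · rw [eqInd_of_ne hb, zero_mul, sub_zero, abs_mul, abs_of_nonneg (adjInd_nonneg _ _ _)]
      refine mul_le_mul_of_nonneg_left ?_ (adjInd_nonneg _ _ _)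
      rw [abs_of_nonneg (Finset.sum_nonneg fun H _ => Finset.sum_nonneg fun a _ =>
        mul_nonneg (adjInd_nonneg _ _ _) (adjInd_nonneg _ _ _))]
      exact sum_path_two_le_six hB hΔ hM hM' hMΔ (Ne.symm hb)
  refine (abs_sum_sub_sum_le _ fun b _ => step b).trans ?_
  rw [← Finset.sum_mul]
  calc _ ≤ (Δ + 1) * (6 * (Δ ^ 3 / M) * numReal h Y) :=
        mul_le_mul_of_nonneg_right (hB.sum_adjInd_le hG₀ v) (by positivity)
    _ ≤ (4 / 3 * Δ) * (6 * (Δ ^ 3 / M) * numReal h Y) :=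
        mul_le_mul_of_nonneg_right (by linarith) (by positivity)
    _ = _ := by ring

lemma sum_adjInd_mul_sum_le {h : V → ℝ} {Y : SimpleGraph V} {Δ M : ℝ}
    (hB : DegBound h Y Δ (Δ + 1)) (hΔ : 3 ≤ Δ) (hM' : M - 2 ≤ ∑ j, h j)
    (hMΔ : 9 * Δ ^ 2 ≤ M) (u v : V) :
    ∑ H ∈ realizations h Y, ∑ b, adjInd Y v b * adjInd H u b ≤
      4 * (Δ ^ 3 / M) * numReal h Y := by
  have hM0 : 0 < M := by nlinarith
  rcases realizations_eq_empty_or h Y with ⟨he, h'⟩ | ⟨G₀, hG₀⟩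
  · simp [he, h']
  have hNn := numReal_nonneg h Y
  rw [Finset.sum_comm]
  simp_rw [← Finset.mul_sum]
  calc _ ≤ (3 * (Δ ^ 2 / M) * numReal h Y) * (Δ + 1) :=
        sum_adjInd_mul_le_of_le (by positivity) (hB.sum_adjInd_le hG₀ v)
          (fun b => sum_adjInd_le_three hB hΔ hM' hMΔ u b)
    _ ≤ (3 * (Δ ^ 2 / M) * numReal h Y) * (4 / 3 * Δ) :=
        mul_le_mul_of_nonneg_left (by linarith) (by positivity)
    _ = _ := by ring

/-- The switchings that are blocked at both ends. -/
lemma abs_sum_overlap_sub_le {h : V → ℝ} {Y : SimpleGraph V} {Δ M : ℝ}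
    (hB : DegBound h Y Δ (Δ + 1)) (hΔ : 3 ≤ Δ) (hM : ∑ j, h j ≤ M) (hM' : M - 2 ≤ ∑ j, h j)
    (hMΔ : 9 * Δ ^ 2 ≤ M) {u v : V} (huv : u ≠ v) (hY : Y.Adj u v) :
    |∑ H ∈ realizations h Y, ∑ a, ∑ b, adjInd H a b * blocked Y H u a * blocked Y H v b -
      (h u + h v) * numReal h Y| ≤ 42 * (Δ ^ 4 / M) * numReal h Y := by
  have hM0 : 0 < M := by nlinarith
  rcases realizations_eq_empty_or h Y with ⟨he, h'⟩ | ⟨G₀, hG₀⟩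
  · simp [he, h']
  have hNn := numReal_nonneg h Y
  rw [Finset.sum_congr rfl fun H hH => (by
    rw [sum_adjInd_blocked, adjInd_eq_zero_of_mem hH hY, zero_add] :
      ∑ a, ∑ b, adjInd H a b * blocked Y H u a * blocked Y H v b = _)]
  simp only [Finset.sum_add_distrib]
  have n0 : ∀ H : SimpleGraph V, ∀ a b c d, 0 ≤ adjInd H a b * adjInd H c d := fun H a b c d =>
    mul_nonneg (adjInd_nonneg _ _ _) (adjInd_nonneg _ _ _)
  have p2 := sum_path_two_le_six hB hΔ hM hM' hMΔ huv
  have p2' : 0 ≤ ∑ H ∈ realizations h Y, ∑ a, adjInd H u a * adjInd H a v :=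
    Finset.sum_nonneg fun H _ => Finset.sum_nonneg fun a _ => n0 _ _ _ _ _
  have p3 := sum_path_three_le_twelve hB hΔ hM hM' hMΔ huv hY
  have p3' : 0 ≤ ∑ H ∈ realizations h Y, ∑ a, ∑ b,
      adjInd H u a * (adjInd H a b * adjInd H b v) :=
    Finset.sum_nonneg fun H _ => Finset.sum_nonneg fun a _ => Finset.sum_nonneg fun b _ =>
      mul_nonneg (adjInd_nonneg _ _ _) (n0 _ _ _ _ _)
  have w1 := abs_le.1 (abs_sum_walks_two_sub_le hB hΔ hM hM' hMΔ hY.symm)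
  have w2 := abs_le.1 (abs_sum_walks_two_sub_le hB hΔ hM hM' hMΔ hY)
  have q1 := sum_adjInd_mul_sum_le hB hΔ hM' hMΔ u v
  have q2 := sum_adjInd_mul_sum_le hB hΔ hM' hMΔ v u
  have q1' : 0 ≤ ∑ H ∈ realizations h Y, ∑ b, adjInd Y v b * adjInd H u b :=
    Finset.sum_nonneg fun H _ => Finset.sum_nonneg fun a _ =>
      mul_nonneg (adjInd_nonneg _ _ _) (adjInd_nonneg _ _ _)
  have q2' : 0 ≤ ∑ H ∈ realizations h Y, ∑ b, adjInd Y u b * adjInd H v b :=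
    Finset.sum_nonneg fun H _ => Finset.sum_nonneg fun a _ =>
      mul_nonneg (adjInd_nonneg _ _ _) (adjInd_nonneg _ _ _)
  have r' : 0 ≤ ∑ H ∈ realizations h Y, ∑ a, adjInd Y u a * ∑ b, adjInd Y v b * adjInd H a b :=
    Finset.sum_nonneg fun H _ => Finset.sum_nonneg fun a _ =>
      mul_nonneg (adjInd_nonneg _ _ _) (Finset.sum_nonneg fun b _ =>
      mul_nonneg (adjInd_nonneg _ _ _) (adjInd_nonneg _ _ _))
  have r : ∑ H ∈ realizations h Y, ∑ a, adjInd Y u a * ∑ b, adjInd Y v b * adjInd H a b ≤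
      6 * (Δ ^ 4 / M) * numReal h Y := by
    rw [Finset.sum_comm]
    simp_rw [← Finset.mul_sum]
    calc _ ≤ (4 * (Δ ^ 3 / M) * numReal h Y) * (Δ + 1) :=
          sum_adjInd_mul_le_of_le (by positivity) (hB.sum_adjInd_le hG₀ u)
            (fun a => sum_adjInd_mul_sum_le hB hΔ hM' hMΔ a v)
      _ ≤ (4 * (Δ ^ 3 / M) * numReal h Y) * (3 / 2 * Δ) :=
          mul_le_mul_of_nonneg_left (by linarith) (by positivity)
      _ = _ := by ring
  have c3 : Δ ^ 3 / M * numReal h Y ≤ 1 / 3 * (Δ ^ 4 / M * numReal h Y) := by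
    have : Δ ^ 3 / M * numReal h Y * 3 ≤ Δ ^ 3 / M * numReal h Y * Δ :=
      mul_le_mul_of_nonneg_left hΔ (by positivity)
    have e : Δ ^ 3 / M * numReal h Y * Δ = Δ ^ 4 / M * numReal h Y := by ring
    linarith
  have c4 : 0 ≤ Δ ^ 4 / M * numReal h Y := by positivity
  rw [abs_le]
  constructor <;> linarith [w1.1, w1.2, w2.1, w2.2]

/-- The neighbourhood sums of the degrees in a random realization. -/
lemma abs_sum_nbr_sub_le {h : V → ℝ} {Y : SimpleGraph V} {Δ M : ℝ}
    (hB : DegBound h Y Δ (Δ + 1)) (hΔ : 3 ≤ Δ) (hM : ∑ j, h j ≤ M) (hM' : M - 2 ≤ ∑ j, h j)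
    (hMΔ : 9 * Δ ^ 2 + 4 ≤ M) (u : V) :
    |∑ H ∈ realizations h Y, ∑ a, adjInd H u a * h a -
      h u * (∑ a, h a ^ 2) / M * numReal h Y| ≤ 32 * (Δ ^ 4 / M) * numReal h Y := by
  have hM0 : 0 < M := by nlinarith
  rcases realizations_eq_empty_or h Y with ⟨he, h'⟩ | ⟨G₀, hG₀⟩
  · simp [he, h']
  have hNn := numReal_nonneg h Y
  have hn := nonneg_of_mem hG₀
  have hΔ0 : 0 ≤ Δ := by linarith
  rw [Finset.sum_comm]
  simp_rw [← Finset.sum_mul]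
  have e : h u * (∑ a, h a ^ 2) / M * numReal h Y =
      ∑ a, h u * h a / M * numReal h Y * h a := by
    rw [Finset.mul_sum, Finset.sum_div, Finset.sum_mul]
    exact Finset.sum_congr rfl fun a _ => by ring
  rw [e]
  have step : ∀ a, |(∑ H ∈ realizations h Y, adjInd H u a) * h a -
      h u * h a / M * numReal h Y * h a| ≤
      (30 * (Δ ^ 2 / M) * h a + (eqInd a u + adjInd Y u a) * Δ) * (Δ ^ 2 / M * numReal h Y) := by
    intro a
    rw [← sub_mul, abs_mul, abs_of_nonneg (hn a)]
    have b1 := abs_sum_adjInd_sub_le_all hB hΔ hM (by linarith) hMΔ u a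
    have b2 : h u * h a / M * numReal h Y ≤ Δ ^ 2 / M * numReal h Y := by
      refine mul_le_mul_of_nonneg_right (div_le_div_of_nonneg_right ?_ hM0.le) hNn
      rw [sq]
      exact mul_le_mul (hB.le u) (hB.le a) (hn a) hΔ0
    have nn : 0 ≤ eqInd a u + adjInd Y u a := add_nonneg (eqInd_nonneg _ _) (adjInd_nonneg _ _ _)
    have nd : 0 ≤ 30 * (Δ ^ 2 / M) := by positivity
    calc _ ≤ (30 * (Δ ^ 2 / M) + (eqInd a u + adjInd Y u a)) * (Δ ^ 2 / M * numReal h Y) * h a :=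
          mul_le_mul_of_nonneg_right (b1.trans (mul_le_mul_of_nonneg_left b2 (by linarith))) (hn a)
      _ = (30 * (Δ ^ 2 / M) * h a + (eqInd a u + adjInd Y u a) * h a) *
          (Δ ^ 2 / M * numReal h Y) := by ring
      _ ≤ _ := by
          refine mul_le_mul_of_nonneg_right ?_ (by positivity)
          have := mul_le_mul_of_nonneg_left (hB.le a) nn
          linarith
  refine (abs_sum_sub_sum_le _ fun a _ => step a).trans ?_
  rw [← Finset.sum_mul, Finset.sum_add_distrib, ← Finset.mul_sum, ← Finset.sum_mul,
    Finset.sum_add_distrib, sum_eqInd]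
  have hK := hB.sum_adjInd_le hG₀ u
  have t1 : 30 * (Δ ^ 2 / M) * ∑ a, h a ≤ 30 * Δ ^ 2 := by
    calc _ ≤ 30 * (Δ ^ 2 / M) * M := mul_le_mul_of_nonneg_left hM (by positivity)
      _ = _ := by field_simp
  have t2 : (1 + ∑ a, adjInd Y u a) * Δ ≤ 2 * Δ ^ 2 := by nlinarith
  calc _ ≤ (32 * Δ ^ 2) * (Δ ^ 2 / M * numReal h Y) :=
        mul_le_mul_of_nonneg_right (by linarith) (by positivity)
    _ = _ := by ring

/-- Second order expansion of the number of switchings away from `uv`. -/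
lemma abs_sum_switchOut_sub_le {h : V → ℝ} {Y : SimpleGraph V} {Δ M : ℝ}
    (hB : DegBound h Y Δ (Δ + 1)) (hΔ : 3 ≤ Δ) (hM : ∑ j, h j ≤ M) (hM' : M - 2 ≤ ∑ j, h j)
    (hMΔ : 9 * Δ ^ 2 + 4 ≤ M) {u v : V} (huv : u ≠ v) (hY : Y.Adj u v) :
    |∑ H ∈ realizations h Y, switchOut Y H u v - (∑ j, h j - ∑ b, adjInd Y u b * h b -
      ∑ b, adjInd Y v b * h b - (h u + h v) * (∑ a, h a ^ 2) / M) * numReal h Y| ≤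
      110 * (Δ ^ 4 / M) * numReal h Y := by
  have hM0 : 0 < M := by nlinarith
  have c4 : 0 ≤ Δ ^ 4 / M * numReal h Y := mul_nonneg (by positivity) (numReal_nonneg _ _)
  have key : ∑ H ∈ realizations h Y, switchOut Y H u v = (∑ j, h j - (h u + ∑ b, adjInd Y u b * h b)
      - (h v + ∑ b, adjInd Y v b * h b)) * numReal h Y
      - ∑ H ∈ realizations h Y, ∑ a, adjInd H u a * h a
      - ∑ H ∈ realizations h Y, ∑ a, adjInd H v a * h a
      + ∑ H ∈ realizations h Y, ∑ a, ∑ b, adjInd H a b * blocked Y H u a * blocked Y H v b := by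
    rw [Finset.sum_congr rfl fun H hH => switchOut_eq hH u v]
    have eb : ∀ (H : SimpleGraph V) (w : V), ∑ a, blocked Y H w a * h a =
        (h w + ∑ b, adjInd Y w b * h b) + ∑ a, adjInd H w a * h a := by
      intro H w
      simp only [blocked, add_mul, Finset.sum_add_distrib, sum_eqInd_mul]
      ring
    simp only [eb, Finset.sum_add_distrib, Finset.sum_sub_distrib, Finset.sum_const, nsmul_eq_mul]
    rw [numReal]
    ring
  have a1 := abs_le.1 (abs_sum_nbr_sub_le hB hΔ hM hM' hMΔ u)
  have a2 := abs_le.1 (abs_sum_nbr_sub_le hB hΔ hM hM' hMΔ v)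
  have a3 := abs_le.1 (abs_sum_overlap_sub_le hB hΔ hM hM' (by linarith) huv hY)
  have e : (∑ j, h j - ∑ b, adjInd Y u b * h b -
      ∑ b, adjInd Y v b * h b - (h u + h v) * (∑ a, h a ^ 2) / M) * numReal h Y =
      (∑ j, h j - ∑ b, adjInd Y u b * h b - ∑ b, adjInd Y v b * h b) * numReal h Y -
      h u * (∑ a, h a ^ 2) / M * numReal h Y - h v * (∑ a, h a ^ 2) / M * numReal h Y := by
    ring
  rw [key, e, abs_le]
  constructor <;> linarith [a1.1, a1.2, a2.1, a2.2, a3.1, a3.2]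

end SwitchOut

section RealEstimates

lemma abs_log_sub_sub_one_le {y c : ℝ} (hc : 0 < c) (hy : c ≤ y) :
    |Real.log y - (y - 1)| ≤ (y - 1) ^ 2 / c := by
  have hy0 : 0 < y := hc.trans_le hy
  have h1 := Real.log_le_sub_one_of_pos hy0
  have h2 := Real.one_sub_inv_le_log_of_pos hy0
  have h3 : (y - 1) - (1 - y⁻¹) = (y - 1) ^ 2 / y := by field_simp
  have h4 : (y - 1) ^ 2 / y ≤ (y - 1) ^ 2 / c := by gcongr
  have h5 : 0 ≤ (y - 1) ^ 2 / c := by positivity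
  rw [abs_le]
  constructor <;> linarith

lemma switch_ratio_le_sharp {S T W M Δ : ℝ} (hM0 : 0 < M) (hΔ : 3 ≤ Δ) (hWM : M ≤ 7 / 4 * W)
    (s0 : 0 ≤ S) (s1 : S ≤ (Δ - 1) * M) (s2 : T ≤ Δ ^ 2 * M) :
    S ^ 2 / W ^ 3 + S / W ^ 2 + T / W ^ 2 ≤ 17 / 2 * (Δ ^ 2 / M) := by
  have hWM' : 4 / 7 * M ≤ W := by linarith
  have w3 : (4 / 7 * M) ^ 3 ≤ W ^ 3 := pow_le_pow_left₀ (by positivity) hWM' 3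
  have w2 : (4 / 7 * M) ^ 2 ≤ W ^ 2 := pow_le_pow_left₀ (by positivity) hWM' 2
  have hd : 0 ≤ Δ - 1 := by linarith
  have t1 : S ^ 2 / W ^ 3 ≤ 343 / 64 * (Δ - 1) ^ 2 / M := by
    calc S ^ 2 / W ^ 3 ≤ ((Δ - 1) * M) ^ 2 / (4 / 7 * M) ^ 3 :=
          div_le_div₀ (by positivity) (pow_le_pow_left₀ s0 s1 2) (by positivity) w3
      _ = _ := by field_simp; ring
  have t2 : S / W ^ 2 ≤ 49 / 16 * (Δ - 1) / M := by
    calc S / W ^ 2 ≤ ((Δ - 1) * M) / (4 / 7 * M) ^ 2 :=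
          div_le_div₀ (by positivity) s1 (by positivity) w2
      _ = _ := by field_simp; ring
  have t3 : T / W ^ 2 ≤ 49 / 16 * Δ ^ 2 / M := by
    calc T / W ^ 2 ≤ (Δ ^ 2 * M) / (4 / 7 * M) ^ 2 :=
          div_le_div₀ (by positivity) s2 (by positivity) w2
      _ = _ := by field_simp; ring
  calc _ ≤ 343 / 64 * (Δ - 1) ^ 2 / M + 49 / 16 * (Δ - 1) / M + 49 / 16 * Δ ^ 2 / M := by linarith
    _ = (343 / 64 * (Δ - 1) ^ 2 + 49 / 16 * (Δ - 1) + 49 / 16 * Δ ^ 2) / M := by ring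
    _ ≤ (17 / 2 * Δ ^ 2) / M := by
        refine div_le_div_of_nonneg_right ?_ hM0.le
        nlinarith
    _ = _ := by ring

/-- The logarithm of `R / (R + F)` to second order. -/
lemma abs_log_switch_ratio_sub_le {M Δ p r ρ F A : ℝ} (hΔ : 3 ≤ Δ) (hMΔ : 9 * Δ ^ 2 + 4 ≤ M)
    (hp : 0 < p) (hpΔ : p ≤ Δ ^ 2) (hr0 : 0 ≤ r) (hr : r ≤ 17 / 2 * (Δ ^ 2 / M))
    (hrρ : |r - ρ| ≤ 1100 * (Δ ^ 4 / M ^ 2)) (hF : M - 2 - 2 * Δ * (Δ + 2) ≤ F) (hF' : F ≤ M - 2)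
    (hFA : |F - (M - 2 - A)| ≤ 110 * (Δ ^ 4 / M)) :
    |Real.log (p * (1 - r)) - Real.log (p * (1 - r) + F) -
      (Real.log p - Real.log (M - 1) - ρ - (p - 1 - A) / M)| ≤ 2600 * (Δ ^ 4 / M ^ 2) := by
  have hM0 : 0 < M := by nlinarith
  have hM85 : 85 ≤ M := by nlinarith
  have hδ9 : Δ ^ 2 / M ≤ 1 / 9 := by rw [div_le_iff₀ hM0]; linarith
  have hδ0 : 0 ≤ Δ ^ 2 / M := by positivity
  have eε : Δ ^ 4 / M ^ 2 = (Δ ^ 2 / M) ^ 2 := by rw [div_pow]; ring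
  have eε' : Δ ^ 4 / M = Δ ^ 2 * (Δ ^ 2 / M) := by ring
  have eΔ : Δ ^ 2 = Δ ^ 2 / M * M := by field_simp
  have hr1 : 1 / 18 ≤ 1 - r := by linarith
  have h1r : 0 < 1 - r := by linarith
  have l1 : |Real.log (1 - r) + r| ≤ 1301 * (Δ ^ 4 / M ^ 2) := by
    have := abs_log_sub_sub_one_le (by norm_num : (0:ℝ) < 1 / 18) hr1
    have e : Real.log (1 - r) - (1 - r - 1) = Real.log (1 - r) + r := by ring
    rw [e] at this
    refine this.trans ?_
    have h2 : r ^ 2 ≤ (17 / 2 * (Δ ^ 2 / M)) ^ 2 := pow_le_pow_left₀ hr0 hr 2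
    have : (1 - r - 1) ^ 2 / (1 / 18) = 18 * r ^ 2 := by ring
    rw [this, eε]
    nlinarith [sq_nonneg (Δ ^ 2 / M)]
  have hB1 : -(7 / 2 * Δ ^ 2) ≤ p * (1 - r) + F - (M - 1) := by
    have : 0 ≤ p * (1 - r) := by positivity
    nlinarith
  have hB2 : p * (1 - r) + F - (M - 1) ≤ 7 / 2 * Δ ^ 2 := by
    have : 0 ≤ p * r := by positivity
    nlinarith
  have hBabs : |p * (1 - r) + F - (M - 1)| ≤ 7 / 2 * Δ ^ 2 := abs_le.2 ⟨hB1, hB2⟩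
  set B := p * (1 - r) + F - (M - 1) with hBdef
  have hM1 : 0 < M - 1 := by linarith
  have hz : (p * (1 - r) + F) / (M - 1) - 1 = B / (M - 1) := by rw [hBdef]; field_simp
  have hzabs : |B / (M - 1)| ≤ 4 * (Δ ^ 2 / M) := by
    rw [abs_div, abs_of_pos hM1, div_le_iff₀ hM1]
    refine hBabs.trans ?_
    have : 4 * (Δ ^ 2 / M) * (M - 1) = 4 * Δ ^ 2 - 4 * (Δ ^ 2 / M) := by
      field_simp
    rw [this]
    nlinarith
  have hz2 : 1 / 2 ≤ (p * (1 - r) + F) / (M - 1) := by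
    have := (abs_le.1 hzabs).1
    linarith
  have l2 : |Real.log ((p * (1 - r) + F) / (M - 1)) - B / (M - 1)| ≤ 32 * (Δ ^ 4 / M ^ 2) := by
    have := abs_log_sub_sub_one_le (by norm_num : (0:ℝ) < 1 / 2) hz2
    rw [hz] at this
    refine this.trans ?_
    have h2 : (B / (M - 1)) ^ 2 ≤ (4 * (Δ ^ 2 / M)) ^ 2 := by
      rw [← sq_abs]; exact pow_le_pow_left₀ (abs_nonneg _) hzabs 2
    rw [eε]
    calc _ = 2 * (B / (M - 1)) ^ 2 := by ring
      _ ≤ 2 * (4 * (Δ ^ 2 / M)) ^ 2 := by linarith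
      _ = _ := by ring
  have l3 : |B / (M - 1) - B / M| ≤ Δ ^ 4 / M ^ 2 := by
    have e : B / (M - 1) - B / M = B / (M - 1) * (1 / M) := by field_simp; ring
    rw [e, abs_mul, abs_of_pos (by positivity : 0 < 1 / M)]
    calc _ ≤ 4 * (Δ ^ 2 / M) * (1 / M) := mul_le_mul_of_nonneg_right hzabs (by positivity)
      _ = 4 * (Δ ^ 2) / M ^ 2 := by field_simp
      _ ≤ _ := by
          refine div_le_div_of_nonneg_right ?_ (by positivity)
          have : Δ ^ 4 = Δ ^ 2 * Δ ^ 2 := by ring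
          rw [this]
          exact mul_le_mul_of_nonneg_right (by nlinarith) (sq_nonneg Δ)
  have l4 : |B / M - (p - 1 - A) / M| ≤ 119 * (Δ ^ 4 / M ^ 2) := by
    rw [← sub_div, abs_div, abs_of_pos hM0, div_le_iff₀ hM0]
    have e : B - (p - 1 - A) = (F - (M - 2 - A)) - p * r := by rw [hBdef]; ring
    have h1 : 0 ≤ p * r := by positivity
    have h2 : p * r ≤ Δ ^ 2 * (17 / 2 * (Δ ^ 2 / M)) :=
      mul_le_mul hpΔ hr hr0 (by positivity)
    have e2 : 119 * (Δ ^ 4 / M ^ 2) * M = 119 * (Δ ^ 4 / M) := by field_simp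
    have h3 : 0 ≤ Δ ^ 4 / M := by positivity
    rw [e, e2]
    rw [eε'] at hFA h3 ⊢
    obtain ⟨f1, f2⟩ := abs_le.1 hFA
    rw [abs_le]
    constructor <;> linarith
  have hlogR : Real.log (p * (1 - r)) = Real.log p + Real.log (1 - r) :=
    Real.log_mul hp.ne' h1r.ne'
  have hpos : 0 < p * (1 - r) + F := by
    have := (div_pos_iff_of_pos_right hM1).1 (lt_of_lt_of_le (by norm_num) hz2)
    exact this
  have hlogz : Real.log ((p * (1 - r) + F) / (M - 1)) =
      Real.log (p * (1 - r) + F) - Real.log (M - 1) := Real.log_div hpos.ne' hM1.ne'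
  rw [hlogz] at l2
  rw [hlogR]
  have hε : 0 ≤ Δ ^ 4 / M ^ 2 := by positivity
  rw [abs_le] at l1 l2 l3 l4 hrρ ⊢
  constructor <;> linarith [l1.1, l1.2, l2.1, l2.2, l3.1, l3.2, l4.1, l4.2, hrρ.1, hrρ.2]

set_option maxHeartbeats 1000000 in
/-- The change of the correction term under the removal of one edge. -/
lemma abs_correction_diff_le {M Δ S T k ξ p : ℝ} (hΔ : 3 ≤ Δ) (hMΔ : 9 * Δ ^ 2 + 4 ≤ M)
    (hS0 : 0 ≤ S) (hS : S ≤ Δ * M) (hT0 : 0 ≤ T) (hT : T ≤ Δ ^ 2 * M) (hk0 : 0 ≤ k)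
    (hk : k ≤ 2 * Δ) (hξ0 : 0 ≤ ξ) (hξ : ξ ≤ 3 * Δ ^ 2) :
    |(-(S ^ 2 / M ^ 3 + S / M ^ 2 + T / M ^ 2) - (p - 1 - (ξ + k * (S - 2 * k + M - 2) / M)) / M) -
      ((-((S - 2 * k) / (2 * (M - 2))) - ((S - 2 * k) / (2 * (M - 2))) ^ 2
          - (T - 2 * ξ - 2) / (2 * (M - 2))) -
        (-(S / (2 * M)) - (S / (2 * M)) ^ 2 - (T - 2 * p) / (2 * M)))| ≤
      10 * (Δ ^ 4 / M ^ 2) := by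
  have hM0 : 0 < M := by nlinarith
  have hM85 : 85 ≤ M := by nlinarith
  have hM2 : 0 < M - 2 := by linarith
  have hi : 1 / (M - 2) ≤ 2 / M := by rw [div_le_div_iff₀ hM2 hM0]; linarith
  have hi0 : 0 ≤ 1 / (M - 2) := by positivity
  set i := 1 / (M - 2) with hidef
  set j := 1 / M with hjdef
  have hj0 : 0 < j := by positivity
  have hij : i - j = 2 * i * j := by rw [hidef, hjdef]; field_simp; ring
  have hi2 : i ≤ 2 * j := by rw [hjdef]; linarith [(by ring : 2 / M = 2 * (1 / M))]
  have hMj : M * j = 1 := by rw [hjdef]; field_simp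
  have hSj : S * j ≤ Δ := by
    calc S * j ≤ Δ * M * j := mul_le_mul_of_nonneg_right hS hj0.le
      _ = _ := by rw [mul_assoc, hMj, mul_one]
  have hSj0 : 0 ≤ S * j := by positivity
  have hTj : T * j ≤ Δ ^ 2 := by
    calc T * j ≤ Δ ^ 2 * M * j := mul_le_mul_of_nonneg_right hT hj0.le
      _ = _ := by rw [mul_assoc, hMj, mul_one]
  have hTj0 : 0 ≤ T * j := by positivity
  have eS : S / M ^ 2 = S * j * j := by rw [hjdef]; field_simp
  have eS2 : S ^ 2 / M ^ 3 = (S * j) * (S * j) * j := by rw [hjdef]; field_simp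
  have eT : T / M ^ 2 = T * j * j := by rw [hjdef]; field_simp
  have e1 : (S - 2 * k) / (2 * (M - 2)) = (S / 2 - k) * i := by rw [hidef]; field_simp
  have e2 : (T - 2 * ξ - 2) / (2 * (M - 2)) = (T / 2 - ξ - 1) * i := by rw [hidef]; field_simp
  have e3 : S / (2 * M) = S * j / 2 := by rw [hjdef]; field_simp
  have e4 : (T - 2 * p) / (2 * M) = (T / 2 - p) * j := by rw [hjdef]; field_simp
  have e5 : (p - 1 - (ξ + k * (S - 2 * k + M - 2) / M)) / M =
      (p - 1 - (ξ + k * (S * j - 2 * k * j + 1 - 2 * j))) * j := by rw [hjdef]; field_simp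
  have e6 : Δ ^ 4 / M ^ 2 = Δ ^ 4 * j ^ 2 := by rw [hjdef]; field_simp
  rw [eS, eS2, eT, e1, e2, e3, e4, e5, e6]
  -- first order change of the term `λ`
  obtain ⟨D, hD⟩ : ∃ D, D = (S / 2 - k) * i - S * j / 2 - (S * j * j - k * j) := ⟨_, rfl⟩
  clear_value i j
  have hDe : D = (2 * (S * j) - 2 * k) * (i * j) := by
    rw [hD]
    linear_combination (S / 2 - k + S * j) * hij
  have hijle : i * j ≤ 2 * j ^ 2 := by
    calc i * j ≤ 2 * j * j := mul_le_mul_of_nonneg_right hi2 hj0.le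
      _ = _ := by ring
  have hij0 : 0 ≤ i * j := by positivity
  have hj1 : 8 * j ≤ 1 := by
    have : 85 * j ≤ M * j := mul_le_mul_of_nonneg_right hM85 hj0.le
    linarith
  have hDabs : |D| ≤ 8 * Δ * j ^ 2 := by
    rw [hDe, abs_mul, abs_of_nonneg hij0]
    have h1 : |2 * (S * j) - 2 * k| ≤ 4 * Δ := abs_le.2 ⟨by linarith, by linarith⟩
    calc _ ≤ 4 * Δ * (2 * j ^ 2) := mul_le_mul h1 hijle hij0 (by linarith)
      _ = _ := by ring
  obtain ⟨δ, hδ⟩ : ∃ δ, δ = S * j * j - k * j + D := ⟨_, rfl⟩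
  have hδabs : |δ| ≤ 3 * Δ * j := by
    have h1 : |S * j * j - k * j| ≤ 2 * Δ * j := by
      rw [← sub_mul, abs_mul, abs_of_pos hj0]
      exact mul_le_mul_of_nonneg_right (abs_le.2 ⟨by linarith, by linarith⟩) hj0.le
    have h2 : 8 * Δ * j ^ 2 ≤ Δ * j := by
      calc 8 * Δ * j ^ 2 = (Δ * j) * (8 * j) := by ring
        _ ≤ (Δ * j) * 1 := mul_le_mul_of_nonneg_left hj1 (by positivity)
        _ = _ := by ring
    calc |δ| ≤ |S * j * j - k * j| + |D| := by rw [hδ]; exact abs_add_le _ _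
      _ ≤ _ := by linarith
  have hδ2 : δ ^ 2 ≤ 9 * Δ ^ 2 * j ^ 2 := by
    rw [← sq_abs]
    calc _ ≤ (3 * Δ * j) ^ 2 := pow_le_pow_left₀ (abs_nonneg _) hδabs 2
      _ = _ := by ring
  have hSD : |S * j * D| ≤ 8 * Δ ^ 2 * j ^ 2 := by
    rw [abs_mul, abs_of_nonneg hSj0]
    calc _ ≤ Δ * (8 * Δ * j ^ 2) := mul_le_mul hSj hDabs (abs_nonneg _) (by linarith)
      _ = _ := by ring
  have hD3 : |(2 * (T * j) - 2 * (ξ + 1)) * (i * j)| ≤ (12 * Δ ^ 2 + 4) * j ^ 2 := by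
    rw [abs_mul, abs_of_nonneg hij0]
    have h1 : |2 * (T * j) - 2 * (ξ + 1)| ≤ 6 * Δ ^ 2 + 2 :=
      abs_le.2 ⟨by linarith, by linarith [sq_nonneg Δ]⟩
    calc _ ≤ (6 * Δ ^ 2 + 2) * (2 * j ^ 2) := mul_le_mul h1 hijle hij0 (by positivity)
      _ = _ := by ring
  have hk4 : |k * (2 * k + 2) * j ^ 2| ≤ (8 * Δ ^ 2 + 4 * Δ) * j ^ 2 := by
    rw [abs_of_nonneg (by positivity)]
    refine mul_le_mul_of_nonneg_right ?_ (by positivity)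
    calc k * (2 * k + 2) ≤ 2 * Δ * (2 * (2 * Δ) + 2) := by gcongr
      _ = _ := by ring
  have hlam : (S / 2 - k) * i = S * j / 2 + δ := by rw [hδ, hD]; ring
  have hμ : (T / 2 - ξ - 1) * i - (T / 2 - p) * j =
      T * j * j - (ξ + 1) * j + p * j + (2 * (T * j) - 2 * (ξ + 1)) * (i * j) := by
    calc _ = T / 2 * (i - j) - (ξ + 1) * (i - j) - (ξ + 1) * j + p * j := by ring
      _ = T * j * i - 2 * (ξ + 1) * (i * j) - (ξ + 1) * j + p * j := by rw [hij]; ring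
      _ = T * j * (j + (i - j)) - 2 * (ξ + 1) * (i * j) - (ξ + 1) * j + p * j := by ring
      _ = _ := by rw [hij]; ring
  have key : (-(S * j * (S * j) * j + S * j * j + T * j * j) -
        (p - 1 - (ξ + k * (S * j - 2 * k * j + 1 - 2 * j))) * j) -
      ((-((S / 2 - k) * i) - ((S / 2 - k) * i) ^ 2 - (T / 2 - ξ - 1) * i) -
        (-(S * j / 2) - (S * j / 2) ^ 2 - (T / 2 - p) * j)) =
      D + δ ^ 2 + S * j * D + (2 * (T * j) - 2 * (ξ + 1)) * (i * j) - k * (2 * k + 2) * j ^ 2 := by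
    have h1 : (T / 2 - ξ - 1) * i = T * j * j - (ξ + 1) * j + p * j +
      (2 * (T * j) - 2 * (ξ + 1)) * (i * j) + (T / 2 - p) * j := by linarith
    rw [hlam, h1]
    have : S * j * D = S * j * δ - S * j * (S * j * j - k * j) := by rw [hδ]; ring
    have h2 : D = δ - (S * j * j - k * j) := by rw [hδ]; ring
    rw [this, h2]
    ring
  rw [key]
  have hfin : (8 * Δ + 9 * Δ ^ 2 + 8 * Δ ^ 2 + (12 * Δ ^ 2 + 4) + (8 * Δ ^ 2 + 4 * Δ)) * j ^ 2 ≤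
      10 * (Δ ^ 4 * j ^ 2) := by
    rw [← mul_assoc]
    refine mul_le_mul_of_nonneg_right ?_ (by positivity)
    have h3 : 3 * Δ ≤ Δ ^ 2 := by
      rw [sq]; exact mul_le_mul_of_nonneg_right hΔ (by linarith)
    have h9 : 9 * Δ ^ 2 ≤ Δ ^ 4 := by
      have e : Δ ^ 4 = Δ ^ 2 * Δ ^ 2 := by ring
      rw [e]; exact mul_le_mul_of_nonneg_right (by linarith) (sq_nonneg Δ)
    linarith
  have hδ20 : 0 ≤ δ ^ 2 := sq_nonneg δ
  obtain ⟨a1, a2⟩ := abs_le.1 hDabs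
  obtain ⟨b1, b2⟩ := abs_le.1 hSD
  obtain ⟨c1, c2⟩ := abs_le.1 hD3
  obtain ⟨d1, d2⟩ := abs_le.1 hk4
  refine le_trans (abs_le.2 ⟨?_, ?_⟩) hfin <;> linarith

end RealEstimates

section EdgeStep

variable {V : Type*} [Fintype V]

/-- The logarithm of the correction factor for the number of realizations. -/
noncomputable def corr (g : V → ℝ) (X : SimpleGraph V) : ℝ :=
  -(fallTwo g / (2 * ∑ j, g j)) - (fallTwo g / (2 * ∑ j, g j)) ^ 2
    - edgeWeight g X / (2 * ∑ j, g j)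

lemma fallTwo_dropEdge (g : V → ℝ) {u v : V} (huv : u ≠ v) :
    fallTwo (dropEdge g u v) =
      fallTwo g - 2 * (dropEdge g u v u + dropEdge g u v v) := by
  have h : ∀ a, dropEdge g u v a * (dropEdge g u v a - 1) =
      g a * (g a - 1) - eqInd a u * (2 * (g a - 1)) - eqInd a v * (2 * (g a - 1)) := by
    intro a
    unfold dropEdge eqInd
    split_ifs with h1 h2
    · exact absurd (h1.symm.trans h2) huv
    all_goals ring
  have hu : dropEdge g u v u = g u - 1 := by simp [dropEdge, eqInd, huv]
  have hv : dropEdge g u v v = g v - 1 := by simp [dropEdge, eqInd, huv.symm]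
  rw [fallTwo, fallTwo, Finset.sum_congr rfl fun a _ => h a, Finset.sum_sub_distrib,
    Finset.sum_sub_distrib, sum_eqInd_mul, sum_eqInd_mul, hu, hv]
  ring

lemma sum_sq_eq (h : V → ℝ) : ∑ a, h a ^ 2 = fallTwo h + ∑ a, h a := by
  rw [fallTwo, ← Finset.sum_add_distrib]
  exact Finset.sum_congr rfl fun a _ => by ring

lemma edgeWeight_addEdge (g : V → ℝ) {X : SimpleGraph V} {u v : V} (huv : u ≠ v)
    (hX : ¬ X.Adj u v) : edgeWeight g (addEdge X u v) = edgeWeight g X + 2 * (g u * g v) := by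
  have h : ∀ a b, adjInd (addEdge X u v) a b * (g a * g b) = adjInd X a b * (g a * g b) +
      eqInd a u * (g a * (eqInd b v * g b)) + eqInd a v * (g a * (eqInd b u * g b)) := fun a b => by
    rw [adjInd_addEdge X huv hX]; ring
  simp only [edgeWeight, h, Finset.sum_add_distrib, ← Finset.mul_sum, sum_eqInd_mul]
  ring

lemma edgeWeight_dropEdge (g : V → ℝ) {Y : SimpleGraph V} {u v : V} (hY : Y.Adj u v) :
    edgeWeight (dropEdge g u v) Y = edgeWeight g Y -
      2 * (∑ b, adjInd Y u b * dropEdge g u v b + ∑ b, adjInd Y v b * dropEdge g u v b) - 2 := by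
  have h : ∀ a b, adjInd Y a b * (g a * g b) =
      adjInd Y a b * (dropEdge g u v a * dropEdge g u v b)
      + eqInd a u * (adjInd Y a b * dropEdge g u v b)
      + eqInd a v * (adjInd Y a b * dropEdge g u v b)
      + eqInd b u * (adjInd Y b a * dropEdge g u v a)
      + eqInd b v * (adjInd Y b a * dropEdge g u v a)
      + eqInd a u * (eqInd b u * adjInd Y a b) + eqInd a u * (eqInd b v * adjInd Y a b)
      + eqInd a v * (eqInd b u * adjInd Y a b) + eqInd a v * (eqInd b v * adjInd Y a b) :=
    fun a b => by
      rw [adjInd_comm Y b a]; unfold dropEdge; ring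
  have e : edgeWeight g Y = edgeWeight (dropEdge g u v) Y +
      2 * (∑ b, adjInd Y u b * dropEdge g u v b + ∑ b, adjInd Y v b * dropEdge g u v b) + 2 := by
    simp only [edgeWeight, h, Finset.sum_add_distrib, ← Finset.mul_sum, sum_eqInd_mul]
    rw [adjInd_of_adj hY, adjInd_of_adj hY.symm, adjInd_self, adjInd_self]
    ring
  linarith

/-- The real-variable part of the one-edge estimate. -/
lemma abs_log_sub_log_of_switching {M Δ p S T k ξ ξ' P Q n₀ n₁ n₂ B : ℝ} (hΔ : 3 ≤ Δ)
    (hMΔ : 9 * Δ ^ 2 + 4 ≤ M) (hp : 0 < p) (hpΔ : p ≤ Δ ^ 2)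
    (hS0 : 0 ≤ S) (hS : S ≤ (Δ - 1) * M) (hT0 : 0 ≤ T) (hT : T ≤ Δ ^ 2 * M) (hk0 : 0 ≤ k)
    (hk : k ≤ 2 * Δ) (hξ0 : 0 ≤ ξ + ξ') (hξ : ξ + ξ' ≤ Δ ^ 2 + Δ ^ 2)
    (hsplit : n₀ = n₁ + n₂) (h₁ : 0 < n₁) (h₂ : 0 ≤ n₂) (hid : Q = p * n₁ - P) (hP0 : 0 ≤ P)
    (hPB : P ≤ p * B * n₁) (hBle : B ≤ 17 / 2 * (Δ ^ 2 / M))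
    (hP : |P - p * (S ^ 2 / M ^ 3 + S / M ^ 2 + T / M ^ 2) * n₁| ≤
      1100 * (Δ ^ 4 / M ^ 2) * (p * n₁))
    (hQ0 : (M - 2 - 2 * Δ * (Δ + 2)) * n₂ ≤ Q) (hQ1 : Q ≤ (M - 2) * n₂)
    (hQ : |Q - (M - 2 - ξ - ξ' - k * (S - 2 * k + (M - 2)) / M) * n₂| ≤
      110 * (Δ ^ 4 / M) * n₂) :
    0 < n₂ ∧ |Real.log n₂ - Real.log n₀ - (Real.log p - Real.log (M - 1) +
      (-((S - 2 * k) / (2 * (M - 2))) - ((S - 2 * k) / (2 * (M - 2))) ^ 2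
          - (T - 2 * (ξ + ξ') - 2) / (2 * (M - 2))) -
        (-(S / (2 * M)) - (S / (2 * M)) ^ 2 - (T - 2 * p) / (2 * M)))| ≤
      2700 * (Δ ^ 4 / M ^ 2) := by
  have hM0 : 0 < M := by nlinarith
  have hpn : 0 < p * n₁ := mul_pos hp h₁
  have hδ9 : Δ ^ 2 / M ≤ 1 / 9 := by rw [div_le_iff₀ hM0]; linarith
  obtain ⟨r, hr⟩ : ∃ r, r = P / (p * n₁) := ⟨_, rfl⟩
  have hPr : P = r * (p * n₁) := by rw [hr]; field_simp
  have hr0 : 0 ≤ r := by rw [hr]; positivity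
  have hr1 : r ≤ 17 / 2 * (Δ ^ 2 / M) := by
    rw [hr, div_le_iff₀ hpn]
    calc P ≤ B * (p * n₁) := by linarith
      _ ≤ _ := mul_le_mul_of_nonneg_right hBle hpn.le
  have hrρ : |r - (S ^ 2 / M ^ 3 + S / M ^ 2 + T / M ^ 2)| ≤ 1100 * (Δ ^ 4 / M ^ 2) := by
    have e : P - p * (S ^ 2 / M ^ 3 + S / M ^ 2 + T / M ^ 2) * n₁ =
        (r - (S ^ 2 / M ^ 3 + S / M ^ 2 + T / M ^ 2)) * (p * n₁) := by rw [hPr]; ring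
    rw [e, abs_mul, abs_of_pos hpn] at hP
    exact le_of_mul_le_mul_right hP hpn
  have hQr : Q = p * (1 - r) * n₁ := by rw [hid, hPr]; ring
  have hR : 0 < p * (1 - r) := mul_pos hp (by linarith)
  have hQpos : 0 < Q := by rw [hQr]; exact mul_pos hR h₁
  have h₂' : 0 < n₂ := by
    rcases h₂.lt_or_eq with h | h
    · exact h
    · rw [← h] at hQ1; linarith
  refine ⟨h₂', ?_⟩
  obtain ⟨F, hF⟩ : ∃ F, F = Q / n₂ := ⟨_, rfl⟩
  have hFQ : Q = F * n₂ := by rw [hF]; field_simp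
  rw [hFQ] at hQ0 hQ1
  have hF0 := le_of_mul_le_mul_right hQ0 h₂'
  have hF1 := le_of_mul_le_mul_right hQ1 h₂'
  have hF2 : |F - (M - 2 - (ξ + ξ' + k * (S - 2 * k + M - 2) / M))| ≤ 110 * (Δ ^ 4 / M) := by
    have e : Q - (M - 2 - ξ - ξ' - k * (S - 2 * k + (M - 2)) / M) * n₂ =
        (F - (M - 2 - (ξ + ξ' + k * (S - 2 * k + M - 2) / M))) * n₂ := by rw [hFQ]; ring
    rw [e, abs_mul, abs_of_pos h₂'] at hQ
    exact le_of_mul_le_mul_right hQ h₂'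
  have hFpos : 0 < F := by rw [hF]; exact div_pos hQpos h₂'
  have hlog : Real.log n₂ - Real.log n₀ =
      Real.log (p * (1 - r)) - Real.log (p * (1 - r) + F) := by
    have hn0 : 0 < n₀ := by linarith
    have e : n₂ * (p * (1 - r) + F) = p * (1 - r) * n₀ := by
      have : F * n₂ = p * (1 - r) * n₁ := by rw [← hFQ, hQr]
      rw [hsplit]; linear_combination this
    have e2 := congrArg Real.log e
    rw [Real.log_mul h₂'.ne' (by positivity), Real.log_mul hR.ne' hn0.ne'] at e2
    linarith
  have hSM : S ≤ Δ * M := hS.trans (mul_le_mul_of_nonneg_right (by linarith) hM0.le)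
  have A := abs_log_switch_ratio_sub_le hΔ hMΔ hp hpΔ hr0 hr1 hrρ hF0 hF1 hF2
  have C := abs_correction_diff_le (p := p) hΔ hMΔ hS0 hSM hT0 hT hk0 hk hξ0
    (hξ.trans (by linarith [sq_nonneg Δ]))
  have hε : 0 ≤ Δ ^ 4 / M ^ 2 := by positivity
  rw [hlog]
  obtain ⟨a1, a2⟩ := abs_le.1 A
  obtain ⟨c1, c2⟩ := abs_le.1 C
  rw [abs_le]
  constructor <;> linarith

set_option maxHeartbeats 1000000 in
/-- Moving one edge into the forbidden graph multiplies the number of realizations by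
`g u * g v / (M - 1)`, up to the change of the correction factor. -/
lemma abs_log_numReal_dropEdge_sub_le {g : V → ℝ} {X : SimpleGraph V} {Δ : ℝ}
    (hB : DegBound g X Δ Δ) (hΔ : 3 ≤ Δ) (hMΔ : 9 * Δ ^ 2 + 4 ≤ ∑ j, g j) {u v : V} (huv : u ≠ v)
    (hX : ¬ X.Adj u v) (hu : 1 ≤ g u) (hv : 1 ≤ g v) (hN : 0 < numReal g X) :
    0 < numReal (dropEdge g u v) (addEdge X u v) ∧
    |Real.log (numReal (dropEdge g u v) (addEdge X u v)) - Real.log (numReal g X) -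
      (Real.log (g u * g v) - Real.log (∑ j, g j - 1) +
        corr (dropEdge g u v) (addEdge X u v) - corr g X)| ≤
      2700 * (Δ ^ 4 / (∑ j, g j) ^ 2) := by
  obtain ⟨M, hM⟩ : ∃ M, ∑ j, g j = M := ⟨_, rfl⟩
  obtain ⟨G₀, hG₀⟩ := numReal_pos_iff.1 hN
  have hg0 : ∀ j, 0 ≤ g j := nonneg_of_mem hG₀
  have hΔ0 : 0 ≤ Δ := by linarith
  have hY := addEdge_adj_self X huv
  have hBgY := hB.addEdge huv hX
  have hBhY := hB.dropEdge_addEdge huv hX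
  have hBhY' : DegBound (dropEdge g u v) (addEdge X u v) Δ (Δ + 1) :=
    ⟨hBhY.le, fun j => (hBhY.add_le j).trans (by linarith)⟩
  have hsumh : ∑ j, dropEdge g u v j = M - 2 := by rw [sum_dropEdge, hM]
  rw [hM] at hMΔ ⊢
  have hΔ2 : 3 * Δ ≤ Δ ^ 2 := by rw [sq]; exact mul_le_mul_of_nonneg_right hΔ hΔ0
  have hM0 : 0 < M := by nlinarith
  have hp : 0 < g u * g v := by positivity
  have hpΔ : g u * g v ≤ Δ ^ 2 := by
    rw [sq]; exact mul_le_mul (hB.le u) (hB.le v) (hg0 v) hΔ0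
  have hsplit := numReal_eq_add g X huv hX
  have hNgY : 0 < numReal g (addEdge X u v) := by
    have hW : 0 < M - 2 - 2 * Δ * (Δ + 1) := by nlinarith
    have h1 := numReal_dropEdge_le hB hΔ0 hW (by rw [hM]) huv hX
    rcases (numReal_nonneg g (addEdge X u v)).lt_or_eq with h | h
    · exact h
    · rw [← h] at h1 hsplit
      linarith
  obtain ⟨G₁, hG₁⟩ := numReal_pos_iff.1 hNgY
  have hW : 0 < M - 6 - 2 * Δ * (Δ + 1 + 1) := by nlinarith
  have hWM : M ≤ 7 / 4 * (M - 6 - 2 * Δ * (Δ + 1 + 1)) := by nlinarith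
  have hS0 := fallTwo_nonneg_of_mem hG₀
  have hS1 := fallTwo_le_of_mem hG₀ hB.le
  have hT0 := edgeWeight_nonneg_of_mem hG₁ (addEdge X u v)
  have hT1 := edgeWeight_le_of_mem hG₁ hBgY
  rw [hM] at hS1 hT1
  have hT2 : edgeWeight g (addEdge X u v) ≤ Δ ^ 2 * M := by
    rw [show Δ * (Δ + 1 - 1) = Δ ^ 2 by ring] at hT1; exact hT1
  have hbadle := sum_switchBad_le hBgY hΔ0 hW (by rw [hM]) huv hY
  have hbad := abs_sum_switchBad_sub_le hBgY hΔ hM hMΔ huv hY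
  have hbad0 : 0 ≤ ∑ G ∈ realizations g (addEdge X u v), switchBad (addEdge X u v) G u v :=
    Finset.sum_nonneg fun G _ => switchBad_nonneg _ _ _ _
  have hid := sum_switchOut_eq_sum_switchIn g (addEdge X u v) huv hY
  rw [sum_switchIn u v] at hid
  have hout := abs_sum_switchOut_sub_le hBhY' hΔ (by rw [hsumh]; linarith) hsumh.ge hMΔ huv hY
  have hratio := switch_ratio_le_sharp hM0 hΔ hWM hS0 hS1 hT2
  have hfh := fallTwo_dropEdge g huv
  have hsq := sum_sq_eq (dropEdge g u v)
  have hew := edgeWeight_dropEdge g hY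
  have hew' := edgeWeight_addEdge g huv hX
  have hhu : dropEdge g u v u = g u - 1 := by simp [dropEdge, eqInd, huv]
  have hhv : dropEdge g u v v = g v - 1 := by simp [dropEdge, eqInd, huv.symm]
  have hh0 : ∀ j, 0 ≤ dropEdge g u v j := by
    intro j
    unfold dropEdge eqInd
    split_ifs with h1 h2
    · exact absurd (h1.symm.trans h2) huv
    · rw [h1]; linarith
    · next h2 => rw [h2]; linarith
    · linarith [hg0 j]
  have hdegY : ∀ w, ∑ b, adjInd (addEdge X u v) w b ≤ Δ := fun w => by
    linarith [hBhY.add_le w, hh0 w]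
  have hxi : ∀ w, ∑ b, adjInd (addEdge X u v) w b * dropEdge g u v b ≤ Δ ^ 2 := fun w => by
    calc _ ≤ ∑ b, adjInd (addEdge X u v) w b * Δ := Finset.sum_le_sum fun b _ =>
          mul_le_mul_of_nonneg_left (hBhY.le b) (adjInd_nonneg _ _ _)
      _ = (∑ b, adjInd (addEdge X u v) w b) * Δ := by rw [Finset.sum_mul]
      _ ≤ Δ * Δ := mul_le_mul_of_nonneg_right (hdegY w) hΔ0
      _ = _ := by ring
  have hxi0 : ∀ w, 0 ≤ ∑ b, adjInd (addEdge X u v) w b * dropEdge g u v b := fun w =>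
    Finset.sum_nonneg fun b _ => mul_nonneg (adjInd_nonneg _ _ _) (hh0 b)
  have hFup : ∑ H ∈ realizations (dropEdge g u v) (addEdge X u v),
      switchOut (addEdge X u v) H u v ≤
      (M - 2) * numReal (dropEdge g u v) (addEdge X u v) := by
    rw [← hsumh]; exact sum_switchOut_le u v
  have hFlow : (M - 2 - 2 * Δ * (Δ + 2)) * numReal (dropEdge g u v) (addEdge X u v) ≤
      ∑ H ∈ realizations (dropEdge g u v) (addEdge X u v), switchOut (addEdge X u v) H u v := by
    rw [mul_comm, numReal, ← nsmul_eq_mul]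
    refine Finset.card_nsmul_le_sum _ _ _ fun H hH => ?_
    have := le_switchOut hH hBhY hΔ0 u v
    rw [hsumh] at this
    linarith
  rw [hsumh, hsq, hfh, hsumh] at hout
  have hk0 : 0 ≤ dropEdge g u v u + dropEdge g u v v := add_nonneg (hh0 _) (hh0 _)
  have hk : dropEdge g u v u + dropEdge g u v v ≤ 2 * Δ := by linarith [hBhY.le u, hBhY.le v]
  have hξ0 := add_nonneg (hxi0 u) (hxi0 v)
  have hξ := add_le_add (hxi u) (hxi v)
  have hcu : corr (dropEdge g u v) (addEdge X u v) = 
    -((fallTwo g - 2 * (dropEdge g u v u + dropEdge g u v v)) / (2 * (M - 2))) -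
      ((fallTwo g - 2 * (dropEdge g u v u + dropEdge g u v v)) / (2 * (M - 2))) ^ 2 -
      (edgeWeight g (addEdge X u v) - 2 * (∑ b, adjInd (addEdge X u v) u b * dropEdge g u v b +
        ∑ b, adjInd (addEdge X u v) v b * dropEdge g u v b) - 2) / (2 * (M - 2)) := by
    rw [corr, hsumh, hfh, hew]
  have hcg : corr g X = -(fallTwo g / (2 * M)) - (fallTwo g / (2 * M)) ^ 2
      - (edgeWeight g (addEdge X u v) - 2 * (g u * g v)) / (2 * M) := by
    rw [corr, hM, hew', add_sub_cancel_right]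
  rw [hcu, hcg]
  generalize hQ : ∑ H ∈ realizations (dropEdge g u v) (addEdge X u v),
    switchOut (addEdge X u v) H u v = Q at *
  generalize hP : ∑ G ∈ realizations g (addEdge X u v), switchBad (addEdge X u v) G u v = P at *
  generalize hn0 : numReal g X = n0 at *
  generalize hn1 : numReal g (addEdge X u v) = n1 at *
  have hn2p := numReal_nonneg (dropEdge g u v) (addEdge X u v)
  generalize hn2 : numReal (dropEdge g u v) (addEdge X u v) = n2 at *
  generalize fallTwo g = S at *
  generalize edgeWeight g (addEdge X u v) = T at *
  generalize g u * g v = p at *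
  generalize dropEdge g u v u + dropEdge g u v v = k at *
  generalize ∑ b, adjInd (addEdge X u v) u b * dropEdge g u v b = ξ1 at *
  generalize ∑ b, adjInd (addEdge X u v) v b * dropEdge g u v b = ξ2 at *
  exact abs_log_sub_log_of_switching hΔ hMΔ hp hpΔ hS0 hS1 hT0 hT2 hk0 hk hξ0 hξ hsplit hNgY hn2p
    hid hbad0 hbadle hratio hbad hFlow hFup hout

end EdgeStep

section EdgeChain

variable {V : Type*}

lemma exists_eq_addEdge {X : SimpleGraph V} {u v : V} (h : X.Adj u v) :
    ∃ X' : SimpleGraph V, ¬ X'.Adj u v ∧ X = addEdge X' u v := by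
  refine ⟨X.deleteEdges {s(u, v)}, by simp, ?_⟩
  ext a b
  rw [addEdge_adj _ h.ne, SimpleGraph.deleteEdges_adj]
  constructor
  · intro hab
    by_cases hs : s(a, b) = s(u, v)
    · right; simpa [Sym2.eq_iff] using hs
    · left; exact ⟨hab, by simpa using hs⟩
  · rintro (⟨hab, -⟩ | ⟨rfl, rfl⟩ | ⟨rfl, rfl⟩)
    · exact hab
    · exact h
    · exact h.symm

variable [Fintype V]

/-- The degrees left after the edges of `X` have been removed. -/
noncomputable def residDeg (d : V → ℕ) (X : SimpleGraph V) : V → ℝ :=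
  fun j => (d j : ℝ) - ∑ b, adjInd X j b

lemma residDeg_addEdge (d : V → ℕ) {X : SimpleGraph V} {u v : V} (huv : u ≠ v)
    (hX : ¬ X.Adj u v) : residDeg d (addEdge X u v) = dropEdge (residDeg d X) u v := by
  funext j
  simp only [residDeg, dropEdge, sum_adjInd_addEdge X huv hX]
  ring

lemma log_descFactorial_degree_addEdge (d : V → ℕ) {X : SimpleGraph V} {u v : V} (huv : u ≠ v)
    (hX : ¬ X.Adj u v) (hd : ∀ j, (addEdge X u v).degree j ≤ d j) :
    ∑ j, Real.log ((d j).descFactorial ((addEdge X u v).degree j)) =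
      ∑ j, Real.log ((d j).descFactorial (X.degree j)) +
        Real.log (residDeg d X u * residDeg d X v) := by
  have hdeg : ∀ j, ((addEdge X u v).degree j : ℝ) = X.degree j + eqInd j u + eqInd j v := fun j => by
    rw [← sum_adjInd, sum_adjInd_addEdge X huv hX, sum_adjInd]
  have hstep : ∀ j, (addEdge X u v).degree j = X.degree j + 1 → 0 < residDeg d X j ∧
      Real.log ((d j).descFactorial ((addEdge X u v).degree j)) =
      Real.log ((d j).descFactorial (X.degree j)) + Real.log (residDeg d X j) := by
    intro j hj
    have hlt : X.degree j < d j := by have := hd j; omega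
    have hres : residDeg d X j = ((d j - X.degree j : ℕ) : ℝ) := by
      rw [residDeg, sum_adjInd, Nat.cast_sub hlt.le]
    have hpos : 0 < residDeg d X j := by
      rw [hres]; exact_mod_cast Nat.sub_pos_of_lt hlt
    refine ⟨hpos, ?_⟩
    rw [hj, Nat.descFactorial_succ, Nat.cast_mul, ← hres, mul_comm, Real.log_mul _ hpos.ne']
    have : (d j).descFactorial (X.degree j) ≠ 0 := by
      rw [Ne, Nat.descFactorial_eq_zero_iff_lt]; omega
    exact_mod_cast this
  have hu : (addEdge X u v).degree u = X.degree u + 1 := by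
    have := hdeg u
    rw [eqInd_self, eqInd_of_ne huv] at this
    exact_mod_cast (by linarith : ((addEdge X u v).degree u : ℝ) = X.degree u + 1)
  have hv : (addEdge X u v).degree v = X.degree v + 1 := by
    have := hdeg v
    rw [eqInd_self, eqInd_of_ne huv.symm] at this
    exact_mod_cast (by linarith : ((addEdge X u v).degree v : ℝ) = X.degree v + 1)
  have hpt : ∀ j, Real.log ((d j).descFactorial ((addEdge X u v).degree j)) =
      Real.log ((d j).descFactorial (X.degree j)) + eqInd j u * Real.log (residDeg d X j) +
        eqInd j v * Real.log (residDeg d X j) := by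
    intro j
    by_cases h1 : j = u
    · subst h1
      rw [(hstep j hu).2, eqInd_self, eqInd_of_ne huv]; ring
    by_cases h2 : j = v
    · subst h2
      rw [(hstep j hv).2, eqInd_self, eqInd_of_ne h1]; ring
    have : (addEdge X u v).degree j = X.degree j := by
      have := hdeg j
      rw [eqInd_of_ne h1, eqInd_of_ne h2] at this
      exact_mod_cast (by linarith : ((addEdge X u v).degree j : ℝ) = X.degree j)
    rw [this, eqInd_of_ne h1, eqInd_of_ne h2]; ring
  rw [Finset.sum_congr rfl fun j _ => hpt j, Finset.sum_add_distrib, Finset.sum_add_distrib,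
    sum_eqInd_mul, sum_eqInd_mul, Real.log_mul (hstep u hu).1.ne' (hstep v hv).1.ne']
  ring

/-- The number of realizations of `d` that contain the graph `X`, relative to the number of all
realizations. -/
lemma abs_log_numReal_residDeg_sub_le {d : V → ℕ} {Δ : ℝ} (hΔ : 3 ≤ Δ) (hd : ∀ j, (d j : ℝ) ≤ Δ)
    (hN : 0 < numReal (fun j => (d j : ℝ)) (⊥ : SimpleGraph V)) (k : ℕ) :
    ∀ X : SimpleGraph V, (∑ j, ∑ b, adjInd X j b = 2 * (k : ℝ)) → (∀ j, X.degree j ≤ d j) →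
      9 * Δ ^ 2 + 2 ≤ ∑ j, (d j : ℝ) - 2 * k →
      0 < numReal (residDeg d X) X ∧
      |Real.log (numReal (residDeg d X) X) - Real.log (numReal (fun j => (d j : ℝ)) ⊥) -
        (∑ j, Real.log ((d j).descFactorial (X.degree j)) -
          ∑ i ∈ Finset.range k, Real.log (∑ j, (d j : ℝ) - 1 - 2 * i) +
          corr (residDeg d X) X - corr (fun j => (d j : ℝ)) ⊥)| ≤
        1350 * Δ ^ 4 * (1 / (∑ j, (d j : ℝ) - 2 * k) - 1 / ∑ j, (d j : ℝ)) := by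
  induction k with
  | zero =>
    intro X hX _ _
    have hbot : X = ⊥ := by
      ext a b
      simp only [SimpleGraph.bot_adj, iff_false]
      intro hab
      have h1 : adjInd X a b ≤ ∑ b, adjInd X a b :=
        Finset.single_le_sum (f := fun b => adjInd X a b) (fun b _ => adjInd_nonneg _ _ _)
          (Finset.mem_univ b)
      have h2 : ∑ b, adjInd X a b ≤ ∑ a, ∑ b, adjInd X a b :=
        Finset.single_le_sum (f := fun a => ∑ b, adjInd X a b)
          (fun a _ => Finset.sum_nonneg fun b _ => adjInd_nonneg _ _ _) (Finset.mem_univ a)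
      rw [adjInd_of_adj hab] at h1
      simp only [CharP.cast_eq_zero, mul_zero] at hX
      linarith
    subst hbot
    have hres : residDeg d (⊥ : SimpleGraph V) = fun j => (d j : ℝ) := by
      funext j; simp [residDeg, adjInd]
    rw [hres]
    exact ⟨hN, by simp⟩
  | succ k ih =>
    intro X hX hdeg hM
    obtain ⟨u, v, hadj⟩ : ∃ u v, X.Adj u v := by
      by_contra! hno
      have : ∑ j, ∑ b, adjInd X j b = 0 :=
        Finset.sum_eq_zero fun a _ => Finset.sum_eq_zero fun b _ => adjInd_of_not_adj (hno a b)
      rw [this] at hX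
      push_cast at hX
      linarith [(Nat.cast_nonneg k : (0:ℝ) ≤ k)]
    obtain ⟨Y, hY, rfl⟩ := exists_eq_addEdge hadj
    have huv := hadj.ne
    have hsumY : ∑ j, ∑ b, adjInd Y j b = 2 * (k : ℝ) := by
      simp only [sum_adjInd_addEdge Y huv hY, Finset.sum_add_distrib, sum_eqInd] at hX
      push_cast at hX
      linarith
    have hdegR : ∀ j, ((addEdge Y u v).degree j : ℝ) = Y.degree j + eqInd j u + eqInd j v :=
      fun j => by rw [← sum_adjInd, sum_adjInd_addEdge Y huv hY, sum_adjInd]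
    have hdegY : ∀ j, Y.degree j ≤ d j := fun j => by
      have h1 : (Y.degree j : ℝ) ≤ (addEdge Y u v).degree j := by
        rw [hdegR]; linarith [eqInd_nonneg j u, eqInd_nonneg j v]
      exact (by exact_mod_cast h1 : Y.degree j ≤ _).trans (hdeg j)
    push_cast at hM
    obtain ⟨hpos, hlog⟩ := ih Y hsumY hdegY (by linarith)
    have hsum : ∑ j, residDeg d Y j = ∑ j, (d j : ℝ) - 2 * k := by
      simp only [residDeg, Finset.sum_sub_distrib, hsumY]
    have hB : DegBound (residDeg d Y) Y Δ Δ := by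
      refine ⟨fun j => ?_, fun j => ?_⟩
      · have : 0 ≤ ∑ b, adjInd Y j b := Finset.sum_nonneg fun b _ => adjInd_nonneg _ _ _
        simp only [residDeg]; linarith [hd j]
      · simp only [residDeg]; linarith [hd j]
    have hge : ∀ w, 1 ≤ eqInd w u + eqInd w v → 1 ≤ residDeg d Y w := by
      intro w hw
      have h1 : ((addEdge Y u v).degree w : ℝ) ≤ d w := by exact_mod_cast hdeg w
      rw [hdegR] at h1
      rw [residDeg, sum_adjInd]; linarith
    have hstep := abs_log_numReal_dropEdge_sub_le hB hΔ (by rw [hsum]; linarith) huv hY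
      (hge u (by rw [eqInd_self]; linarith [eqInd_nonneg u v]))
      (hge v (by rw [eqInd_self]; linarith [eqInd_nonneg v u])) hpos
    rw [← residDeg_addEdge d huv hY, hsum] at hstep
    refine ⟨hstep.1, ?_⟩
    rw [log_descFactorial_degree_addEdge d huv hY hdeg, Finset.sum_range_succ]
    obtain ⟨-, hs⟩ := hstep
    have harg : ∑ j, (d j : ℝ) - 2 * k - 1 = ∑ j, (d j : ℝ) - 1 - 2 * k := by ring
    rw [harg] at hs
    generalize ∑ j, (d j : ℝ) = M at *
    have hM1 : 0 < M - 2 * k := by nlinarith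
    have hM2 : 0 < M - 2 * (k + 1) := by nlinarith
    have herr : 2700 * (Δ ^ 4 / (M - 2 * k) ^ 2) ≤
        1350 * Δ ^ 4 * (1 / (M - 2 * (k + 1)) - 1 / (M - 2 * k)) := by
      have e : 1 / (M - 2 * (k + 1)) - 1 / (M - 2 * k) =
          2 / ((M - 2 * (k + 1)) * (M - 2 * k)) := by
        rw [div_sub_div _ _ hM2.ne' hM1.ne']
        congr 1; ring
      have h1 : 2 / (M - 2 * k) ^ 2 ≤ 2 / ((M - 2 * (k + 1)) * (M - 2 * k)) := by
        refine div_le_div_of_nonneg_left (by norm_num) (mul_pos hM2 hM1) ?_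
        rw [sq]; exact mul_le_mul_of_nonneg_right (by linarith) hM1.le
      rw [e]
      calc _ = 1350 * Δ ^ 4 * (2 / (M - 2 * k) ^ 2) := by ring
        _ ≤ _ := mul_le_mul_of_nonneg_left h1 (by positivity)
    push_cast
    obtain ⟨a1, a2⟩ := abs_le.1 hs
    obtain ⟨b1, b2⟩ := abs_le.1 hlog
    rw [abs_le]
    constructor <;> linarith

end EdgeChain

section Existence

variable {V : Type*} [Fintype V]

/-- A sequence with bounded terms and a large even sum is graphical. -/
lemma numReal_bot_pos {d : V → ℕ} {Δ : ℝ} (hΔ : 3 ≤ Δ) (hd : ∀ j, (d j : ℝ) ≤ Δ)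
    (heven : Even (∑ j, d j)) (hM : 9 * Δ ^ 2 + 4 ≤ ∑ j, (d j : ℝ)) :
    0 < numReal (fun j => (d j : ℝ)) (⊥ : SimpleGraph V) := by
  obtain ⟨G, hGm, hmax⟩ := Finset.exists_max_image
    (Finset.univ.filter fun G : SimpleGraph V => ∀ j, ∑ b, adjInd G j b ≤ d j)
    (fun G => ∑ j, ∑ b, adjInd G j b) ⟨⊥, by simp [adjInd]⟩
  have hG : ∀ j, ∑ b, adjInd G j b ≤ d j := (Finset.mem_filter.1 hGm).2
  have hno : ∀ u v, (∀ j, ∑ b, adjInd G j b + eqInd j u + eqInd j v ≤ d j) →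
      ∀ G' : SimpleGraph V, ¬ ∀ j, ∑ b, adjInd G' j b = ∑ b, adjInd G j b + eqInd j u + eqInd j v := by
    intro u v huv G' hG'
    have := hmax G' (by simp only [Finset.mem_filter, Finset.mem_univ, true_and]
                        intro j; rw [hG']; exact huv j)
    simp only [hG', Finset.sum_add_distrib, sum_eqInd] at this
    linarith
  by_cases hall : ∀ j, ∑ b, adjInd G j b = d j
  · exact numReal_pos_iff.2 ⟨G, mem_realizations.2 ⟨fun a b _ => by simp, hall⟩⟩
  exfalso
  push Not at hall
  obtain ⟨u, hu⟩ := hall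
  have hdefR : ∀ j, ∑ b, adjInd G j b ≠ d j → ∑ b, adjInd G j b + 1 ≤ d j := by
    intro j hj
    have h1 := lt_of_le_of_ne (hG j) hj
    rw [sum_adjInd] at h1 ⊢
    exact_mod_cast h1
  obtain ⟨v, hv⟩ : ∃ v, ∀ j, ∑ b, adjInd G j b + eqInd j u + eqInd j v ≤ d j := by
    by_cases h2 : ∑ b, adjInd G u b + 2 ≤ d u
    · refine ⟨u, fun j => ?_⟩
      by_cases hj : j = u
      · subst hj; rw [eqInd_self]; linarith
      · rw [eqInd_of_ne hj]; linarith [hG j]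
    have hu1 : ∑ b, adjInd G u b + 1 = d u := by
      have h1 := hdefR u hu
      rw [sum_adjInd] at h1 h2 ⊢
      have h1' : G.degree u + 1 ≤ d u := by exact_mod_cast h1
      have h2' : ¬ G.degree u + 2 ≤ d u := by exact_mod_cast h2
      exact_mod_cast (by omega : G.degree u + 1 = d u)
    obtain ⟨v, hvu, hv⟩ : ∃ v, v ≠ u ∧ ∑ b, adjInd G v b ≠ d v := by
      by_contra! hcon
      have hsum : ∑ j, d j = ∑ j, G.degree j + 1 := by
        have : ∀ j, (d j : ℝ) = (G.degree j : ℝ) + eqInd j u := by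
          intro j
          by_cases hj : j = u
          · subst hj; rw [eqInd_self, ← hu1, sum_adjInd]
          · rw [eqInd_of_ne hj, ← hcon j hj, sum_adjInd, add_zero]
        have h3 : ∑ j, (d j : ℝ) = ∑ j, (G.degree j : ℝ) + 1 := by
          simp only [this, Finset.sum_add_distrib, sum_eqInd]
        exact_mod_cast h3
      rw [hsum, G.sum_degrees_eq_twice_card_edges] at heven
      exact (Nat.not_even_iff_odd.2 (odd_two_mul_add_one _)) heven
    refine ⟨v, fun j => ?_⟩
    by_cases hj : j = u
    · subst hj; rw [eqInd_self, eqInd_of_ne hvu.symm]; linarith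
    by_cases hj' : j = v
    · subst hj'; rw [eqInd_self, eqInd_of_ne hj]; linarith [hdefR j hv]
    · rw [eqInd_of_ne hj, eqInd_of_ne hj']; linarith [hG j]
  have hclique : ∀ w, w ≠ u → ∑ b, adjInd G w b ≠ d w → G.Adj u w := by
    intro w hw hwd
    by_contra hadj
    refine hno u w (fun j => ?_) (addEdge G u w) fun j => sum_adjInd_addEdge G hw.symm hadj j
    by_cases hj : j = u
    · subst hj; rw [eqInd_self, eqInd_of_ne hw.symm]; linarith [hdefR j hu]
    by_cases hj' : j = w
    · subst hj'; rw [eqInd_self, eqInd_of_ne hj]; linarith [hdefR j hwd]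
    · rw [eqInd_of_ne hj, eqInd_of_ne hj']; linarith [hG j]
  have hadjuv : u ≠ v → G.Adj u v := by
    intro huv
    refine hclique v huv.symm fun h => ?_
    have := hv v
    rw [h, eqInd_self, eqInd_of_ne huv.symm] at this
    linarith
  have hdeg0 : ∀ j, 0 ≤ ∑ b, adjInd G j b := fun j =>
    Finset.sum_nonneg fun b _ => adjInd_nonneg _ _ _
  have hdefic : ∑ j, (d j : ℝ) - ∑ j, ∑ b, adjInd G j b ≤ Δ * (Δ + 1) := by
    rw [← Finset.sum_sub_distrib]
    calc _ ≤ ∑ j, Δ * (adjInd G u j + eqInd j u) := by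
          refine Finset.sum_le_sum fun j _ => ?_
          by_cases hj : j = u
          · subst hj
            rw [adjInd_self, eqInd_self]; linarith [hd j, hdeg0 j]
          by_cases hjd : ∑ b, adjInd G j b = d j
          · rw [hjd, sub_self]
            exact mul_nonneg (by linarith) (add_nonneg (adjInd_nonneg _ _ _) (eqInd_nonneg _ _))
          · rw [adjInd_of_adj (hclique j hj hjd), eqInd_of_ne hj]; linarith [hd j, hdeg0 j]
      _ = Δ * (∑ j, adjInd G u j + 1) := by
          rw [← Finset.mul_sum, Finset.sum_add_distrib, sum_eqInd]
      _ ≤ _ := mul_le_mul_of_nonneg_left (by linarith [hG u, hd u]) (by linarith)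
  have hmem : G ∈ realizations (fun j => ∑ b, adjInd G j b) ⊥ :=
    mem_realizations.2 ⟨fun a b _ => by simp, fun _ => rfl⟩
  have hB : DegBound (fun j => ∑ b, adjInd G j b) (⊥ : SimpleGraph V) Δ Δ :=
    ⟨fun j => (hG j).trans (hd j), fun j => by
      have : ∑ b, adjInd (⊥ : SimpleGraph V) j b = 0 := by simp [adjInd]
      rw [this, add_zero]; exact (hG j).trans (hd j)⟩
  have hout := le_switchOut hmem hB (by linarith) u v
  have hpos : 0 < switchOut ⊥ G u v := by
    refine lt_of_lt_of_le ?_ hout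
    nlinarith
  obtain ⟨a, b, hab, hua, hGua, hvb, hGvb⟩ :
      ∃ a b, G.Adj a b ∧ a ≠ u ∧ ¬ G.Adj u a ∧ b ≠ v ∧ ¬ G.Adj v b := by
    by_contra! hcon
    refine hpos.not_ge (Finset.sum_nonpos fun a _ => Finset.sum_nonpos fun b _ => le_of_eq ?_)
    by_cases hab : G.Adj a b
    swap
    · rw [adjInd_of_not_adj hab]; ring
    have hbot : ∀ x y, adjInd (⊥ : SimpleGraph V) x y = 0 := fun x y => by simp [adjInd]
    rw [hbot, hbot]
    by_cases hau : a = u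
    · subst hau; rw [eqInd_self, adjInd_self]; ring
    by_cases hGua : G.Adj u a
    · rw [eqInd_of_ne hau, adjInd_of_adj hGua]; ring
    by_cases hbv : b = v
    · subst hbv; rw [eqInd_self, adjInd_self]; ring
    · rw [eqInd_of_ne hbv, adjInd_of_adj (hcon a b hab hau hGua hbv)]; ring
  obtain ⟨G₁, hG₁, hGG₁⟩ := exists_eq_addEdge hab
  have hle : ∀ x y, G₁.Adj x y → G.Adj x y := fun x y h => by
    rw [hGG₁, addEdge_adj _ hab.ne]; exact Or.inl h
  have hn1 : ¬ G₁.Adj u a := fun h => hGua (hle _ _ h)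
  have hn2 : ¬ (addEdge G₁ u a).Adj v b := by
    rw [addEdge_adj _ hua.symm]
    rintro (h | ⟨-, h⟩ | ⟨h1, h2⟩)
    · exact hGvb (hle _ _ h)
    · exact hab.ne h.symm
    · by_cases huv : u = v
      · exact hvb (h2.trans huv)
      · exact hGua (h1 ▸ hadjuv huv)
  refine hno u v hv (addEdge (addEdge G₁ u a) v b) fun j => ?_
  rw [sum_adjInd_addEdge _ hvb.symm hn2, sum_adjInd_addEdge _ hua.symm hn1, hGG₁,
    sum_adjInd_addEdge _ hab.ne hG₁]
  ring

end Existence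

section LeafRemoval

variable {V : Type*}

/-- The tree obtained by attaching the leaf `l` to the vertex `k`. -/
def graft {l : V} (T : SimpleGraph {v : V // v ≠ l}) (k : {v : V // v ≠ l}) : SimpleGraph V :=
  addEdge (T.map (Function.Embedding.subtype _)) l k

lemma map_subtype_not_adj {l : V} (T : SimpleGraph {v : V // v ≠ l}) (b : V) :
    ¬ (T.map (Function.Embedding.subtype _)).Adj l b := by
  rw [SimpleGraph.map_adj]
  rintro ⟨a, -, -, ha, -⟩
  exact a.2 ha

lemma adjInd_map_subtype {l : V} (T : SimpleGraph {v : V // v ≠ l}) (a b : {v : V // v ≠ l}) :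
    adjInd (T.map (Function.Embedding.subtype _)) (a : V) b = adjInd T a b := by
  have h : (T.map (Function.Embedding.subtype _)).Adj (a : V) b ↔ T.Adj a b :=
    SimpleGraph.map_adj_apply (f := Function.Embedding.subtype _)
  by_cases hab : T.Adj a b
  · rw [adjInd_of_adj hab, adjInd_of_adj (h.2 hab)]
  · rw [adjInd_of_not_adj hab, adjInd_of_not_adj fun h' => hab (h.1 h')]

lemma adjInd_map_subtype_left {l : V} (T : SimpleGraph {v : V // v ≠ l}) (b : V) :
    adjInd (T.map (Function.Embedding.subtype _)) l b = 0 :=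
  adjInd_of_not_adj (map_subtype_not_adj T b)

lemma adjInd_map_subtype_right {l : V} (T : SimpleGraph {v : V // v ≠ l}) (b : V) :
    adjInd (T.map (Function.Embedding.subtype _)) b l = 0 := by
  rw [adjInd_comm]; exact adjInd_map_subtype_left T b

lemma graft_adj_leaf {l : V} (T : SimpleGraph {v : V // v ≠ l}) (k : {v : V // v ≠ l}) (b : V) :
    (graft T k).Adj l b ↔ b = k := by
  rw [graft, addEdge_adj _ k.2.symm]
  constructor
  · rintro (h | ⟨-, h⟩ | ⟨h, -⟩)
    · exact absurd h (map_subtype_not_adj T b)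
    · exact h
    · exact absurd h.symm k.2
  · rintro rfl; exact Or.inr (Or.inl ⟨rfl, rfl⟩)

lemma graft_adj {l : V} (T : SimpleGraph {v : V // v ≠ l}) (k a b : {v : V // v ≠ l}) :
    (graft T k).Adj a b ↔ T.Adj a b := by
  rw [graft, addEdge_adj _ k.2.symm,
    show (T.map (Function.Embedding.subtype _)).Adj (a : V) b ↔ T.Adj a b from
      SimpleGraph.map_adj_apply (f := Function.Embedding.subtype _)]
  constructor
  · rintro (h | ⟨h, -⟩ | ⟨-, h⟩)
    · exact h
    · exact absurd h a.2
    · exact absurd h b.2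
  · exact Or.inl

lemma graft_connected {l : V} {T : SimpleGraph {v : V // v ≠ l}} (hT : T.Connected)
    (k : {v : V // v ≠ l}) : (graft T k).Connected := by
  have hadj : (graft T k).Adj l k := (graft_adj_leaf T k _).2 rfl
  have hk : ∀ w : V, (graft T k).Reachable w k := by
    intro w
    by_cases hw : w = l
    · rw [hw]; exact hadj.reachable
    · exact (hT.preconnected ⟨w, hw⟩ k).map
        (⟨Subtype.val, fun {a b} h => (graft_adj T k a b).2 h⟩ : T →g graft T k)
  have : Nonempty V := ⟨l⟩
  exact ⟨fun a b => (hk a).trans (hk b).symm⟩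

variable [Fintype V]

lemma sum_adjInd_graft {l : V} (T : SimpleGraph {v : V // v ≠ l}) (k a : {v : V // v ≠ l}) :
    ∑ b, adjInd (graft T k) (a : V) b = ∑ b, adjInd T a b + eqInd a k := by
  rw [graft, sum_adjInd_addEdge _ k.2.symm (map_subtype_not_adj T _), eqInd_of_ne a.2,
    Fintype.sum_eq_add_sum_subtype_ne _ l, adjInd_map_subtype_right]
  simp only [adjInd_map_subtype, add_zero, zero_add]
  congr 1
  simp [eqInd, Subtype.ext_iff]

lemma sum_adjInd_graft_leaf {l : V} (T : SimpleGraph {v : V // v ≠ l}) (k : {v : V // v ≠ l}) :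
    ∑ b, adjInd (graft T k) l b = 1 := by
  simp [adjInd, graft_adj_leaf]

lemma edgeWeight_graft {l : V} (y : V → ℝ) (T : SimpleGraph {v : V // v ≠ l})
    (k : {v : V // v ≠ l}) :
    edgeWeight y (graft T k) = edgeWeight (fun v : {v : V // v ≠ l} => y v) T +
      2 * (y l * y k) := by
  rw [graft, edgeWeight_addEdge _ k.2.symm (map_subtype_not_adj T _)]
  congr 1
  rw [edgeWeight, Fintype.sum_eq_add_sum_subtype_ne _ l]
  simp only [adjInd_map_subtype_left, zero_mul, Finset.sum_const_zero, zero_add, edgeWeight]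
  refine Finset.sum_congr rfl fun a _ => ?_
  rw [Fintype.sum_eq_add_sum_subtype_ne _ l, adjInd_map_subtype_right]
  simp only [adjInd_map_subtype, zero_mul, zero_add]

/-- The connected graphs whose degrees exceed `e` by one. -/
noncomputable def treesWith (e : V → ℕ) : Finset (SimpleGraph V) :=
  Finset.univ.filter fun T => T.Connected ∧ ∀ j, ∑ b, adjInd T j b = e j + 1

/-- The sum over the trees with excess degrees `e` of the product of the weights
`exp (-c * y a * y b)` of the edges. -/
noncomputable def treeSum (c : ℝ) (y : V → ℝ) (e : V → ℕ) : ℝ :=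
  ∑ T ∈ treesWith e, Real.exp (-(c / 2 * edgeWeight y T))

lemma mem_treesWith {e : V → ℕ} {T : SimpleGraph V} :
    T ∈ treesWith e ↔ T.Connected ∧ ∀ j, ∑ b, adjInd T j b = e j + 1 := by
  simp [treesWith]

/-- Removal of the leaf `l`. -/
lemma treeSum_eq_sum (c : ℝ) (y : V → ℝ) (e : V → ℕ) {l : V} (hl : e l = 0)
    (hV : 3 ≤ Fintype.card V) :
    treeSum c y e = ∑ k : {v : V // v ≠ l}, if 1 ≤ e k then
      Real.exp (-(c * (y l * y k))) * treeSum c (fun v : {v : V // v ≠ l} => y v)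
        (fun v => e v - if v = k then 1 else 0) else 0 := by
  rw [← Finset.sum_filter]
  simp only [treeSum, Finset.mul_sum]
  rw [Finset.sum_sigma']
  symm
  have hcard : Fintype.card {v : V // v ≠ l} = Fintype.card V - 1 := by
    simp
  have : Nontrivial {v : V // v ≠ l} := Fintype.one_lt_card_iff_nontrivial.1 (by omega)
  refine Finset.sum_bij (fun p _ => graft p.2 p.1) ?_ ?_ ?_ ?_
  · rintro ⟨k, T⟩ hm
    simp only [Finset.mem_sigma, Finset.mem_filter, Finset.mem_univ, true_and,
      mem_treesWith] at hm
    obtain ⟨hk, hT, hdeg⟩ := hm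
    refine mem_treesWith.2 ⟨graft_connected hT k, fun j => ?_⟩
    by_cases hj : j = l
    · subst hj; rw [sum_adjInd_graft_leaf, hl]; simp
    · have := sum_adjInd_graft T k ⟨j, hj⟩
      rw [this, hdeg]
      by_cases hjk : (⟨j, hj⟩ : {v : V // v ≠ l}) = k
      · subst hjk
        rw [eqInd_self, if_pos rfl, Nat.cast_sub hk]; simp
      · rw [eqInd_of_ne hjk, if_neg hjk]; simp
  · rintro ⟨k, T⟩ - ⟨k', T'⟩ - heq
    dsimp only at heq
    have hk : k = k' := by
      apply Subtype.ext
      rw [← graft_adj_leaf T' k', ← heq, graft_adj_leaf]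
    subst hk
    have hT : T = T' := by
      ext a b
      rw [← graft_adj T k, heq, graft_adj]
    rw [hT]
  · intro T hT
    obtain ⟨hconn, hdeg⟩ := mem_treesWith.1 hT
    have hdl : T.degree l = 1 := by
      have := hdeg l
      rw [sum_adjInd, hl] at this
      exact_mod_cast (by simpa using this : (T.degree l : ℝ) = 1)
    obtain ⟨k, hk, huniq⟩ := SimpleGraph.degree_eq_one_iff_existsUnique_adj.1 hdl
    have hkl : k ≠ l := hk.ne'
    have hc : (T.comap (Subtype.val : {v : V // v ≠ l} → V)).Connected :=
      hconn.induce_compl_singleton_of_degree_eq_one hdl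
    have hgr : graft (T.comap (Subtype.val : {v : V // v ≠ l} → V)) ⟨k, hkl⟩ = T := by
      have h1 : ∀ b, (graft (T.comap (Subtype.val : {v : V // v ≠ l} → V)) ⟨k, hkl⟩).Adj l b ↔
          T.Adj l b := fun b => by
        rw [graft_adj_leaf]
        exact ⟨fun h => h ▸ hk, fun h => huniq b h⟩
      ext a b
      by_cases ha : a = l
      · subst ha; exact h1 b
      by_cases hb : b = l
      · subst hb; rw [SimpleGraph.adj_comm, h1, SimpleGraph.adj_comm]
      · exact graft_adj _ _ ⟨a, ha⟩ ⟨b, hb⟩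
    have hsum : ∀ j : {v : V // v ≠ l},
        ∑ b, adjInd (T.comap (Subtype.val : {v : V // v ≠ l} → V)) j b + eqInd j ⟨k, hkl⟩ =
          e j + 1 := fun j => by
      rw [← sum_adjInd_graft, hgr, hdeg]
    have hek : 1 ≤ e k := by
      have h1 := hsum ⟨k, hkl⟩
      have h2 := hc.preconnected.degree_pos_of_nontrivial ⟨k, hkl⟩
      rw [eqInd_self, sum_adjInd] at h1
      have h3 := add_right_cancel h1
      rw [Nat.cast_inj] at h3
      rw [← h3, Nat.one_le_iff_ne_zero, ← Nat.pos_iff_ne_zero]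
      convert h2
    refine ⟨⟨⟨k, hkl⟩, T.comap Subtype.val⟩, ?_, hgr⟩
    simp only [Finset.mem_sigma, Finset.mem_filter, Finset.mem_univ, true_and, mem_treesWith]
    refine ⟨hek, hc, fun j => ?_⟩
    have h1 := hsum j
    by_cases hj : j = ⟨k, hkl⟩
    · subst hj
      rw [eqInd_self] at h1
      rw [if_pos rfl, Nat.cast_sub hek]
      push_cast; linarith
    · rw [eqInd_of_ne hj] at h1
      rw [if_neg hj]; simp only [tsub_zero]; linarith
  · rintro ⟨k, T⟩ -
    dsimp only
    rw [edgeWeight_graft, ← Real.exp_add]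
    congr 1; ring

end LeafRemoval

section TreeSumBounds

/-- Jensen's inequality and its converse up to second order. -/
lemma exp_mean_bounds {ι : Type*} [Fintype ι] {p D : ι → ℝ} {F r : ℝ} (hp : ∀ k, 0 ≤ p k)
    (hp1 : ∑ k, p k = 1) (hD : ∑ k, p k * D k = F) (hr : ∀ k, |D k - F| ≤ r) (hr1 : r ≤ 1) :
    Real.exp (-F) ≤ ∑ k, p k * Real.exp (-D k) ∧
      ∑ k, p k * Real.exp (-D k) ≤ Real.exp (-F + r ^ 2) := by
  have hfac : ∑ k, p k * Real.exp (-D k) =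
      Real.exp (-F) * ∑ k, p k * Real.exp (F - D k) := by
    rw [Finset.mul_sum]
    refine Finset.sum_congr rfl fun k _ => ?_
    rw [show -D k = -F + (F - D k) by ring, Real.exp_add]; ring
  have hlin : ∑ k, p k * (F - D k) = 0 := by
    simp only [mul_sub, Finset.sum_sub_distrib, ← Finset.sum_mul, hp1, hD]; ring
  have hlow : 1 ≤ ∑ k, p k * Real.exp (F - D k) := by
    calc (1 : ℝ) = ∑ k, p k * ((F - D k) + 1) := by
          simp only [mul_add, Finset.sum_add_distrib, hlin, mul_one, hp1]; ring
      _ ≤ _ := Finset.sum_le_sum fun k _ =>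
          mul_le_mul_of_nonneg_left (Real.add_one_le_exp _) (hp k)
  have hup : ∑ k, p k * Real.exp (F - D k) ≤ Real.exp (r ^ 2) := by
    calc ∑ k, p k * Real.exp (F - D k) ≤ ∑ k, p k * (1 + (F - D k) + r ^ 2) := by
          refine Finset.sum_le_sum fun k _ => mul_le_mul_of_nonneg_left ?_ (hp k)
          have hk : |F - D k| ≤ r := by rw [abs_sub_comm]; exact hr k
          have h1 := (abs_le.1 (Real.abs_exp_sub_one_sub_id_le (hk.trans hr1))).2
          have h2 : (F - D k) ^ 2 ≤ r ^ 2 := sq_le_sq' (abs_le.1 hk).1 (abs_le.1 hk).2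
          linarith
      _ = 1 + r ^ 2 := by
          simp only [mul_add, Finset.sum_add_distrib, hlin, mul_one, hp1, ← Finset.sum_mul]; ring
      _ ≤ _ := by linarith [Real.add_one_le_exp (r ^ 2)]
  rw [hfac, Real.exp_add]
  exact ⟨le_mul_of_one_le_right (Real.exp_pos _).le hlow,
    mul_le_mul_of_nonneg_left hup (Real.exp_pos _).le⟩

/-- The multinomial number of trees with excess degrees `e`. -/
noncomputable def treeCount {V : Type*} [Fintype V] (e : V → ℕ) : ℝ :=
  ((∑ j, e j).factorial : ℝ) / ∏ j, ((e j).factorial : ℝ)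

/-- The mean of the edge weight over the trees with excess degrees `e`. -/
noncomputable def meanWeight {V : Type*} [Fintype V] (c : ℝ) (y : V → ℝ) (e : V → ℕ) : ℝ :=
  c / (∑ j, (e j : ℝ)) * ∑ j, (e j : ℝ) * (y j * (∑ i, y i - y j))

lemma treeCount_pos {V : Type*} [Fintype V] (e : V → ℕ) : 0 < treeCount e :=
  div_pos (by exact_mod_cast Nat.factorial_pos _)
    (Finset.prod_pos fun j _ => by exact_mod_cast Nat.factorial_pos _)

lemma sum_subtype_ne {V : Type*} [Fintype V] {M : Type*} [AddCommMonoid M] (f : V → M) {l : V}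
    (hl : f l = 0) : ∑ v : {v : V // v ≠ l}, f v = ∑ v, f v := by
  rw [Fintype.sum_eq_add_sum_subtype_ne f l, hl, zero_add]

lemma sum_reduced {V : Type*} [Fintype V] (e : V → ℕ) (g : V → ℝ) {l : V} (hl : e l = 0)
    {k : {v : V // v ≠ l}} (hk : 1 ≤ e k) :
    ∑ v : {v : V // v ≠ l}, ((e v - if v = k then 1 else 0 : ℕ) : ℝ) * g v =
      ∑ v, (e v : ℝ) * g v - g k := by
  rw [← sum_subtype_ne (fun v => (e v : ℝ) * g v) (l := l) (by simp [hl]), eq_sub_iff_add_eq,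
    ← Finset.sum_ite_eq' Finset.univ k (fun v => g (v : V)) |>.trans (if_pos (Finset.mem_univ k)),
    ← Finset.sum_add_distrib]
  refine Finset.sum_congr rfl fun v _ => ?_
  by_cases hv : v = k
  · subst hv
    rw [if_pos rfl, if_pos rfl, Nat.cast_sub hk]; push_cast; ring
  · simp [hv]

lemma sum_nat_reduced {V : Type*} [Fintype V] (e : V → ℕ) {l : V} (hl : e l = 0)
    {k : {v : V // v ≠ l}} (hk : 1 ≤ e k) :
    ∑ v : {v : V // v ≠ l}, (e v - if v = k then 1 else 0 : ℕ) + 1 = ∑ v, e v := by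
  have h := sum_reduced e (fun _ => 1) hl hk
  simp only [mul_one] at h
  have h' : ((∑ v : {v : V // v ≠ l}, (e v - if v = k then 1 else 0 : ℕ) + 1 : ℕ) : ℝ) =
      ((∑ v, e v : ℕ) : ℝ) := by
    push_cast
    rw [eq_sub_iff_add_eq] at h
    exact h
  exact_mod_cast h'

lemma treeCount_reduced {V : Type*} [Fintype V] (e : V → ℕ) {l : V} (hl : e l = 0)
    {k : {v : V // v ≠ l}} (hk : 1 ≤ e k) :
    treeCount (fun v : {v : V // v ≠ l} => e v - if v = k then 1 else 0) =
      treeCount e * ((e k : ℝ) / ∑ v, (e v : ℝ)) := by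
  unfold treeCount
  have hs := sum_nat_reduced e hl hk
  set s := ∑ v : {v : V // v ≠ l}, (e v - if v = k then 1 else 0 : ℕ) with hsdef
  have hP : ∏ j, ((e j).factorial : ℝ) =
      e k * ∏ v : {v : V // v ≠ l}, (((e v - if v = k then 1 else 0 : ℕ)).factorial : ℝ) := by
    rw [Fintype.prod_eq_mul_prod_subtype_ne (fun j => ((e j).factorial : ℝ)) l, hl,
      Nat.factorial_zero, Nat.cast_one, one_mul,
      ← Finset.mul_prod_erase _ _ (Finset.mem_univ k),
      ← Finset.mul_prod_erase Finset.univ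
        (fun v : {v : V // v ≠ l} => (((e v - if v = k then 1 else 0 : ℕ)).factorial : ℝ))
        (Finset.mem_univ k), ← mul_assoc]
    congr 1
    · rw [if_pos rfl, ← Nat.mul_factorial_pred (by omega)]; push_cast; rfl
    · refine Finset.prod_congr rfl fun v hv => ?_
      rw [if_neg (Finset.ne_of_mem_erase hv), Nat.sub_zero]
  have hk0 : (e k : ℝ) ≠ 0 := by exact_mod_cast (by omega : e k ≠ 0)
  have hP0 : ∏ v : {v : V // v ≠ l},
      (((e v - if v = k then 1 else 0 : ℕ)).factorial : ℝ) ≠ 0 :=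
    Finset.prod_ne_zero_iff.2 fun v _ => by exact_mod_cast Nat.factorial_ne_zero _
  have hsR : ∑ v, (e v : ℝ) = s + 1 := by rw [← Nat.cast_sum, ← hs]; push_cast; rfl
  have hs1 : (s : ℝ) + 1 ≠ 0 := by positivity
  rw [hP, hsR, ← hs, Nat.factorial_succ]
  push_cast
  field_simp

lemma exists_excess_eq_zero {V : Type*} [Fintype V] (e : V → ℕ)
    (h : ∑ j, e j < Fintype.card V) : ∃ l, e l = 0 := by
  by_contra! hne
  have : ∑ _j : V, 1 ≤ ∑ j, e j := Finset.sum_le_sum fun j _ => Nat.one_le_iff_ne_zero.2 (hne j)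
  simp at this
  omega

lemma treesWith_of_card_eq_two {V : Type*} [Fintype V] (hV : Fintype.card V = 2) (e : V → ℕ)
    (he : ∀ v, e v = 0) : treesWith e = {⊤} := by
  have hV' : Finset.card (Finset.univ : Finset V) = 2 := by simpa using hV
  obtain ⟨a, b, hab, huniv⟩ := Finset.card_eq_two.1 hV'
  have : Nontrivial V := ⟨a, b, hab⟩
  have hcov : ∀ v, v = a ∨ v = b := fun v => by
    have := Finset.mem_univ v
    rw [huniv] at this
    simpa using this
  ext T
  rw [mem_treesWith, Finset.mem_singleton]
  constructor
  · rintro ⟨hT, -⟩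
    have hadj : T.Adj a b := by
      have h := hT.preconnected.exists_adj_of_nontrivial a
      obtain ⟨w, hw⟩ := h
      rcases hcov w with rfl | rfl
      · exact absurd hw (T.irrefl)
      · exact hw
    ext u v
    rw [SimpleGraph.top_adj]
    refine ⟨fun h => h.ne, fun h => ?_⟩
    rcases hcov u with rfl | rfl <;> rcases hcov v with rfl | rfl
    · exact absurd rfl h
    · exact hadj
    · exact hadj.symm
    · exact absurd rfl h
  · rintro rfl
    refine ⟨SimpleGraph.connected_top, fun j => ?_⟩
    rw [sum_adjInd, he, Nat.cast_zero, zero_add, Nat.cast_eq_one]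
    convert (SimpleGraph.complete_graph_degree j).trans (by rw [hV])

lemma edgeWeight_top {V : Type*} [Fintype V] (y : V → ℝ) :
    edgeWeight y ⊤ = ∑ a, y a * (∑ b, y b - y a) := by
  unfold edgeWeight
  refine Finset.sum_congr rfl fun a _ => ?_
  have h : ∀ b, adjInd (⊤ : SimpleGraph V) a b * (y a * y b) =
      y a * y b - if b = a then y a * y b else 0 := fun b => by
    by_cases hb : b = a
    · subst hb; simp [adjInd_self]
    · rw [adjInd_of_adj (by simpa using Ne.symm hb), if_neg hb]; ring
  rw [Finset.sum_congr rfl fun b _ => h b, Finset.sum_sub_distrib, Finset.sum_ite_eq',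
    if_pos (Finset.mem_univ _), ← Finset.mul_sum]
  ring

end TreeSumBounds

section TreeSumInduction

lemma sum_sub_of_card_eq_two {V : Type*} [Fintype V] (hV : Fintype.card V = 2) (y : V → ℝ)
    (k : V) : ∑ a, y a * (∑ b, y b - y a) = 2 * (y k * (∑ b, y b - y k)) := by
  have hV' : Finset.card (Finset.univ : Finset V) = 2 := by simpa using hV
  obtain ⟨a, b, hab, huniv⟩ := Finset.card_eq_two.1 hV'
  rw [huniv, Finset.sum_pair hab, Finset.sum_pair hab]
  have := Finset.mem_univ k
  rw [huniv, Finset.mem_insert, Finset.mem_singleton] at this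
  rcases this with rfl | rfl <;> ring

lemma sum_real_subtype_ne {V : Type*} [Fintype V] (y : V → ℝ) (l : V) :
    ∑ v : {v : V // v ≠ l}, y v = ∑ v, y v - y l := by
  rw [Fintype.sum_eq_add_sum_subtype_ne y l]; ring

lemma card_subtype_ne {V : Type*} [Fintype V] (l : V) :
    Fintype.card {v : V // v ≠ l} = Fintype.card V - 1 := by
  simp

lemma treeSum_of_card_eq_three {V : Type*} [Fintype V] (hV : Fintype.card V = 3) (c : ℝ)
    (y : V → ℝ) (e : V → ℕ) (he : ∑ j, e j = 1) :
    treeSum c y e = treeCount e * Real.exp (-meanWeight c y e) := by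
  obtain ⟨l, hl⟩ := exists_excess_eq_zero e (by omega)
  obtain ⟨k, hk⟩ : ∃ k, e k ≠ 0 := by
    by_contra! h
    simp [h] at he
  have hle : ∀ v, v ≠ k → e v = 0 := fun v hv => by
    have h := Finset.sum_le_sum_of_subset (f := e) (Finset.subset_univ ({v, k} : Finset V))
    rw [Finset.sum_pair hv] at h
    omega
  have hk1 : e k = 1 := by
    rw [Finset.sum_eq_single k (fun v _ hv => hle v hv) (by simp)] at he
    exact he
  have hkl : k ≠ l := fun h => hk (h ▸ hl)
  have hcount : treeCount e = 1 := by
    rw [treeCount, he, Finset.prod_eq_one fun j _ => ?_]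
    · simp
    · by_cases hj : j = k
      · rw [hj, hk1]; simp
      · rw [hle j hj]; simp
  have hmean : meanWeight c y e = c * (y k * (∑ i, y i - y k)) := by
    rw [meanWeight, ← Nat.cast_sum, he, Finset.sum_eq_single k (fun v _ hv => by simp [hle v hv])
      (by simp), hk1]
    push_cast; ring
  rw [treeSum_eq_sum c y e hl (by omega), Finset.sum_eq_single ⟨k, hkl⟩ (fun v _ hv => ?_) (by simp),
    if_pos (by rw [hk1]), hcount, hmean, one_mul, treeSum, treesWith_of_card_eq_two,
    Finset.sum_singleton, edgeWeight_top, sum_sub_of_card_eq_two _ _ ⟨k, hkl⟩, ← Real.exp_add,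
    sum_real_subtype_ne]
  · congr 1; ring
  · rw [card_subtype_ne, hV]
  · rw [card_subtype_ne, hV]
  · intro v
    by_cases hv : v = ⟨k, hkl⟩
    · rw [if_pos hv, hv, hk1]
    · rw [hle v fun h => hv (Subtype.ext h)]; simp
  · rw [if_neg]
    rw [hle v fun h => hv (Subtype.ext h)]; simp

lemma meanWeight_reduced {V : Type*} [Fintype V] (c : ℝ) (y : V → ℝ) (e : V → ℕ) {l : V}
    (hl : e l = 0) {k : {v : V // v ≠ l}} (hk : 1 ≤ e k) :
    meanWeight c (fun v : {v : V // v ≠ l} => y v) (fun v => e v - if v = k then 1 else 0) =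
      c / (∑ j, (e j : ℝ) - 1) * (∑ j, (e j : ℝ) * (y j * (∑ i, y i - y j)) -
        y l * ∑ j, (e j : ℝ) * y j - y k * (∑ i, y i - y l - y k)) := by
  have h1 := sum_reduced e (fun _ => 1) hl hk
  simp only [mul_one] at h1
  have h2 := sum_reduced e (fun v => y v * (∑ i, y i - y l - y v)) hl hk
  have h3 : ∑ v, (e v : ℝ) * (y v * (∑ i, y i - y l - y v)) =
      ∑ j, (e j : ℝ) * (y j * (∑ i, y i - y j)) - y l * ∑ j, (e j : ℝ) * y j := by
    rw [Finset.mul_sum, ← Finset.sum_sub_distrib]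
    exact Finset.sum_congr rfl fun v _ => by ring
  rw [meanWeight, h1, sum_real_subtype_ne, h2, h3]

/-- Algebraic identities and bounds for one step of the leaf-removal recursion. -/
lemma leaf_step_abs_le {c Δ q A B Y a b : ℝ} (hc : 0 ≤ c) (hq : 2 ≤ q) (ha : 0 ≤ a)
    (hb : 0 ≤ b) (hbΔ : b ≤ Δ) (hA0 : 0 ≤ A) (hA : A ≤ q * (Δ * Y)) (hB0 : 0 ≤ B)
    (hB : B ≤ q * Δ) (hab : a + b ≤ Y) :
    |c * (a * b) + c / (q - 1) * (A - a * B - b * (Y - a - b)) - c / q * A| ≤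
      c * Δ * (2 * a + Y / (q - 1)) := by
  have hq1 : 0 < q - 1 := by linarith
  have hq0 : 0 < q := by linarith
  have hΔ : 0 ≤ Δ := hb.trans hbΔ
  have e1 : c * (a * b) + c / (q - 1) * (A - a * B - b * (Y - a - b)) - c / q * A =
      c * (a * (b - B / (q - 1)) + (A / q - b * (Y - a - b)) / (q - 1)) := by
    field_simp; ring
  have e2 : c * Δ * (2 * a + Y / (q - 1)) = c * (a * (2 * Δ) + (Δ * Y) / (q - 1)) := by
    field_simp
  rw [e1, e2, abs_mul, abs_of_nonneg hc]
  refine mul_le_mul_of_nonneg_left ((abs_add_le _ _).trans (add_le_add ?_ ?_)) hc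
  · rw [abs_mul, abs_of_nonneg ha]
    refine mul_le_mul_of_nonneg_left ?_ ha
    have h1 : B / (q - 1) ≤ 2 * Δ := by
      rw [div_le_iff₀ hq1]; nlinarith
    have h2 : 0 ≤ B / (q - 1) := by positivity
    rw [abs_le]; constructor <;> linarith
  · rw [abs_div, abs_of_pos hq1]
    refine div_le_div_of_nonneg_right ?_ hq1.le
    have h1 : A / q ≤ Δ * Y := by rw [div_le_iff₀ hq0]; linarith
    have h2 : 0 ≤ A / q := by positivity
    have h3 : b * (Y - a - b) ≤ Δ * Y := mul_le_mul hbΔ (by linarith) (by linarith) hΔ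
    have h4 : 0 ≤ b * (Y - a - b) := mul_nonneg hb (by linarith)
    rw [abs_le]; constructor <;> linarith

lemma leaf_step_mean {ι : Type*} [Fintype ι] {c q A B Y a : ℝ} {p y : ι → ℝ} (hq : 2 ≤ q)
    (hp : ∑ k, p k = 1) (hB : ∑ k, p k * y k = B / q)
    (hA : ∑ k, p k * (y k * (Y - y k)) = A / q) :
    ∑ k, p k * (c * (a * y k) + c / (q - 1) * (A - a * B - y k * (Y - a - y k))) = c / q * A := by
  have h : ∀ k, p k * (c * (a * y k) + c / (q - 1) * (A - a * B - y k * (Y - a - y k))) =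
      (c / (q - 1) * (A - a * B)) * p k + (c * a + c / (q - 1) * a) * (p k * y k) -
        c / (q - 1) * (p k * (y k * (Y - y k))) := fun k => by ring
  rw [Finset.sum_congr rfl fun k _ => h k, Finset.sum_sub_distrib, Finset.sum_add_distrib,
    ← Finset.mul_sum, ← Finset.mul_sum, ← Finset.mul_sum, hp, hB, hA]
  have hq1 : q - 1 ≠ 0 := by linarith
  have hq0 : q ≠ 0 := by linarith
  field_simp
  ring

end TreeSumInduction

section TreeSumMain

universe u

set_option maxHeartbeats 1000000 in
/-- Second-order estimate of the sum over the trees with given degrees. -/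
theorem treeSum_bounds {c Δ L : ℝ} {β : ℕ → ℝ} (hc : 0 ≤ c) (hΔ : 0 ≤ Δ)
    (hcΔ : 6 * (c * Δ ^ 2) ≤ 1)
    (hβ : ∀ i : ℕ, 4 ≤ i → ∀ s : ℝ, 0 ≤ s → s ≤ i * Δ → s ≤ L → (s / ((i : ℝ) - 3)) ^ 2 ≤ β i)
    (m : ℕ) : ∀ (V : Type u) [Fintype V], Fintype.card V = m + 3 → ∀ (y : V → ℝ) (e : V → ℕ),
      (∀ v, 0 ≤ y v) → (∀ v, y v ≤ Δ) → ∑ v, y v ≤ L → ∑ v, e v = m + 1 →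
      treeCount e * Real.exp (-meanWeight c y e) ≤ treeSum c y e ∧
      treeSum c y e ≤ treeCount e * Real.exp (-meanWeight c y e +
        2 * (c * Δ) ^ 2 * (4 * (Δ * ∑ v, y v) + ∑ i ∈ Finset.Ico 4 (m + 4), β i)) := by
  induction m with
  | zero =>
    intro V _ hV y e hy hyΔ hL he
    rw [treeSum_of_card_eq_three (by omega) c y e (by omega)]
    refine ⟨le_rfl, mul_le_mul_of_nonneg_left (Real.exp_le_exp.2 ?_) (treeCount_pos e).le⟩
    have : 0 ≤ ∑ v, y v := Finset.sum_nonneg fun v _ => hy v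
    simp only [zero_add, Finset.Ico_self, Finset.sum_empty, add_zero]
    have : 0 ≤ 2 * (c * Δ) ^ 2 * (4 * (Δ * ∑ v, y v)) := by positivity
    linarith
  | succ m ih =>
    intro V _ hV y e hy hyΔ hL he
    obtain ⟨l, hl⟩ := exists_excess_eq_zero e (by omega)
    rw [treeSum_eq_sum c y e hl (by omega)]
    set Y := ∑ v, y v with hY
    set q : ℝ := ∑ j, (e j : ℝ) with hqdef
    set A := ∑ j, (e j : ℝ) * (y j * (Y - y j)) with hA
    set B := ∑ j, (e j : ℝ) * y j with hB
    have hqm : q = m + 2 := by rw [hqdef, ← Nat.cast_sum, he]; push_cast; ring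
    have hq2 : 2 ≤ q := by rw [hqm]; linarith [(Nat.cast_nonneg m : (0 : ℝ) ≤ m)]
    have hq0 : 0 < q := by linarith
    have hY0 : 0 ≤ Y := Finset.sum_nonneg fun v _ => hy v
    have hyY : ∀ v, y v ≤ Y := fun v =>
      Finset.single_le_sum (fun v _ => hy v) (Finset.mem_univ v)
    have hA0 : 0 ≤ A := Finset.sum_nonneg fun v _ =>
      mul_nonneg (Nat.cast_nonneg _) (mul_nonneg (hy v) (sub_nonneg.2 (hyY v)))
    have hAle : A ≤ q * (Δ * Y) := by
      rw [hA, hqdef, Finset.sum_mul]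
      refine Finset.sum_le_sum fun v _ => mul_le_mul_of_nonneg_left ?_ (Nat.cast_nonneg _)
      exact mul_le_mul (hyΔ v) (by linarith [hy v]) (sub_nonneg.2 (hyY v)) hΔ
    have hB0 : 0 ≤ B := Finset.sum_nonneg fun v _ => mul_nonneg (Nat.cast_nonneg _) (hy v)
    have hBle : B ≤ q * Δ := by
      rw [hB, hqdef, Finset.sum_mul]
      exact Finset.sum_le_sum fun v _ => mul_le_mul_of_nonneg_left (hyΔ v) (Nat.cast_nonneg _)
    set D : {v : V // v ≠ l} → ℝ := fun k =>
      c * (y l * y k) + c / (q - 1) * (A - y l * B - y k * (Y - y l - y k)) with hD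
    set p : {v : V // v ≠ l} → ℝ := fun k => (e k : ℝ) / q with hpdef
    have hsum : ∀ g : V → ℝ, ∑ k, p k * g k = (∑ j, (e j : ℝ) * g j) / q := fun g => by
      rw [← sum_subtype_ne (fun j => (e j : ℝ) * g j) (l := l) (by simp [hl]), Finset.sum_div]
      exact Finset.sum_congr rfl fun k _ => by rw [hpdef]; ring
    have hp1 : ∑ k, p k = 1 := by
      have h := hsum fun _ => 1
      simp only [mul_one] at h
      rw [h, ← hqdef, div_self hq0.ne']
    have hmean : ∑ k, p k * D k = c / q * A :=
      leaf_step_mean (y := fun k : {v : V // v ≠ l} => y k) hq2 hp1 (hsum y)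
        (hsum fun j => y j * (Y - y j))
    have hmw : meanWeight c y e = c / q * A := rfl
    have hdev : ∀ k, |D k - c / q * A| ≤ c * Δ * (2 * y l + Y / (q - 1)) := fun k => by
      refine leaf_step_abs_le hc hq2 (hy l) (hy k) (hyΔ k) hA0 hAle hB0 hBle ?_
      have h := Finset.sum_le_sum_of_subset_of_nonneg
        (Finset.subset_univ ({l, (k : V)} : Finset V)) (f := y) fun v _ _ => hy v
      rwa [Finset.sum_pair k.2.symm] at h
    have hYcard : Y ≤ ((m + 4 : ℕ) : ℝ) * Δ := by
      have h := Finset.sum_le_card_nsmul Finset.univ y Δ fun v _ => hyΔ v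
      rw [Finset.card_univ, hV, nsmul_eq_mul] at h
      exact h
    have hβm : (Y / (q - 1)) ^ 2 ≤ β (m + 4) := by
      have h := hβ (m + 4) (by omega) Y hY0 hYcard hL
      rwa [show (((m + 4 : ℕ) : ℝ) - 3) = q - 1 by rw [hqm]; push_cast; ring] at h
    have hYq : Y / (q - 1) ≤ 4 * Δ := by
      rw [div_le_iff₀ (by linarith), hqm]
      push_cast at hYcard
      nlinarith [mul_nonneg (Nat.cast_nonneg m : (0 : ℝ) ≤ m) hΔ]
    have hr1 : c * Δ * (2 * y l + Y / (q - 1)) ≤ 1 := by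
      calc c * Δ * (2 * y l + Y / (q - 1)) ≤ c * Δ * (6 * Δ) :=
            mul_le_mul_of_nonneg_left (by linarith [hyΔ l]) (mul_nonneg hc hΔ)
        _ ≤ 1 := by linarith
    have hr2 : (c * Δ * (2 * y l + Y / (q - 1))) ^ 2 ≤
        2 * (c * Δ) ^ 2 * (4 * (Δ * y l) + β (m + 4)) := by
      rw [mul_pow]
      have h1 : (2 * y l + Y / (q - 1)) ^ 2 ≤ 2 * (4 * (Δ * y l) + β (m + 4)) := by
        have h2 : y l * y l ≤ Δ * y l := mul_le_mul_of_nonneg_right (hyΔ l) (hy l)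
        nlinarith [sq_nonneg (2 * y l - Y / (q - 1))]
      calc _ ≤ (c * Δ) ^ 2 * (2 * (4 * (Δ * y l) + β (m + 4))) :=
            mul_le_mul_of_nonneg_left h1 (sq_nonneg _)
        _ = _ := by ring
    obtain ⟨hlow, hup⟩ := exp_mean_bounds (fun k => by rw [hpdef]; positivity) hp1 hmean hdev hr1
    set U := 2 * (c * Δ) ^ 2 * (4 * (Δ * (Y - y l)) + ∑ i ∈ Finset.Ico 4 (m + 4), β i) with hU
    have hterm : ∀ k : {v : V // v ≠ l},
        treeCount e * (p k * Real.exp (-D k)) ≤ (if 1 ≤ e k then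
          Real.exp (-(c * (y l * y k))) * treeSum c (fun v : {v : V // v ≠ l} => y v)
            (fun v => e v - if v = k then 1 else 0) else 0) ∧
        (if 1 ≤ e k then
          Real.exp (-(c * (y l * y k))) * treeSum c (fun v : {v : V // v ≠ l} => y v)
            (fun v => e v - if v = k then 1 else 0) else 0) ≤
          treeCount e * (p k * Real.exp (-D k)) * Real.exp U := fun k => by
      by_cases hk : 1 ≤ e k
      · rw [if_pos hk]
        have hcard : Fintype.card {v : V // v ≠ l} = m + 3 := by rw [card_subtype_ne]; omega
        have hs := sum_nat_reduced e hl hk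
        obtain ⟨h1, h2⟩ := ih {v : V // v ≠ l} hcard (fun v => y v)
          (fun v => e v - if v = k then 1 else 0) (fun v => hy v) (fun v => hyΔ v)
          (by rw [sum_real_subtype_ne]; linarith [hy l]) (by omega)
        rw [sum_real_subtype_ne, ← hY, ← hU] at h2
        rw [treeCount_reduced e hl hk, meanWeight_reduced c y e hl hk] at h1 h2
        have hDk : -D k = -(c * (y l * y k)) +
            -(c / (q - 1) * (A - y l * B - y k * (Y - y l - y k))) := by rw [hD]; ring
        rw [hDk, Real.exp_add]
        rw [Real.exp_add] at h2
        have hE := (Real.exp_pos (-(c * (y l * y k)))).le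
        constructor
        · refine le_trans (le_of_eq ?_) (mul_le_mul_of_nonneg_left h1 hE)
          rw [hpdef]; ring
        · refine le_trans (mul_le_mul_of_nonneg_left h2 hE) (le_of_eq ?_)
          rw [hpdef]; ring
      · have h0 : p k = 0 := by rw [hpdef]; simp [show e k = 0 by omega]
        rw [if_neg hk, h0]; simp
    rw [hmw]
    constructor
    · calc treeCount e * Real.exp (-(c / q * A))
          ≤ treeCount e * ∑ k, p k * Real.exp (-D k) :=
            mul_le_mul_of_nonneg_left hlow (treeCount_pos e).le
        _ = ∑ k, treeCount e * (p k * Real.exp (-D k)) := Finset.mul_sum _ _ _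
        _ ≤ _ := Finset.sum_le_sum fun k _ => (hterm k).1
    · calc _ ≤ ∑ k, treeCount e * (p k * Real.exp (-D k)) * Real.exp U :=
            Finset.sum_le_sum fun k _ => (hterm k).2
        _ = treeCount e * ((∑ k, p k * Real.exp (-D k)) * Real.exp U) := by
            rw [← Finset.sum_mul, ← Finset.mul_sum]; ring
        _ ≤ treeCount e * Real.exp (-(c / q * A) + 2 * (c * Δ) ^ 2 *
              (4 * (Δ * Y) + ∑ i ∈ Finset.Ico 4 (m + 1 + 4), β i)) := by
            refine mul_le_mul_of_nonneg_left ?_ (treeCount_pos e).le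
            refine (mul_le_mul_of_nonneg_right hup (Real.exp_pos U).le).trans ?_
            rw [← Real.exp_add, Real.exp_le_exp, show m + 1 + 4 = (m + 4) + 1 by ring,
              Finset.sum_Ico_succ_top (by omega)]
            rw [hU]
            linarith

end TreeSumMain

section TreeSumEstimate

lemma treeSum_le_treeSum_zero {V : Type*} [Fintype V] {c : ℝ} (hc : 0 ≤ c) {y : V → ℝ}
    (hy : ∀ v, 0 ≤ y v) (e : V → ℕ) : treeSum c y e ≤ treeSum 0 y e := by
  refine Finset.sum_le_sum fun T _ => Real.exp_le_exp.2 ?_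
  have : 0 ≤ edgeWeight y T := Finset.sum_nonneg fun a _ => Finset.sum_nonneg fun b _ =>
    mul_nonneg (adjInd_nonneg T a b) (mul_nonneg (hy a) (hy b))
  have h : 0 ≤ c / 2 * edgeWeight y T := by positivity
  simpa using h

lemma sum_Ico_inv_le (m : ℕ) :
    ∑ i ∈ Finset.Ico 4 (m + 4), 1 / ((i : ℝ) - 3) ≤ 1 + Real.log m := by
  have h := harmonic_le_one_add_log m
  refine le_trans (le_of_eq ?_) h
  rw [harmonic, Finset.sum_Ico_eq_sum_range]
  push_cast
  refine Finset.sum_congr rfl fun i _ => ?_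
  rw [one_div]
  congr 1
  ring

lemma meanWeight_le {V : Type*} [Fintype V] {c Δ Y : ℝ} (hc : c = 1 / Y) {y : V → ℝ}
    {e : V → ℕ} (hy : ∀ v, 0 ≤ y v) (he : ∀ v, (e v : ℝ) ≤ Δ) (hY : ∑ v, y v = Y)
    (hY0 : 0 < Y) : meanWeight c y e ≤ Δ * Y / ∑ j, (e j : ℝ) := by
  rw [meanWeight, hY, hc]
  have h0 : 0 ≤ ∑ j, (e j : ℝ) := Finset.sum_nonneg fun j _ => Nat.cast_nonneg _
  have h1 : ∑ j, (e j : ℝ) * (y j * (Y - y j)) ≤ Δ * Y * Y := by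
    calc ∑ j, (e j : ℝ) * (y j * (Y - y j)) ≤ ∑ j, Δ * Y * y j := by
          refine Finset.sum_le_sum fun j _ => ?_
          have hyY : y j ≤ Y := hY ▸ Finset.single_le_sum (fun v _ => hy v) (Finset.mem_univ j)
          calc (e j : ℝ) * (y j * (Y - y j)) ≤ Δ * (y j * Y) :=
                mul_le_mul (he j) (mul_le_mul_of_nonneg_left (by linarith [hy j]) (hy j))
                  (mul_nonneg (hy j) (by linarith)) ((Nat.cast_nonneg _).trans (he j))
            _ = Δ * Y * y j := by ring
      _ = Δ * Y * Y := by rw [← Finset.mul_sum, hY]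
  rw [div_div, one_div_mul_eq_div, mul_comm Y, ← div_div, div_right_comm]
  refine div_le_div_of_nonneg_right ?_ h0
  rw [div_le_iff₀ hY0]
  exact h1

lemma abs_meanWeight_sub_le {n : ℕ} (hn : 4 ≤ n) {Δ Y : ℝ} {y : Fin n → ℝ}
    {e : Fin n → ℕ} (hy : ∀ v, 0 ≤ y v) (hyΔ : ∀ v, y v ≤ Δ) (he : ∑ v, e v = n - 2)
    (hY : ∑ v, y v = Y) (hY0 : 0 < Y) :
    |meanWeight (1 / Y) y e - 1 / n * ∑ j, (e j : ℝ) * y j| ≤ 2 * Δ / n + Δ ^ 2 / Y := by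
  have hn' : (4 : ℝ) ≤ n := by exact_mod_cast hn
  have hq : ∑ j, (e j : ℝ) = n - 2 := by
    rw [← Nat.cast_sum, he, Nat.cast_sub (by omega)]; norm_num
  have hq0 : (0 : ℝ) < n - 2 := by linarith
  have hΔ : 0 ≤ Δ := (hy ⟨0, by omega⟩).trans (hyΔ _)
  set B := ∑ j, (e j : ℝ) * y j with hB
  set S := ∑ j, (e j : ℝ) * y j ^ 2 with hS
  have hB0 : 0 ≤ B := Finset.sum_nonneg fun v _ => mul_nonneg (Nat.cast_nonneg _) (hy v)
  have hS0 : 0 ≤ S := Finset.sum_nonneg fun v _ => mul_nonneg (Nat.cast_nonneg _) (sq_nonneg _)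
  have hB1 : B ≤ (n - 2) * Δ := by
    rw [hB, ← hq, Finset.sum_mul]
    exact Finset.sum_le_sum fun v _ => mul_le_mul_of_nonneg_left (hyΔ v) (Nat.cast_nonneg _)
  have hS1 : S ≤ (n - 2) * Δ ^ 2 := by
    rw [hS, ← hq, Finset.sum_mul]
    exact Finset.sum_le_sum fun v _ => mul_le_mul_of_nonneg_left
      (pow_le_pow_left₀ (hy v) (hyΔ v) 2) (Nat.cast_nonneg _)
  have hA : ∑ j, (e j : ℝ) * (y j * (Y - y j)) = Y * B - S := by
    rw [hB, hS, Finset.mul_sum, ← Finset.sum_sub_distrib]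
    exact Finset.sum_congr rfl fun j _ => by ring
  have e1 : meanWeight (1 / Y) y e - 1 / n * B =
      2 * (B / (n - 2)) / n - S / (n - 2) / Y := by
    rw [meanWeight, hY, hq, hA]
    field_simp
    ring
  have h1 : B / (n - 2) ≤ Δ := by rw [div_le_iff₀ hq0]; linarith
  have h2 : S / (n - 2) ≤ Δ ^ 2 := by rw [div_le_iff₀ hq0]; linarith
  have h3 : 0 ≤ B / ((n : ℝ) - 2) := by positivity
  have h4 : 0 ≤ S / ((n : ℝ) - 2) := by positivity
  have h5 : 2 * (B / (n - 2)) / n ≤ 2 * Δ / n := by gcongr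
  have h6 : S / (n - 2) / Y ≤ Δ ^ 2 / Y := by gcongr
  have h7 : 0 ≤ 2 * (B / ((n : ℝ) - 2)) / n := by positivity
  have h8 : 0 ≤ S / ((n : ℝ) - 2) / Y := by positivity
  rw [e1, abs_le]
  constructor <;> linarith

lemma treeSum_upper_const {n : ℕ} (hn : 4 ≤ n) {Δ Y : ℝ} {y : Fin n → ℝ}
    {e : Fin n → ℕ} (hy : ∀ v, 0 ≤ y v) (hyΔ : ∀ v, y v ≤ Δ) (he : ∑ v, e v = n - 2)
    (hY : ∑ v, y v = Y) (hY0 : 0 < Y) (hΔY : 6 * Δ ^ 2 ≤ Y) :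
    treeCount e * Real.exp (-meanWeight (1 / Y) y e) ≤ treeSum (1 / Y) y e ∧
    treeSum (1 / Y) y e ≤ treeCount e * Real.exp (-meanWeight (1 / Y) y e +
      (8 * Δ ^ 3 / Y + 32 * (Δ ^ 4 * n / Y ^ 2))) := by
  have hΔ : 0 ≤ Δ := (hy ⟨0, by omega⟩).trans (hyΔ _)
  obtain ⟨m, rfl⟩ : ∃ m, n = m + 3 := ⟨n - 3, by omega⟩
  have hcΔ : 6 * (1 / Y * Δ ^ 2) ≤ 1 := by
    rw [one_div_mul_eq_div, ← mul_div_assoc, div_le_one hY0]; exact hΔY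
  have h := treeSum_bounds (L := Y) (β := fun _ => 16 * Δ ^ 2) (by positivity) hΔ hcΔ
    (fun i hi s hs hsi _ => by
      have hi' : (4 : ℝ) ≤ i := by exact_mod_cast hi
      have h1 : s / ((i : ℝ) - 3) ≤ 4 * Δ := by
        rw [div_le_iff₀ (by linarith)]; nlinarith
      calc (s / ((i : ℝ) - 3)) ^ 2 ≤ (4 * Δ) ^ 2 :=
            pow_le_pow_left₀ (div_nonneg hs (by linarith)) h1 2
        _ = 16 * Δ ^ 2 := by ring) m (Fin (m + 3)) (by simp) y e hy hyΔ hY.le (by omega)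
  refine ⟨h.1, h.2.trans (mul_le_mul_of_nonneg_left (Real.exp_le_exp.2 ?_) (treeCount_pos e).le)⟩
  rw [hY, Finset.sum_const, Nat.card_Ico, nsmul_eq_mul, Nat.add_sub_cancel]
  have e1 : 2 * (1 / Y * Δ) ^ 2 * (4 * (Δ * Y) + m * (16 * Δ ^ 2)) =
      8 * Δ ^ 3 / Y + 32 * (Δ ^ 4 * m / Y ^ 2) := by field_simp; ring
  rw [e1]
  have : Δ ^ 4 * m / Y ^ 2 ≤ Δ ^ 4 * ((m + 3 : ℕ) : ℝ) / Y ^ 2 := by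
    gcongr; omega
  linarith

lemma treeSum_upper_log {n : ℕ} (hn : 4 ≤ n) {Δ Y : ℝ} {y : Fin n → ℝ}
    {e : Fin n → ℕ} (hy : ∀ v, 0 ≤ y v) (hyΔ : ∀ v, y v ≤ Δ) (he : ∑ v, e v = n - 2)
    (hY : ∑ v, y v = Y) (hY0 : 0 < Y) (hΔY : 6 * Δ ^ 2 ≤ Y) :
    treeSum (1 / Y) y e ≤ treeCount e * Real.exp (-meanWeight (1 / Y) y e +
      (16 * Δ ^ 3 / Y + 8 * (Δ ^ 3 * Real.log n / Y))) := by
  have hΔ : 0 ≤ Δ := (hy ⟨0, by omega⟩).trans (hyΔ _)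
  obtain ⟨m, rfl⟩ : ∃ m, n = m + 3 := ⟨n - 3, by omega⟩
  have hcΔ : 6 * (1 / Y * Δ ^ 2) ≤ 1 := by
    rw [one_div_mul_eq_div, ← mul_div_assoc, div_le_one hY0]; exact hΔY
  have h := treeSum_bounds (L := Y) (β := fun i => 4 * Δ * Y * (1 / ((i : ℝ) - 3)))
    (by positivity) hΔ hcΔ
    (fun i hi s hs hsi hsY => by
      have hi' : (4 : ℝ) ≤ i := by exact_mod_cast hi
      have h0 : (0 : ℝ) < i - 3 := by linarith
      have h1 : s / ((i : ℝ) - 3) ≤ 4 * Δ := by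
        rw [div_le_iff₀ h0]; nlinarith
      calc (s / ((i : ℝ) - 3)) ^ 2 = s / ((i : ℝ) - 3) * (s / ((i : ℝ) - 3)) := sq _
        _ ≤ 4 * Δ * (Y / ((i : ℝ) - 3)) :=
            mul_le_mul h1 (div_le_div_of_nonneg_right hsY h0.le) (by positivity) (by positivity)
        _ = _ := by ring) m (Fin (m + 3)) (by simp) y e hy hyΔ hY.le (by omega)
  refine h.2.trans (mul_le_mul_of_nonneg_left (Real.exp_le_exp.2 ?_) (treeCount_pos e).le)
  rw [hY, ← Finset.mul_sum]
  have hlog : Real.log m ≤ Real.log ((m + 3 : ℕ) : ℝ) :=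
    Real.log_le_log (by exact_mod_cast (by omega : 0 < m)) (by exact_mod_cast (by omega))
  have h1 : ∑ i ∈ Finset.Ico 4 (m + 4), 1 / ((i : ℝ) - 3) ≤
      1 + Real.log ((m + 3 : ℕ) : ℝ) := (sum_Ico_inv_le m).trans (by linarith)
  have h2 : 2 * (1 / Y * Δ) ^ 2 * (4 * (Δ * Y) + 4 * Δ * Y *
      ∑ i ∈ Finset.Ico 4 (m + 4), 1 / ((i : ℝ) - 3)) ≤
      2 * (1 / Y * Δ) ^ 2 * (4 * (Δ * Y) + 4 * Δ * Y * (1 + Real.log ((m + 3 : ℕ) : ℝ))) := by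
    gcongr
  have e1 : 2 * (1 / Y * Δ) ^ 2 * (4 * (Δ * Y) + 4 * Δ * Y *
      (1 + Real.log ((m + 3 : ℕ) : ℝ))) =
      16 * Δ ^ 3 / Y + 8 * (Δ ^ 3 * Real.log ((m + 3 : ℕ) : ℝ) / Y) := by field_simp; ring
  linarith

lemma treeSum_le_treeCount {n : ℕ} (hn : 4 ≤ n) {Δ c : ℝ} (hc : 0 ≤ c) {y : Fin n → ℝ}
    {e : Fin n → ℕ} (hy : ∀ v, 0 ≤ y v) (hyΔ : ∀ v, y v ≤ Δ) (he : ∑ v, e v = n - 2) :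
    treeSum c y e ≤ treeCount e := by
  have hΔ : 0 ≤ Δ := (hy ⟨0, by omega⟩).trans (hyΔ _)
  obtain ⟨m, rfl⟩ : ∃ m, n = m + 3 := ⟨n - 3, by omega⟩
  refine (treeSum_le_treeSum_zero hc hy e).trans ?_
  have h := (treeSum_bounds (c := 0) (L := ∑ v, y v)
    (β := fun i : ℕ => ((∑ v, y v) / ((i : ℝ) - 3)) ^ 2) le_rfl hΔ (by simp)
    (fun i hi s hs _ hsL => by
      have hi' : (4 : ℝ) ≤ i := by exact_mod_cast hi
      have h0 : (0 : ℝ) < i - 3 := by linarith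
      gcongr) m (Fin (m + 3)) (by simp) y e hy hyΔ le_rfl (by omega)).2
  simpa [meanWeight] using h

set_option maxHeartbeats 1000000 in
/-- The weighted number of trees with given degrees, with the error term of the theorem. -/
theorem exists_treeSum_eq {n : ℕ} (hn : 4 ≤ n) {Δ t Y : ℝ} {y : Fin n → ℝ} {e : Fin n → ℕ}
    (hΔ : 3 ≤ Δ) (hy : ∀ v, 0 ≤ y v) (hyΔ : ∀ v, y v ≤ Δ) (heΔ : ∀ v, (e v : ℝ) ≤ Δ)
    (he : ∑ v, e v = n - 2) (hY : ∑ v, y v = Y) (hYt : Y = t * n + 2) (ht : Δ ^ 4 ≤ t * n)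
    (htΔ : t ≤ Δ) :
    ∃ E : ℝ, |E| ≤ 19 * (Δ ^ 4 / (t * n)) + 32 * min (Δ ^ 4 / (t ^ 2 * n))
        (min (Δ ^ 3 * Real.log n / (t * n)) (Δ * t)) ∧
      treeSum (1 / Y) y e = treeCount e * Real.exp (-(1 / n * ∑ j, (e j : ℝ) * y j) + E) := by
  have hn' : (4 : ℝ) ≤ n := by exact_mod_cast hn
  have hn0 : (0 : ℝ) < n := by linarith
  have hΔ0 : 0 < Δ := by linarith
  have h9 : 9 * Δ ^ 2 ≤ Δ ^ 4 := by
    have : (3 : ℝ) ^ 2 ≤ Δ ^ 2 := pow_le_pow_left₀ (by norm_num) hΔ 2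
    calc 9 * Δ ^ 2 ≤ Δ ^ 2 * Δ ^ 2 := mul_le_mul_of_nonneg_right (by linarith) (sq_nonneg Δ)
      _ = Δ ^ 4 := by ring
  have h81 : 81 ≤ t * n := by
    have : (3 : ℝ) ^ 4 ≤ Δ ^ 4 := pow_le_pow_left₀ (by norm_num) hΔ 4
    linarith
  have h6 : 6 * Δ ^ 2 ≤ Y := by linarith [sq_nonneg Δ]
  have hW : 0 < t * n := by linarith
  have ht0 : 0 < t := pos_of_mul_pos_left hW hn0.le
  have hY0 : 0 < Y := by linarith
  have hWY : t * n ≤ Y := by linarith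
  obtain ⟨hlow, hup1⟩ := treeSum_upper_const hn hy hyΔ he hY hY0 h6
  have hup2 := treeSum_upper_log hn hy hyΔ he hY hY0 h6
  have hup3 := treeSum_le_treeCount (c := 1 / Y) hn (by positivity) hy hyΔ he
  have hq : ∑ j, (e j : ℝ) = n - 2 := by
    rw [← Nat.cast_sum, he, Nat.cast_sub (by omega)]; norm_num
  have hmw := meanWeight_le rfl hy heΔ hY hY0
  have hmd := abs_meanWeight_sub_le hn hy hyΔ he hY hY0
  rw [hq] at hmw
  set F := meanWeight (1 / Y) y e with hF
  set N := treeCount e with hN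
  have hN0 : 0 < N := treeCount_pos e
  have hZ0 : 0 < treeSum (1 / Y) y e := lt_of_lt_of_le (by positivity) hlow
  set G := Real.log (treeSum (1 / Y) y e / N) + F with hG
  have hexp : treeSum (1 / Y) y e = N * Real.exp (-F + G) := by
    rw [hG, show -F + (Real.log (treeSum (1 / Y) y e / N) + F) =
      Real.log (treeSum (1 / Y) y e / N) by ring, Real.exp_log (by positivity)]
    field_simp
  rw [hexp] at hlow hup1 hup2 hup3
  have hG0 : 0 ≤ G := by
    have := Real.exp_le_exp.1 (le_of_mul_le_mul_left hlow hN0); linarith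
  have hG1 := Real.exp_le_exp.1 (le_of_mul_le_mul_left hup1 hN0)
  have hG2 := Real.exp_le_exp.1 (le_of_mul_le_mul_left hup2 hN0)
  have hG3 : -F + G ≤ 0 := by
    rw [← Real.exp_le_one_iff]
    exact le_of_mul_le_mul_left (by linarith) hN0
  have hΔ34 : Δ ^ 3 ≤ Δ ^ 4 := pow_le_pow_right₀ (by linarith) (by norm_num)
  have hΔ24 : Δ ^ 2 ≤ Δ ^ 4 := pow_le_pow_right₀ (by linarith) (by norm_num)
  have b3 : Δ ^ 3 / Y ≤ Δ ^ 4 / (t * n) := by gcongr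
  have b2 : Δ ^ 2 / Y ≤ Δ ^ 4 / (t * n) := by gcongr
  have b1 : Δ / n ≤ Δ ^ 4 / (t * n) := by
    rw [div_le_div_iff₀ hn0 hW]
    have h1 : Δ * t ≤ Δ ^ 4 := by
      calc Δ * t ≤ Δ * Δ := by gcongr
        _ = Δ ^ 2 := by ring
        _ ≤ Δ ^ 4 := hΔ24
    calc Δ * (t * n) = Δ * t * n := by ring
      _ ≤ Δ ^ 4 * n := mul_le_mul_of_nonneg_right h1 hn0.le
  have hlog : 0 ≤ Real.log n := Real.log_nonneg (by linarith)
  have a1 : Δ ^ 4 * n / Y ^ 2 ≤ Δ ^ 4 / (t ^ 2 * n) := by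
    calc Δ ^ 4 * n / Y ^ 2 ≤ Δ ^ 4 * n / (t * n) ^ 2 := by gcongr
      _ = Δ ^ 4 / (t ^ 2 * n) := by field_simp
  have a2 : Δ ^ 3 * Real.log n / Y ≤ Δ ^ 3 * Real.log n / (t * n) := by gcongr
  have a3 : F ≤ 4 * (Δ * t) := by
    refine hmw.trans ?_
    rw [div_le_iff₀ (by linarith)]
    have h1 : Y ≤ 4 * t * (n - 2) := by 
      have h2 : t * 4 ≤ t * n := mul_le_mul_of_nonneg_left hn' ht0.le
      linarith
    calc Δ * Y ≤ Δ * (4 * t * (n - 2)) := mul_le_mul_of_nonneg_left h1 hΔ0.le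
      _ = _ := by ring
  have c1 : 8 * Δ ^ 3 / Y = 8 * (Δ ^ 3 / Y) := by ring
  have c2 : 16 * Δ ^ 3 / Y = 16 * (Δ ^ 3 / Y) := by ring
  have c3 : 2 * Δ / n = 2 * (Δ / n) := by ring
  have hP : 0 ≤ Δ ^ 4 / (t * n) := by positivity
  have d1 : 0 ≤ Δ ^ 4 / (t ^ 2 * n) := by positivity
  have d2 : 0 ≤ Δ ^ 3 * Real.log n / (t * n) := by positivity
  have d3 : 0 ≤ Δ * t := by positivity
  have hGmin : (G - 16 * (Δ ^ 4 / (t * n))) / 32 ≤ min (Δ ^ 4 / (t ^ 2 * n))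
      (min (Δ ^ 3 * Real.log n / (t * n)) (Δ * t)) := by
    refine le_min ?_ (le_min ?_ ?_)
    · linarith
    · linarith
    · linarith
  have hmin0 : 0 ≤ min (Δ ^ 4 / (t ^ 2 * n))
      (min (Δ ^ 3 * Real.log n / (t * n)) (Δ * t)) := le_min d1 (le_min d2 d3)
  refine ⟨G - (F - 1 / n * ∑ j, (e j : ℝ) * y j), ?_, ?_⟩
  · have h1 := abs_le.1 hmd
    rw [abs_le]
    constructor <;> linarith [h1.1, h1.2]
  · rw [hexp]; congr 2; ring

end TreeSumEstimate

section StirlingEstimates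

/-- The error term in Stirling's formula. -/
noncomputable def stirlingErr (k : ℕ) : ℝ :=
  Real.log k.factorial - (k * Real.log k - k + Real.log k / 2 + Real.log (2 * Real.pi) / 2)

lemma stirlingErr_eq {k : ℕ} (hk : k ≠ 0) :
    stirlingErr k = Real.log (Stirling.stirlingSeq k) - Real.log Real.pi / 2 := by
  have hk0 : (k : ℝ) ≠ 0 := by exact_mod_cast hk
  rw [stirlingErr, Stirling.log_stirlingSeq_formula, Real.log_div hk0 (Real.exp_pos 1).ne',
    Real.log_exp, Real.log_mul two_ne_zero hk0, Real.log_mul two_ne_zero Real.pi_ne_zero]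
  ring

lemma abs_stirlingErr_le {k : ℕ} (hk : k ≠ 0) : |stirlingErr k| ≤ 1 / (2 * k) := by
  obtain ⟨j, rfl⟩ := Nat.exists_eq_succ_of_ne_zero hk
  have hlow : 0 ≤ stirlingErr (j + 1) := by
    rw [stirlingErr]; exact sub_nonneg.2 (Stirling.le_log_factorial_stirling hk)
  rw [Nat.succ_eq_add_one, abs_of_nonneg hlow]
  have hmono : Monotone fun i : ℕ =>
      Real.log (Stirling.stirlingSeq (i + 1)) - 1 / (2 * ((i : ℝ) + 1)) := by
    refine monotone_nat_of_le_succ fun i => ?_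
    have h := Stirling.log_stirlingSeq_sdiff_le (i + 1)
    push_cast at h ⊢
    have h2 : 1 / (12 * ((i : ℝ) + 1) * ((i : ℝ) + 1 + 1)) ≤
        1 / (2 * ((i : ℝ) + 1)) - 1 / (2 * ((i : ℝ) + 1 + 1)) := by
      rw [div_sub_div _ _ (by positivity) (by positivity),
        div_le_div_iff₀ (by positivity) (by positivity)]
      have h3 : (0 : ℝ) ≤ ((i : ℝ) + 1) * ((i : ℝ) + 1 + 1) := by positivity
      linarith
    linarith
  have hlim : Filter.Tendsto (fun i : ℕ =>
      Real.log (Stirling.stirlingSeq (i + 1)) - 1 / (2 * ((i : ℝ) + 1))) Filter.atTop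
      (nhds (Real.log (Real.sqrt Real.pi) - 0)) := by
    refine Filter.Tendsto.sub ?_ ?_
    · exact (Filter.Tendsto.log Stirling.tendsto_stirlingSeq_sqrt_pi
        (Real.sqrt_ne_zero'.2 Real.pi_pos)).comp (Filter.tendsto_add_atTop_nat 1)
    · have h := (tendsto_one_div_add_atTop_nhds_zero_nat (𝕜 := ℝ)).const_mul (1 / 2)
      rw [mul_zero] at h
      refine h.congr fun i => ?_
      rw [one_div_mul_one_div]
  have h := hmono.ge_of_tendsto hlim j
  rw [Real.log_sqrt Real.pi_pos.le] at h
  rw [stirlingErr_eq hk]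
  push_cast
  linarith

lemma log_factorial_eq (k : ℕ) : Real.log k.factorial =
    k * Real.log k - k + Real.log k / 2 + Real.log (2 * Real.pi) / 2 + stirlingErr k := by
  rw [stirlingErr]; ring

/-- The logarithm of the double factorial `(2 * j - 1)!!`. -/
noncomputable def logOddFactorial (j : ℕ) : ℝ :=
  Real.log (2 * j).factorial - j * Real.log 2 - Real.log j.factorial

lemma logOddFactorial_succ (j : ℕ) :
    logOddFactorial (j + 1) = logOddFactorial j + Real.log (2 * j + 1) := by
  have h1 : ((2 * (j + 1)).factorial : ℝ) = 2 * ((j : ℝ) + 1) * ((2 * j + 1) *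
      ((2 * j).factorial : ℝ)) := by
    rw [show 2 * (j + 1) = 2 * j + 1 + 1 by ring, Nat.factorial_succ, Nat.factorial_succ]
    push_cast; ring
  have h2 : ((2 * j).factorial : ℝ) ≠ 0 := by exact_mod_cast Nat.factorial_ne_zero _
  have h3 : (j.factorial : ℝ) ≠ 0 := by exact_mod_cast Nat.factorial_ne_zero _
  have h4 : (j : ℝ) + 1 ≠ 0 := by positivity
  have h5 : 2 * (j : ℝ) + 1 ≠ 0 := by positivity
  rw [logOddFactorial, logOddFactorial, h1, Nat.factorial_succ]
  push_cast
  rw [Real.log_mul (by positivity) (by positivity), Real.log_mul two_ne_zero h4,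
    Real.log_mul h5 h2, Real.log_mul h4 h3]
  ring

lemma sum_log_odd (b k : ℕ) :
    ∑ i ∈ Finset.range k, Real.log (2 * ((b + k : ℕ) : ℝ) - 1 - 2 * i) =
      logOddFactorial (b + k) - logOddFactorial b := by
  induction k with
  | zero => simp
  | succ k ih =>
    rw [Finset.sum_range_succ', ← add_assoc, logOddFactorial_succ]
    have h : ∀ i ∈ Finset.range k, Real.log (2 * ((b + k + 1 : ℕ) : ℝ) - 1 - 2 * ((i + 1 : ℕ) : ℝ)) =
        Real.log (2 * ((b + k : ℕ) : ℝ) - 1 - 2 * i) := fun i _ => by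
      congr 1; push_cast; ring
    rw [Finset.sum_congr rfl h, ih]
    have h2 : 2 * ((b + k + 1 : ℕ) : ℝ) - 1 - 2 * ((0 : ℕ) : ℝ) = 2 * ((b + k : ℕ) : ℝ) + 1 := by
      push_cast; ring
    rw [h2]; ring

/-- The asymptotics of the product of the multinomial, double factorial and binomial terms. -/
lemma abs_log_prefactor_le {n b : ℕ} (hn : 2 ≤ n) (hb : 1 ≤ b) {d : ℝ}
    (hd : d * n = 2 * n + 2 * b) :
    |Real.log (n - 2).factorial -
        ∑ i ∈ Finset.range (n - 1), Real.log (2 * ((n + b : ℕ) : ℝ) - 1 - 2 * i) +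
        Real.log (Nat.choose (n + 2 * b) (n - 2)) -
      (Real.log (d - 1) / 2 - 3 / 2 * Real.log (d - 2) - Real.log n +
        n * ((d - 1) * Real.log (d - 1) - d / 2 * Real.log d - (d / 2 - 1) * Real.log (d - 2)))| ≤
      3 / b := by
  have hn0 : (0 : ℝ) < n := by exact_mod_cast (by omega : 0 < n)
  have hb0 : (0 : ℝ) < b := by exact_mod_cast hb
  have hd2 : d - 2 = 2 * b / n := by field_simp; linarith
  have hd2' : 0 < d - 2 := by rw [hd2]; positivity
  have hd1 : 0 < d - 1 := by linarith
  have hd0 : 0 < d := by linarith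
  have hchoose : Real.log (Nat.choose (n + 2 * b) (n - 2)) =
      Real.log (n + 2 * b).factorial - Real.log (n - 2).factorial -
        Real.log (2 * (b + 1)).factorial := by
    have h := Nat.choose_mul_factorial_mul_factorial (show n - 2 ≤ n + 2 * b by omega)
    rw [show n + 2 * b - (n - 2) = 2 * (b + 1) by omega] at h
    have hc : ((n + 2 * b).choose (n - 2) : ℝ) ≠ 0 := by
      exact_mod_cast (Nat.choose_pos (by omega)).ne'
    have h1 : ((n - 2).factorial : ℝ) ≠ 0 := by exact_mod_cast Nat.factorial_ne_zero _
    have h2 : ((2 * (b + 1)).factorial : ℝ) ≠ 0 := by exact_mod_cast Nat.factorial_ne_zero _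
    rw [← h]
    push_cast
    rw [Real.log_mul (mul_ne_zero hc h1) h2, Real.log_mul hc h1]
    ring
  have hsum := sum_log_odd (b + 1) (n - 1)
  rw [show b + 1 + (n - 1) = n + b by omega] at hsum
  have hfac : Real.log (b + 1).factorial = Real.log (b + 1) + Real.log b.factorial := by
    have h1 : (b.factorial : ℝ) ≠ 0 := by exact_mod_cast Nat.factorial_ne_zero _
    rw [Nat.factorial_succ]; push_cast
    rw [Real.log_mul (by positivity) h1]
  have lu : Real.log ((n + 2 * b : ℕ) : ℝ) = Real.log (d - 1) + Real.log n := by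
    rw [← Real.log_mul hd1.ne' hn0.ne']; congr 1; push_cast; linarith
  have ls2 : Real.log ((2 * (n + b) : ℕ) : ℝ) = Real.log d + Real.log n := by
    rw [← Real.log_mul hd0.ne' hn0.ne']; congr 1; push_cast; linarith
  have ls : Real.log ((n + b : ℕ) : ℝ) = Real.log d + Real.log n - Real.log 2 := by
    rw [← ls2]; push_cast
    rw [Real.log_mul two_ne_zero (by positivity)]; ring
  have lb : Real.log (b : ℝ) = Real.log (d - 2) + Real.log n - Real.log 2 := by
    rw [hd2, Real.log_div (by positivity) hn0.ne', Real.log_mul two_ne_zero hb0.ne']; ring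
  have key : Real.log (n - 2).factorial -
        ∑ i ∈ Finset.range (n - 1), Real.log (2 * ((n + b : ℕ) : ℝ) - 1 - 2 * i) +
        Real.log (Nat.choose (n + 2 * b) (n - 2)) -
      (Real.log (d - 1) / 2 - 3 / 2 * Real.log (d - 2) - Real.log n +
        n * ((d - 1) * Real.log (d - 1) - d / 2 * Real.log d - (d / 2 - 1) * Real.log (d - 2))) =
      stirlingErr (n + 2 * b) + stirlingErr (n + b) - stirlingErr (2 * (n + b)) - stirlingErr b -
        (Real.log (b + 1) - Real.log b) := by
    have hdb : (b : ℝ) = (d - 2) * n / 2 := by linarith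
    rw [hsum, hchoose, logOddFactorial, logOddFactorial, hfac, log_factorial_eq (n + 2 * b),
      log_factorial_eq (n + b), log_factorial_eq (2 * (n + b)), log_factorial_eq b, lu, ls, ls2, lb]
    push_cast
    rw [hdb]
    ring
  have mono : ∀ k : ℕ, b ≤ k → |stirlingErr k| ≤ 1 / (2 * b) := fun k hk => by
    have hk' : (b : ℝ) ≤ k := by exact_mod_cast hk
    refine (abs_stirlingErr_le (by omega)).trans ?_
    gcongr
  have m1 := abs_le.1 (mono (n + 2 * b) (by omega))
  have m2 := abs_le.1 (mono (n + b) (by omega))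
  have m3 := abs_le.1 (mono (2 * (n + b)) (by omega))
  have m4 := abs_le.1 (mono b le_rfl)
  have hl0 : 0 ≤ Real.log (b + 1) - Real.log b :=
    sub_nonneg.2 (Real.log_le_log hb0 (by linarith))
  have hl1 : Real.log (b + 1) - Real.log b ≤ 1 / b := by
    rw [← Real.log_div (by positivity) hb0.ne']
    refine (Real.log_le_sub_one_of_pos (by positivity)).trans (le_of_eq ?_)
    field_simp; ring
  have e1 : 1 / (2 * (b : ℝ)) = 1 / b / 2 := by field_simp
  have e2 : 3 / (b : ℝ) = 3 * (1 / b) := by ring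
  rw [e1] at m1 m2 m3 m4
  have hpos : 0 < 1 / (b : ℝ) := by positivity
  rw [key, e2, abs_le]
  constructor <;> linarith [m1.1, m1.2, m2.1, m2.2, m3.1, m3.2, m4.1, m4.2]

end StirlingEstimates

section DoubleCounting

variable {V : Type*} [Fintype V]

lemma sum_adjInd_sdiff {G T : SimpleGraph V} (h : T ≤ G) (v : V) :
    ∑ b, adjInd (G \ T) v b = ∑ b, adjInd G v b - ∑ b, adjInd T v b := by
  rw [← Finset.sum_sub_distrib]
  refine Finset.sum_congr rfl fun b _ => ?_
  by_cases hT : T.Adj v b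
  · rw [adjInd_of_adj hT, adjInd_of_adj (h hT), adjInd_of_not_adj (by simp [hT])]; ring
  · by_cases hG : G.Adj v b
    · rw [adjInd_of_adj hG, adjInd_of_not_adj hT, adjInd_of_adj (by simp [hT, hG])]; ring
    · rw [adjInd_of_not_adj hG, adjInd_of_not_adj hT, adjInd_of_not_adj (by simp [hG])]; ring

/-- The graphs with degrees `d` containing `T` correspond to the realizations of the residual
degrees avoiding `T`. -/
lemma card_filter_le_eq_numReal (d : V → ℕ) (T : SimpleGraph V) :
    ((Finset.univ.filter fun G : SimpleGraph V => T ≤ G ∧ ∀ j, G.degree j = d j).card : ℝ) =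
      numReal (residDeg d T) T := by
  rw [numReal, Nat.cast_inj]
  refine Finset.card_bij' (fun G _ => G \ T) (fun H _ => H ⊔ T) ?_ ?_ ?_ ?_
  · intro G hG
    simp only [Finset.mem_filter, Finset.mem_univ, true_and] at hG
    refine mem_realizations.2 ⟨fun a b hab => ?_, fun v => ?_⟩
    · rw [SimpleGraph.sdiff_adj] at hab; exact hab.2
    · rw [sum_adjInd_sdiff hG.1, residDeg, sum_adjInd G, hG.2]
  · intro H hH
    obtain ⟨h1, h2⟩ := mem_realizations.1 hH
    simp only [Finset.mem_filter, Finset.mem_univ, true_and]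
    refine ⟨le_sup_right, fun j => ?_⟩
    have hsd : (H ⊔ T) \ T = H := by
      ext a b
      simp only [SimpleGraph.sdiff_adj, SimpleGraph.sup_adj]
      exact ⟨fun h => h.1.resolve_right h.2, fun h => ⟨Or.inl h, h1 a b h⟩⟩
    have h3 := sum_adjInd_sdiff (le_sup_right : T ≤ H ⊔ T) j
    rw [hsd, h2, residDeg] at h3
    rw [← Nat.cast_inj (R := ℝ), ← sum_adjInd]
    linarith
  · intro G hG
    simp only [Finset.mem_filter, Finset.mem_univ, true_and] at hG
    exact sdiff_sup_cancel hG.1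
  · intro H hH
    obtain ⟨h1, -⟩ := mem_realizations.1 hH
    ext a b
    simp only [SimpleGraph.sdiff_adj, SimpleGraph.sup_adj]
    exact ⟨fun h => h.1.resolve_right h.2, fun h => ⟨Or.inl h, h1 a b h⟩⟩

lemma mem_treesWith_iff_isTree {x : V → ℕ} (hx : ∀ j, 1 ≤ x j)
    (hsum : ∑ j, x j + 2 = 2 * Fintype.card V) (T : SimpleGraph V) :
    T ∈ treesWith (fun j => x j - 1) ↔ T.IsTree ∧ ∀ j, T.degree j = x j := by
  have hdeg : ∀ j, (∑ b, adjInd T j b = ((x j - 1 : ℕ) : ℝ) + 1) ↔ T.degree j = x j := fun j => by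
    rw [sum_adjInd, Nat.cast_sub (hx j), Nat.cast_one, sub_add_cancel, Nat.cast_inj]
  rw [mem_treesWith, forall_congr' hdeg, SimpleGraph.isTree_iff_connected_and_card]
  constructor
  · rintro ⟨hc, hd⟩
    refine ⟨⟨hc, ?_⟩, hd⟩
    have h := T.sum_degrees_eq_twice_card_edges
    have hs : ∑ j, T.degree j = ∑ j, x j := Finset.sum_congr rfl fun j _ => hd j
    rw [SimpleGraph.edgeFinset_card, ← Nat.card_eq_fintype_card] at h
    rw [Nat.card_eq_fintype_card (α := V)]
    omega
  · rintro ⟨⟨hc, -⟩, hd⟩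
    exact ⟨hc, hd⟩

end DoubleCounting

section Assembly

lemma numReal_bot_eq_card {n : ℕ} (d : Fin n → ℕ) :
    numReal (fun j => (d j : ℝ)) (⊥ : SimpleGraph (Fin n)) =
      ((Finset.univ.filter fun G : SimpleGraph (Fin n) => ∀ j, G.degree j = d j).card : ℝ) := by
  rw [numReal]
  congr 2
  ext G
  simp [mem_realizations, sum_adjInd]

lemma sum_spanningTreeCount_eq {n : ℕ} {x : Fin n → ℕ} (hx : ∀ j, 1 ≤ x j)
    (hsum : ∑ j, x j + 2 = 2 * n) (d : Fin n → ℕ) :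
    ∑ G ∈ Finset.univ.filter (fun G : SimpleGraph (Fin n) => ∀ j, G.degree j = d j),
      (spanningTreeCountWithDegrees G x : ℝ) =
    ∑ T ∈ treesWith (fun j => x j - 1), numReal (residDeg d T) T := by
  have h := Finset.sum_card_bipartiteAbove_eq_sum_card_bipartiteBelow
    (s := Finset.univ.filter fun G : SimpleGraph (Fin n) => ∀ j, G.degree j = d j)
    (t := treesWith fun j => x j - 1) (fun G T : SimpleGraph (Fin n) => T ≤ G)
  have h' := congrArg (fun k : ℕ => (k : ℝ)) h
  simp only [Nat.cast_sum] at h'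
  refine Eq.trans (Finset.sum_congr rfl fun G _ => ?_)
    (h'.trans (Finset.sum_congr rfl fun T _ => ?_))
  · rw [spanningTreeCountWithDegrees, Nat.cast_inj]
    congr 1
    ext T
    simp only [Finset.mem_filter, Finset.mem_univ, true_and, Finset.bipartiteAbove,
      mem_treesWith_iff_isTree hx (by simpa using hsum)]
    tauto
  · rw [← card_filter_le_eq_numReal, Nat.cast_inj]
    congr 1
    ext G
    simp only [Finset.mem_filter, Finset.mem_univ, true_and, Finset.bipartiteBelow]
    tauto

/-- Termwise closeness of logarithms passes to sums. -/
lemma exists_sum_eq_exp_mul_sum {ι : Type*} {s : Finset ι} {a b : ι → ℝ} {ε : ℝ}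
    (hs : 0 < ∑ i ∈ s, b i) (ha : ∀ i ∈ s, 0 < a i) (hb : ∀ i ∈ s, 0 < b i)
    (h : ∀ i ∈ s, |Real.log (a i) - Real.log (b i)| ≤ ε) :
    ∃ E : ℝ, |E| ≤ ε ∧ ∑ i ∈ s, a i = Real.exp E * ∑ i ∈ s, b i := by
  have hterm : ∀ i ∈ s, Real.exp (-ε) * b i ≤ a i ∧ a i ≤ Real.exp ε * b i := fun i hi => by
    obtain ⟨h1, h2⟩ := abs_le.1 (h i hi)
    have hai := Real.exp_log (ha i hi)
    have hbi := Real.exp_log (hb i hi)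
    constructor
    · rw [← hai, ← hbi, ← Real.exp_add, Real.exp_le_exp]; linarith
    · rw [← hai, ← hbi, ← Real.exp_add, Real.exp_le_exp]; linarith
  have hlow : Real.exp (-ε) * ∑ i ∈ s, b i ≤ ∑ i ∈ s, a i := by
    rw [Finset.mul_sum]; exact Finset.sum_le_sum fun i hi => (hterm i hi).1
  have hup : ∑ i ∈ s, a i ≤ Real.exp ε * ∑ i ∈ s, b i := by
    rw [Finset.mul_sum]; exact Finset.sum_le_sum fun i hi => (hterm i hi).2
  have hpos : 0 < ∑ i ∈ s, a i := lt_of_lt_of_le (mul_pos (Real.exp_pos _) hs) hlow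
  have hq : 0 < (∑ i ∈ s, a i) / ∑ i ∈ s, b i := div_pos hpos hs
  refine ⟨Real.log ((∑ i ∈ s, a i) / ∑ i ∈ s, b i), ?_, ?_⟩
  · rw [abs_le, Real.le_log_iff_exp_le hq, Real.log_le_iff_le_exp hq, le_div_iff₀ hs,
      div_le_iff₀ hs]
    exact ⟨hlow, hup⟩
  · rw [Real.exp_log hq, div_mul_cancel₀ _ hs.ne']

lemma fallTwo_natCast_sub {n : ℕ} {d x : Fin n → ℕ} (hxd : ∀ j, x j ≤ d j) :
    fallTwo (fun j => (d j : ℝ) - x j) = ∑ j, (Nat.descFactorial (d j - x j) 2 : ℝ) := by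
  refine Finset.sum_congr rfl fun j _ => ?_
  rw [Nat.descFactorial_succ, Nat.descFactorial_one]
  dsimp only
  rw [← Nat.cast_sub (hxd j)]
  rcases Nat.eq_zero_or_pos (d j - x j) with h | h
  · rw [h]; simp
  · rw [Nat.cast_mul, Nat.cast_sub h]; push_cast; ring

lemma corr_bot_eq {n : ℕ} (hn : 0 < n) {d : Fin n → ℕ} {davg R : ℝ}
    (hdavg : davg = (∑ j, (d j : ℝ)) / n) (hpos : 0 < davg)
    (hR : R = (∑ j, ((d j : ℝ) - davg) ^ 2) / n) :
    -corr (fun j => (d j : ℝ)) (⊥ : SimpleGraph (Fin n)) =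
      (R + davg ^ 2) ^ 2 / (4 * davg ^ 2) - 1 / 4 := by
  have hn0 : (n : ℝ) ≠ 0 := by exact_mod_cast hn.ne'
  have hM : ∑ j, (d j : ℝ) = davg * n := by rw [hdavg]; field_simp
  have hsq : ∑ j, ((d j : ℝ) - davg) ^ 2 = ∑ j, (d j : ℝ) ^ 2 - davg ^ 2 * n := by
    have h : ∀ j, ((d j : ℝ) - davg) ^ 2 = (d j : ℝ) ^ 2 - 2 * davg * d j + davg ^ 2 :=
      fun j => by ring
    rw [Finset.sum_congr rfl fun j _ => h j, Finset.sum_add_distrib, Finset.sum_sub_distrib,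
      ← Finset.mul_sum, hM, Finset.sum_const, Finset.card_univ, Fintype.card_fin, nsmul_eq_mul]
    ring
  have hfall : fallTwo (fun j => (d j : ℝ)) = (R + davg ^ 2) * n - davg * n := by
    rw [hR, hsq, fallTwo, ← hM, div_add' _ _ _ hn0, div_mul_cancel₀ _ hn0, sub_add_cancel,
      ← Finset.sum_sub_distrib]
    exact Finset.sum_congr rfl fun j _ => by ring
  have hew : edgeWeight (fun j => (d j : ℝ)) (⊥ : SimpleGraph (Fin n)) = 0 := by
    simp [edgeWeight, adjInd]
  rw [corr, hM, hfall, hew]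
  field_simp
  ring

lemma log_descFactorial_eq {d x : ℕ} (hx : 1 ≤ x) (hxd : x ≤ d) :
    Real.log (d.descFactorial x) = Real.log d + Real.log ((x - 1).factorial) +
      Real.log (Nat.choose (d - 1) (x - 1)) := by
  obtain ⟨x, rfl⟩ : ∃ k, x = k + 1 := ⟨x - 1, by omega⟩
  obtain ⟨d, rfl⟩ : ∃ k, d = k + 1 := ⟨d - 1, by omega⟩
  have h1 : ((d + 1 : ℕ) : ℝ) ≠ 0 := by exact_mod_cast Nat.succ_ne_zero d
  have h2 : (x.factorial : ℝ) ≠ 0 := by exact_mod_cast Nat.factorial_ne_zero x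
  have h3 : (d.choose x : ℝ) ≠ 0 := by exact_mod_cast (Nat.choose_pos (by omega)).ne'
  rw [Nat.succ_descFactorial_succ, Nat.descFactorial_eq_factorial_mul_choose, Nat.cast_mul,
    Nat.cast_mul, Real.log_mul h1 (mul_ne_zero h2 h3), Real.log_mul h2 h3]
  simp only [Nat.add_sub_cancel]
  ring

lemma log_treeCount {n : ℕ} (e : Fin n → ℕ) :
    Real.log (treeCount e) =
      Real.log ((∑ j, e j).factorial) - ∑ j, Real.log ((e j).factorial) := by
  have h : ∀ j, ((e j).factorial : ℝ) ≠ 0 := fun j => by exact_mod_cast Nat.factorial_ne_zero _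
  rw [treeCount, Real.log_div (by exact_mod_cast Nat.factorial_ne_zero _)
    (Finset.prod_ne_zero_iff.2 fun j _ => h j), Real.log_prod fun j _ => h j]

lemma log_leading_term {n : ℕ} (hn : 0 < n) {d : Fin n → ℕ} (hd : ∀ j, 1 ≤ d j)
    {davg dhat : ℝ} (hdhat : dhat = (∏ j, (d j : ℝ)) ^ ((1 : ℝ) / n)) (h2 : 0 < davg - 2) :
    0 < Real.sqrt (davg - 1) / ((davg - 2) ^ ((3 : ℝ) / 2) * n) *
        (dhat * (davg - 1) ^ (davg - 1) /
          (davg ^ (davg / 2) * (davg - 2) ^ (davg / 2 - 1))) ^ (n : ℝ) ∧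
    Real.log (Real.sqrt (davg - 1) / ((davg - 2) ^ ((3 : ℝ) / 2) * n) *
        (dhat * (davg - 1) ^ (davg - 1) /
          (davg ^ (davg / 2) * (davg - 2) ^ (davg / 2 - 1))) ^ (n : ℝ)) =
      ∑ j, Real.log (d j) + (Real.log (davg - 1) / 2 - 3 / 2 * Real.log (davg - 2) - Real.log n +
        n * ((davg - 1) * Real.log (davg - 1) - davg / 2 * Real.log davg -
          (davg / 2 - 1) * Real.log (davg - 2))) := by
  have hn0 : (0 : ℝ) < n := by exact_mod_cast hn
  have h1 : 0 < davg - 1 := by linarith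
  have h0 : 0 < davg := by linarith
  have hdj : ∀ j, (0 : ℝ) < d j := fun j => by exact_mod_cast hd j
  have hprod : 0 < ∏ j, (d j : ℝ) := Finset.prod_pos fun j _ => hdj j
  have hdh : 0 < dhat := hdhat ▸ Real.rpow_pos_of_pos hprod _
  have hs : 0 < Real.sqrt (davg - 1) := Real.sqrt_pos.2 h1
  have p1 := Real.rpow_pos_of_pos h2 ((3 : ℝ) / 2)
  have p2 := Real.rpow_pos_of_pos h1 (davg - 1)
  have p3 := Real.rpow_pos_of_pos h0 (davg / 2)
  have p4 := Real.rpow_pos_of_pos h2 (davg / 2 - 1)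
  have q1 : 0 < dhat * (davg - 1) ^ (davg - 1) /
      (davg ^ (davg / 2) * (davg - 2) ^ (davg / 2 - 1)) := by positivity
  have q2 := Real.rpow_pos_of_pos q1 (n : ℝ)
  have hlogdh : n * Real.log dhat = ∑ j, Real.log (d j) := by
    rw [hdhat, Real.log_rpow hprod, Real.log_prod fun j _ => (hdj j).ne']
    field_simp
  refine ⟨by positivity, ?_⟩
  rw [Real.log_mul (by positivity) q2.ne', Real.log_div hs.ne' (by positivity),
    Real.log_mul p1.ne' hn0.ne', Real.log_rpow q1, Real.log_div (by positivity) (by positivity),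
    Real.log_mul hdh.ne' p2.ne', Real.log_mul p3.ne' p4.ne', Real.log_rpow h1, Real.log_rpow h0,
    Real.log_rpow h2, Real.log_rpow h2, Real.log_sqrt h1.le, ← hlogdh]
  ring

end Assembly

section Final

set_option maxHeartbeats 1000000 in
/-- The expected number of spanning trees in terms of the weighted sum over trees. -/
lemma exists_expectation_eq_treeSum {n : ℕ} (hn : 4 ≤ n) {d x : Fin n → ℕ} {Δ Y : ℝ}
    (heven : Even (∑ j, d j)) (hx : ∀ j, 1 ≤ x j) (hxd : ∀ j, x j ≤ d j)
    (hsum : ∑ j, x j + 2 = 2 * n) (hΔ : 3 ≤ Δ) (hd : ∀ j, (d j : ℝ) ≤ Δ)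
    (hY : ∑ j, (d j : ℝ) = Y + 2 * ((n - 1 : ℕ) : ℝ)) (hYΔ : 9 * Δ ^ 2 + 2 ≤ Y)
    (hpos : 0 < treeSum (1 / Y) (fun j => (d j : ℝ) - x j) (fun j => x j - 1)) :
    ∃ E : ℝ, |E| ≤ 1350 * (Δ ^ 4 / Y) ∧
      (∑ T ∈ treesWith (fun j => x j - 1), numReal (residDeg d T) T) /
        numReal (fun j => (d j : ℝ)) (⊥ : SimpleGraph (Fin n)) =
      Real.exp (E + (∑ j, Real.log ((d j).descFactorial (x j)) -
        ∑ i ∈ Finset.range (n - 1), Real.log (∑ j, (d j : ℝ) - 1 - 2 * i) -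
        fallTwo (fun j => (d j : ℝ) - x j) / (2 * Y) -
        (fallTwo (fun j => (d j : ℝ) - x j) / (2 * Y)) ^ 2 -
        corr (fun j => (d j : ℝ)) (⊥ : SimpleGraph (Fin n)))) *
        treeSum (1 / Y) (fun j => (d j : ℝ) - x j) (fun j => x j - 1) := by
  have hn1 : (3 : ℝ) ≤ ((n - 1 : ℕ) : ℝ) := by exact_mod_cast (by omega : 3 ≤ n - 1)
  have hY0 : 0 < Y := by nlinarith
  have hN := numReal_bot_pos hΔ hd heven (by rw [hY]; linarith)
  set N₀ := numReal (fun j => (d j : ℝ)) (⊥ : SimpleGraph (Fin n)) with hN₀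
  set y : Fin n → ℝ := fun j => (d j : ℝ) - x j with hy
  set K := ∑ j, Real.log ((d j).descFactorial (x j)) -
        ∑ i ∈ Finset.range (n - 1), Real.log (∑ j, (d j : ℝ) - 1 - 2 * i) -
        fallTwo y / (2 * Y) - (fallTwo y / (2 * Y)) ^ 2 -
        corr (fun j => (d j : ℝ)) (⊥ : SimpleGraph (Fin n)) with hK
  have hxsum : ∑ j, (x j : ℝ) = 2 * ((n - 1 : ℕ) : ℝ) := by
    rw [← Nat.cast_sum, ← Nat.cast_two, ← Nat.cast_mul, Nat.cast_inj]; omega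
  have hysum : ∑ j, y j = Y := by
    rw [hy, Finset.sum_sub_distrib, hY, hxsum]; ring
  have hT : ∀ T ∈ treesWith (fun j => x j - 1), 0 < numReal (residDeg d T) T ∧
      |Real.log (numReal (residDeg d T) T) -
        Real.log (N₀ * Real.exp K * Real.exp (-(1 / Y / 2 * edgeWeight y T)))| ≤
          1350 * (Δ ^ 4 / Y) := fun T hTm => by
    have hadj : ∀ j, ∑ b, adjInd T j b = x j := fun j => by
      rw [(mem_treesWith.1 hTm).2 j, Nat.cast_sub (hx j)]; push_cast; ring
    have hdeg : ∀ j, T.degree j = x j := fun j => by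
      rw [← Nat.cast_inj (R := ℝ), ← sum_adjInd, hadj]
    have hres : residDeg d T = y := by funext j; rw [residDeg, hadj]
    obtain ⟨h1, h2⟩ := abs_log_numReal_residDeg_sub_le hΔ hd hN (n - 1) T
      (by rw [Finset.sum_congr rfl fun j _ => hadj j, hxsum])
      (fun j => by rw [hdeg]; exact hxd j) (by rw [hY]; linarith)
    refine ⟨h1, ?_⟩
    rw [hres] at h2 ⊢
    simp only [hdeg] at h2
    have hcorr : corr y T = -(fallTwo y / (2 * Y)) - (fallTwo y / (2 * Y)) ^ 2 -
        1 / Y / 2 * edgeWeight y T := by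
      rw [corr, hysum]; ring
    have hlog : Real.log (N₀ * Real.exp K * Real.exp (-(1 / Y / 2 * edgeWeight y T))) =
        Real.log N₀ + K - 1 / Y / 2 * edgeWeight y T := by
      rw [Real.log_mul (by positivity) (Real.exp_pos _).ne', Real.log_mul hN.ne'
        (Real.exp_pos _).ne', Real.log_exp, Real.log_exp]; ring
    have hbd : 1350 * Δ ^ 4 * (1 / (∑ j, (d j : ℝ) - 2 * ((n - 1 : ℕ) : ℝ)) -
        1 / ∑ j, (d j : ℝ)) ≤ 1350 * (Δ ^ 4 / Y) := by
      rw [hY, add_sub_cancel_right, ← mul_one_div (Δ ^ 4), ← mul_assoc]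
      refine mul_le_mul_of_nonneg_left ?_ (by positivity)
      have : 0 ≤ 1 / (Y + 2 * ((n - 1 : ℕ) : ℝ)) := by positivity
      linarith
    refine le_trans (le_of_eq ?_) (h2.trans hbd)
    rw [hlog, hcorr, hK]
    congr 1; ring
  obtain ⟨E, hE, heq⟩ := exists_sum_eq_exp_mul_sum
    (b := fun T => N₀ * Real.exp K * Real.exp (-(1 / Y / 2 * edgeWeight y T)))
    (by rw [← Finset.mul_sum]; exact mul_pos (by positivity) hpos)
    (fun T hTm => (hT T hTm).1) (fun T _ => by positivity) (fun T hTm => (hT T hTm).2)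
  refine ⟨E, hE, ?_⟩
  rw [heq, ← Finset.mul_sum, Real.exp_add, treeSum]
  field_simp

end Final

set_option maxHeartbeats 2000000 in
theorem expected_spanning_trees_with_given_degree_sequence :
    ∃ C : ℝ, 0 < C ∧ ∃ N₀ : ℕ, ∀ n : ℕ, N₀ ≤ n →
    ∀ dseq xseq : Fin n → ℕ,
      (∀ j, 1 ≤ dseq j) → Even (∑ j, dseq j) →
      -- `xseq` is a suitable degree sequence
      (∀ j, 1 ≤ xseq j) → (∀ j, xseq j ≤ dseq j) → (∑ j, xseq j) + 2 = 2 * n →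
      ∀ dmax davg dhat R Hd lamx : ℝ,
      dmax = (Finset.univ.sup dseq : ℕ) →
      davg = (∑ j, (dseq j : ℝ)) / n →
      dhat = (∏ j, (dseq j : ℝ)) ^ ((1 : ℝ) / n) →
      R = (∑ j, ((dseq j : ℝ) - davg) ^ 2) / n →
      Hd = Real.sqrt (davg - 1) / ((davg - 2) ^ ((3 : ℝ) / 2) * n) *
        (dhat * (davg - 1) ^ (davg - 1) /
          (davg ^ (davg / 2) * (davg - 2) ^ (davg / 2 - 1))) ^ (n : ℝ) →
      lamx = (∑ j, (Nat.descFactorial (dseq j - xseq j) 2 : ℝ)) /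
          (2 * ((davg - 2) * n) + 4) →
      dmax ^ 4 ≤ (davg - 2) * n →
      ∃ E : ℝ,
        |E| ≤ C * (dmax ^ 4 / ((davg - 2) * n) +
            min (dmax ^ 4 / ((davg - 2) ^ 2 * n))
              (min (dmax ^ 3 * Real.log n / ((davg - 2) * n)) (dmax * (davg - 2)))) ∧
        (∑ G ∈ Finset.univ.filter
              (fun G : SimpleGraph (Fin n) => ∀ j, G.degree j = dseq j),
            (spanningTreeCountWithDegrees G xseq : ℝ)) /
          ((Finset.univ.filter
              (fun G : SimpleGraph (Fin n) => ∀ j, G.degree j = dseq j)).card : ℝ)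
        = Hd * ((Nat.choose ((∑ j, dseq j) - n) (n - 2) : ℝ))⁻¹ *
            (∏ j, (Nat.choose (dseq j - 1) (xseq j - 1) : ℝ)) *
            Real.exp ((R + davg ^ 2) ^ 2 / (4 * davg ^ 2) - 1 / 4 - lamx - lamx ^ 2
              - (1 / n) * ∑ j, ((xseq j : ℝ) - 1) * ((dseq j : ℝ) - xseq j)
              + E) := by
  refine ⟨1400, by norm_num, 4, ?_⟩
  intro n hn d x hd1 heven hx hxd hsum Δ davg dhat R Hd lamx hΔdef hdavg hdhat hR hHd hlam hcond
  have hn0 : (0 : ℝ) < n := by exact_mod_cast (by omega : 0 < n)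
  have hdΔ : ∀ j, (d j : ℝ) ≤ Δ := fun j => by
    rw [hΔdef]; exact_mod_cast Finset.le_sup (f := d) (Finset.mem_univ j)
  have hM : ∑ j, (d j : ℝ) = davg * n := by rw [hdavg]; field_simp
  have hΔ1 : 1 ≤ Δ := le_trans (by exact_mod_cast hd1 ⟨0, by omega⟩) (hdΔ ⟨0, by omega⟩)
  have hΔ4 : 1 ≤ Δ ^ 4 := one_le_pow₀ hΔ1
  have ht0 : 0 < davg - 2 := pos_of_mul_pos_left (by linarith) hn0.le
  have havgΔ : davg ≤ Δ := by
    rw [hdavg, div_le_iff₀ hn0]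
    have h := Finset.sum_le_card_nsmul Finset.univ (fun j => (d j : ℝ)) Δ fun j _ => hdΔ j
    rw [Finset.card_univ, Fintype.card_fin, nsmul_eq_mul] at h
    linarith
  have hΔ3 : 3 ≤ Δ := by
    have h2 : (2 : ℝ) < Δ := by linarith
    rw [hΔdef] at h2 ⊢
    have h3 : 2 < Finset.univ.sup d := by exact_mod_cast h2
    exact_mod_cast h3
  have h81 : 81 ≤ Δ ^ 4 := by
    have : (3 : ℝ) ^ 4 ≤ Δ ^ 4 := pow_le_pow_left₀ (by norm_num) hΔ3 4
    linarith
  have h9 : 9 * Δ ^ 2 ≤ Δ ^ 4 := by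
    have : (3 : ℝ) ^ 2 ≤ Δ ^ 2 := pow_le_pow_left₀ (by norm_num) hΔ3 2
    calc 9 * Δ ^ 2 ≤ Δ ^ 2 * Δ ^ 2 := mul_le_mul_of_nonneg_right (by linarith) (sq_nonneg Δ)
      _ = Δ ^ 4 := by ring
  have hW : 0 < (davg - 2) * n := by linarith
  obtain ⟨s, hs⟩ := heven
  have hsn : n + 1 ≤ s := by
    have h1 : ((2 * n + 2 : ℕ) : ℝ) ≤ ((s + s : ℕ) : ℝ) := by
      rw [← hs]; push_cast; linarith
    have h2 : 2 * n + 2 ≤ s + s := by exact_mod_cast h1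
    omega
  obtain ⟨b, rfl⟩ : ∃ b, s = n + b := ⟨s - n, by omega⟩
  have hb : 1 ≤ b := by omega
  have hMb : ∑ j, (d j : ℝ) = 2 * ((n + b : ℕ) : ℝ) := by
    rw [← Nat.cast_sum, hs]; push_cast; ring
  have hdb : davg * n = 2 * n + 2 * b := by rw [← hM, hMb]; push_cast; ring
  have hWb : (davg - 2) * n = 2 * b := by linarith
  set Y := (davg - 2) * n + 2 with hY
  have hY0 : 0 < Y := by linarith
  have hxle : ∀ j, (x j : ℝ) ≤ d j := fun j => by exact_mod_cast hxd j
  have hx1 : ∀ j, (1 : ℝ) ≤ x j := fun j => by exact_mod_cast hx j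
  have hcast : ((n - 1 : ℕ) : ℝ) = n - 1 := by rw [Nat.cast_sub (by omega)]; norm_num
  have hMY : ∑ j, (d j : ℝ) = Y + 2 * ((n - 1 : ℕ) : ℝ) := by rw [hM, hY, hcast]; ring
  have hxsum : ∑ j, (x j : ℝ) = 2 * n - 2 := by
    have h : ((∑ j, x j + 2 : ℕ) : ℝ) = ((2 * n : ℕ) : ℝ) := by rw [hsum]
    push_cast at h; linarith
  have hysum : ∑ j, ((d j : ℝ) - x j) = Y := by
    rw [Finset.sum_sub_distrib, hM, hxsum, hY]; ring
  have hecast : ∀ j, ((x j - 1 : ℕ) : ℝ) = x j - 1 := fun j => by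
    rw [Nat.cast_sub (hx j)]; norm_num
  have hesum : ∑ j, (x j - 1) = n - 2 := by
    have h : ∑ j, (x j - 1) + n = ∑ j, x j := by
      calc ∑ j, (x j - 1) + n = ∑ j, (x j - 1) + ∑ _j : Fin n, 1 := by simp
        _ = ∑ j, x j := by
          rw [← Finset.sum_add_distrib]
          exact Finset.sum_congr rfl fun j _ => Nat.sub_add_cancel (hx j)
    omega
  obtain ⟨E₂, hE₂, htree⟩ := exists_treeSum_eq hn hΔ3 (y := fun j => (d j : ℝ) - x j)
    (e := fun j => x j - 1) (fun j => sub_nonneg.2 (hxle j))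
    (fun j => by linarith [hdΔ j, hx1 j]) (fun j => by rw [hecast]; linarith [hdΔ j, hxle j])
    hesum hysum hY hcond (by linarith)
  have hpos : 0 < treeSum (1 / Y) (fun j => (d j : ℝ) - x j) (fun j => x j - 1) := by
    rw [htree]; exact mul_pos (treeCount_pos _) (Real.exp_pos _)
  obtain ⟨E₁, hE₁, hratio⟩ := exists_expectation_eq_treeSum hn ⟨n + b, hs⟩ hx hxd hsum hΔ3 hdΔ
    hMY (by linarith) hpos
  have hpre := abs_log_prefactor_le (by omega : 2 ≤ n) hb hdb
  obtain ⟨hHpos, hHlog⟩ := log_leading_term (by omega : 0 < n) hd1 hdhat ht0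
  rw [← hHd] at hHpos hHlog
  set S := Real.log (n - 2).factorial -
      ∑ i ∈ Finset.range (n - 1), Real.log (2 * ((n + b : ℕ) : ℝ) - 1 - 2 * i) +
      Real.log (Nat.choose (n + 2 * b) (n - 2)) -
    (Real.log (davg - 1) / 2 - 3 / 2 * Real.log (davg - 2) - Real.log n +
      n * ((davg - 1) * Real.log (davg - 1) - davg / 2 * Real.log davg -
        (davg / 2 - 1) * Real.log (davg - 2))) with hS
  have hchoose : ∑ j, d j - n = n + 2 * b := by omega
  have hcpos : (0 : ℝ) < Nat.choose (n + 2 * b) (n - 2) := by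
    exact_mod_cast Nat.choose_pos (by omega)
  have hcj : ∀ j, (0 : ℝ) < Nat.choose (d j - 1) (x j - 1) := fun j => by
    have := hxd j
    exact_mod_cast Nat.choose_pos (by omega)
  have hprod : (0 : ℝ) < ∏ j, (Nat.choose (d j - 1) (x j - 1) : ℝ) :=
    Finset.prod_pos fun j _ => hcj j
  have hlamx : fallTwo (fun j => (d j : ℝ) - x j) / (2 * Y) = lamx := by
    rw [fallTwo_natCast_sub hxd, hlam, hY]; congr 1; ring
  refine ⟨E₁ + E₂ + S, ?_, ?_⟩
  · have hPY : Δ ^ 4 / Y ≤ Δ ^ 4 / ((davg - 2) * n) := by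
      gcongr; linarith
    have hPS : 3 / (b : ℝ) ≤ Δ ^ 4 / ((davg - 2) * n) := by
      have hb0 : (0 : ℝ) < b := by exact_mod_cast hb
      rw [hWb, div_le_div_iff₀ hb0 (by positivity)]
      have := mul_le_mul_of_nonneg_right h81 hb0.le
      linarith
    have hlog : 0 ≤ Real.log n := Real.log_nonneg (by exact_mod_cast (by omega : 1 ≤ n))
    have hmin : 0 ≤ min (Δ ^ 4 / ((davg - 2) ^ 2 * n))
        (min (Δ ^ 3 * Real.log n / ((davg - 2) * n)) (Δ * (davg - 2))) :=
      le_min (by positivity) (le_min (by positivity) (by positivity))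
    have h1 := abs_add_le (E₁ + E₂) S
    have h2 := abs_add_le E₁ E₂
    have hP : 0 ≤ Δ ^ 4 / ((davg - 2) * n) := by positivity
    linarith
  · rw [sum_spanningTreeCount_eq hx hsum, ← numReal_bot_eq_card, hratio, htree, hchoose, hlamx]
    have hcorr := corr_bot_eq (by omega : 0 < n) hdavg (by linarith : 0 < davg) hR
    have hsumlog : ∑ j, Real.log ((d j).descFactorial (x j)) = ∑ j, Real.log (d j) +
        ∑ j, Real.log ((x j - 1).factorial) +
        ∑ j, Real.log (Nat.choose (d j - 1) (x j - 1)) := by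
      rw [← Finset.sum_add_distrib, ← Finset.sum_add_distrib]
      exact Finset.sum_congr rfl fun j _ => log_descFactorial_eq (hx j) (hxd j)
    have hN := treeCount_pos fun j => x j - 1
    have hNlog := log_treeCount fun j => x j - 1
    rw [hesum] at hNlog
    have hplog : Real.log (∏ j, (Nat.choose (d j - 1) (x j - 1) : ℝ)) =
        ∑ j, Real.log (Nat.choose (d j - 1) (x j - 1)) :=
      Real.log_prod fun j _ => (hcj j).ne'
    have hecong : ∑ j, ((x j - 1 : ℕ) : ℝ) * ((d j : ℝ) - x j) =
        ∑ j, ((x j : ℝ) - 1) * ((d j : ℝ) - x j) :=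
      Finset.sum_congr rfl fun j _ => by rw [hecast]
    rw [← Real.exp_log hN, ← Real.exp_log hHpos, ← Real.exp_log hcpos, ← Real.exp_neg,
      ← Real.exp_log hprod, ← Real.exp_add, ← Real.exp_add, ← Real.exp_add, ← Real.exp_add,
      ← Real.exp_add, hNlog, hHlog, hplog, hsumlog, hecong, hMb, ← hcorr, hS]
    congr 1
    ring
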